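/- Let (ρ̄,(ū,0),p̄,Φ₀) be the subsonic background solution on N, fix α∈(1/2,1), μ∈(2,∞) and the point x̄=(x̄₁,0)∈Γ₀, and suppose Φ_bd satisfies ∂_{x₂}Φ_bd = 0 at Γ̄_w ∩ (Γ̄₀ ∪ Γ̄_L). Then there exists σ₂>0, depending only on the data, α and μ, such that if ω₁(b)+ω₂(S_en,B_en)+ω₃(Φ_bd,p_ex)+ω₄(S_en,B_en,Φ_bd) ≤ σ₂, where ω₄(S_en,B_en,Φ_bd) := ‖(S_en, B_en−Φ_bd)−(S₀,B₀)‖_{W^{2,μ}(Γ₀)}, then the solution (ρ,(u,v),p,Φ) of the steady Euler–Poisson boundary value problem produced by the existence theorem (satisfying the stated weighted Hölder estimate) is unique. -/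

import Mathlib

open Real Set Metric MeasureTheory
open scoped ENNReal

noncomputable section

abbrev Pt : Type := ℝ × ℝ

/-- partial derivative in the `x₁` direction -/
def pd1 (f : Pt → ℝ) : Pt → ℝ := fun x => fderiv ℝ f x (1, 0)

/-- partial derivative in the `x₂` direction -/
def pd2 (f : Pt → ℝ) : Pt → ℝ := fun x => fderiv ℝ f x (0, 1)

/-- mixed partial derivative `∂₁^i ∂₂^j` -/
def Dmix (i j : ℕ) (f : Pt → ℝ) : Pt → ℝ := pd1^[i] (pd2^[j] f)

/-- Laplacian -/
def lap (f : Pt → ℝ) : Pt → ℝ := fun x => pd1 (pd1 f) x + pd2 (pd2 f) x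

/-- the nozzle `N = (0,L) × (0,1)` -/
def Noz (L : ℝ) : Set Pt := Ioo 0 L ×ˢ Ioo 0 1

/-- the entrance `Γ₀ = {0} × [0,1]` -/
def Gam0 : Set Pt := {0} ×ˢ Icc 0 1

/-- the exit `Γ_L = {L} × [0,1]` -/
def GamL (L : ℝ) : Set Pt := {L} ×ˢ Icc 0 1

/-- the insulated walls `Γ_w = (0,L) × {0,1}` -/
def GamW (L : ℝ) : Set Pt := Ioo 0 L ×ˢ ({0, 1} : Set ℝ)

/-- the closed walls `Γ̄_w = [0,L] × {0,1}` -/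
def GamWbar (L : ℝ) : Set Pt := Icc 0 L ×ˢ ({0, 1} : Set ℝ)

/-- `f` is `C^m` on an open neighborhood of `K` (encoding of "`C^m` up to the boundary") -/
def UpTo (m : ℕ) (f : Pt → ℝ) (K : Set Pt) : Prop :=
  ∃ U : Set Pt, IsOpen U ∧ K ⊆ U ∧ ContDiffOn ℝ m f U

/-! ### Hölder norms (ℝ≥0∞–valued) -/

def supAbs (Ω : Set Pt) (g : Pt → ℝ) : ℝ≥0∞ := ⨆ x ∈ Ω, ENNReal.ofReal |g x|

def hSemi (α : ℝ) (Ω : Set Pt) (g : Pt → ℝ) : ℝ≥0∞ :=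
  ⨆ x ∈ Ω, ⨆ y ∈ Ω, ⨆ _ : x ≠ y, ENNReal.ofReal (|g x - g y| / ‖x - y‖ ^ α)

def idxLe (m : ℕ) : Finset (ℕ × ℕ) :=
  (Finset.range (m+1) ×ˢ Finset.range (m+1)).filter (fun p => p.1 + p.2 ≤ m)

def idxEq (m : ℕ) : Finset (ℕ × ℕ) :=
  (Finset.range (m+1) ×ˢ Finset.range (m+1)).filter (fun p => p.1 + p.2 = m)

/-- the Hölder norm `‖f‖_{m,α,Ω}` -/
def hNorm (m : ℕ) (α : ℝ) (Ω : Set Pt) (f : Pt → ℝ) : ℝ≥0∞ :=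
  ∑ p ∈ idxLe m, supAbs Ω (Dmix p.1 p.2 f) + ∑ p ∈ idxEq m, hSemi α Ω (Dmix p.1 p.2 f)

/-- the `C^k` sup norm `‖f‖_{k,Ω}` -/
def ckNorm (k : ℕ) (Ω : Set Pt) (f : Pt → ℝ) : ℝ≥0∞ :=
  ∑ p ∈ idxLe k, supAbs Ω (Dmix p.1 p.2 f)

def wSup (k : ℝ) (Γ Ω : Set Pt) (d : ℕ) (g : Pt → ℝ) : ℝ≥0∞ :=
  ⨆ x ∈ Ω, ENNReal.ofReal (infDist x Γ ^ (max ((d : ℝ) + k) 0) * |g x|)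

def wSemi (m : ℕ) (α k : ℝ) (Γ Ω : Set Pt) (g : Pt → ℝ) : ℝ≥0∞ :=
  ⨆ x ∈ Ω, ⨆ y ∈ Ω, ⨆ _ : x ≠ y,
    ENNReal.ofReal ((min (infDist x Γ) (infDist y Γ)) ^ (max ((m : ℝ) + α + k) 0) *
      (|g x - g y| / ‖x - y‖ ^ α))

/-- the weighted Hölder norm `‖f‖^{(k,Γ)}_{m,α,Ω}` -/
def whNorm (m : ℕ) (α k : ℝ) (Γ Ω : Set Pt) (f : Pt → ℝ) : ℝ≥0∞ :=
  ∑ p ∈ idxLe m, wSup k Γ Ω (p.1 + p.2) (Dmix p.1 p.2 f)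
  + ∑ p ∈ idxEq m, wSemi m α k Γ Ω (Dmix p.1 p.2 f)

/-! ### one–dimensional versions, for norms of boundary data -/

def supAbs1 (Ω : Set ℝ) (g : ℝ → ℝ) : ℝ≥0∞ := ⨆ x ∈ Ω, ENNReal.ofReal |g x|

def hSemi1 (α : ℝ) (Ω : Set ℝ) (g : ℝ → ℝ) : ℝ≥0∞ :=
  ⨆ x ∈ Ω, ⨆ y ∈ Ω, ⨆ _ : x ≠ y, ENNReal.ofReal (|g x - g y| / |x - y| ^ α)

/-- the one–dimensional Hölder norm `‖f‖_{m,α,Ω}` -/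
def h1Norm (m : ℕ) (α : ℝ) (Ω : Set ℝ) (f : ℝ → ℝ) : ℝ≥0∞ :=
  ∑ i ∈ Finset.range (m+1), supAbs1 Ω (deriv^[i] f) + hSemi1 α Ω (deriv^[m] f)

def wSup1 (k : ℝ) (Γ Ω : Set ℝ) (d : ℕ) (g : ℝ → ℝ) : ℝ≥0∞ :=
  ⨆ x ∈ Ω, ENNReal.ofReal (infDist x Γ ^ (max ((d : ℝ) + k) 0) * |g x|)

def wSemi1 (m : ℕ) (α k : ℝ) (Γ Ω : Set ℝ) (g : ℝ → ℝ) : ℝ≥0∞ :=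
  ⨆ x ∈ Ω, ⨆ y ∈ Ω, ⨆ _ : x ≠ y,
    ENNReal.ofReal ((min (infDist x Γ) (infDist y Γ)) ^ (max ((m : ℝ) + α + k) 0) *
      (|g x - g y| / |x - y| ^ α))

/-- the one–dimensional weighted Hölder norm `‖f‖^{(k,Γ)}_{m,α,Ω}` -/
def wh1Norm (m : ℕ) (α k : ℝ) (Γ Ω : Set ℝ) (f : ℝ → ℝ) : ℝ≥0∞ :=
  ∑ i ∈ Finset.range (m+1), wSup1 k Γ Ω i (deriv^[i] f) + wSemi1 m α k Γ Ω (deriv^[m] f)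

/-! ### gas quantities and the background solution -/

/-- density as a function of entropy `S` and `ζ = K + Φ − |u|²/2` -/
def Hfun (γ 𝔭 cv S ζ : ℝ) : ℝ := ((γ - 1) * ζ / (γ * 𝔭 * exp (S / cv))) ^ (1 / (γ - 1))

/-- temperature -/
def Tfun (γ 𝔭 cv ρ S : ℝ) : ℝ := (cv * 𝔭 / (γ - 1)) * exp (S / cv) * ρ ^ (γ - 1)

/-- the background Bernoulli constant `B₀ = ū(0)²/2 + γ𝔭e^{S₀/c_v}ρ₀^{γ−1}/(γ−1)` -/
def Bern0 (γ 𝔭 cv S₀ J₀ ρ₀ : ℝ) : ℝ :=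
  (J₀ / ρ₀) ^ 2 / 2 + γ * 𝔭 * exp (S₀ / cv) * ρ₀ ^ (γ - 1) / (γ - 1)

/-- the Bernoulli function of a flow `(ρ, u, v, p)` -/
def BernFn (γ : ℝ) (ρ u v p : Pt → ℝ) : Pt → ℝ :=
  fun y => (u y ^ 2 + v y ^ 2) / 2 + γ * p y / ((γ - 1) * ρ y)

/-- the background electric potential `Φ₀` -/
def Phi0 (Eb : ℝ → ℝ) : Pt → ℝ := fun x => ∫ t in (0:ℝ)..x.1, Eb t

/-- the background velocity potential `φ₀` -/
def phi0 (J₀ : ℝ) (ρb : ℝ → ℝ) : Pt → ℝ := fun x => ∫ t in (0:ℝ)..x.1, J₀ / ρb t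

/-- `(ρb, Eb)` is the subsonic background solution of Proposition 2.1 associated with the
data `(b₀, S₀, J₀, ρ₀, E₀, L)`, with density bounds `ρlow, ρhigh` and subsonicity bound `ν₀`. -/
structure Background (γ 𝔭 cv b₀ J₀ S₀ E₀ ρ₀ L ν₀ ρlow ρhigh : ℝ) (ρb Eb : ℝ → ℝ) : Prop where
  hγ : 1 < γ
  h𝔭 : 0 < 𝔭
  hcv : 0 < cv
  hb₀ : 0 < b₀
  hJ₀ : 0 < J₀
  hS₀ : 0 < S₀
  hL : 0 < L
  hν₀ : 0 < ν₀
  hρlow : 0 < ρlow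
  smooth_rho : ContDiffOn ℝ (⊤ : ℕ∞) ρb (Icc 0 L)
  smooth_E : ContDiffOn ℝ (⊤ : ℕ∞) Eb (Icc 0 L)
  init_rho : ρb 0 = ρ₀
  init_E : Eb 0 = E₀
  ode_rho : ∀ x ∈ Icc 0 L, derivWithin ρb (Icc 0 L) x =
      ρb x * Eb x / (γ * 𝔭 * exp (S₀ / cv) * ρb x ^ (γ - 1) - J₀ ^ 2 / ρb x ^ 2)
  ode_E : ∀ x ∈ Icc 0 L, derivWithin Eb (Icc 0 L) x = ρb x - b₀
  bound_lo : ∀ x ∈ Icc 0 L, ρlow ≤ ρb x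
  bound_hi : ∀ x ∈ Icc 0 L, ρb x ≤ ρhigh
  subsonic : ∀ x ∈ Icc 0 L, ν₀ ≤ γ * 𝔭 * exp (S₀ / cv) * ρb x ^ (γ - 1) - J₀ ^ 2 / ρb x ^ 2

/-! ### sizes of the perturbations -/

/-- `ω₁(b) = ‖b − b₀‖_{α,N}` -/
def om1 (α b₀ L : ℝ) (b : Pt → ℝ) : ℝ≥0∞ := hNorm 0 α (Noz L) (fun x => b x - b₀)

/-- `ω₂(S_en, B_en) = ‖(S_en,B_en) − (S₀,B₀)‖_{1,α,Γ₀}` -/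
def om2 (α S₀ B₀ : ℝ) (Sen Ben : ℝ → ℝ) : ℝ≥0∞ :=
  h1Norm 1 α (Icc 0 1) (fun t => Sen t - S₀) + h1Norm 1 α (Icc 0 1) (fun t => Ben t - B₀)

/-- `ω₃(Φ_bd, p_ex)`, where `Φ_bd` is described by its two traces `Φbd0` on `Γ₀` and
`ΦbdL` on `Γ_L` (as functions of `x₂`), and the background potential vanishes on `Γ₀`. -/
def om3 (γ 𝔭 cv S₀ α L : ℝ) (ρb Eb : ℝ → ℝ) (Φbd0 ΦbdL pex : ℝ → ℝ) : ℝ≥0∞ :=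
  wh1Norm 2 α (-1-α) {0, 1} (Icc 0 1) Φbd0
  + wh1Norm 2 α (-1-α) {0, 1} (Icc 0 1) (fun t => ΦbdL t - ∫ s in (0:ℝ)..L, Eb s)
  + wh1Norm 1 α (-α) {0, 1} (Icc 0 1) (fun t => pex t - 𝔭 * exp (S₀ / cv) * ρb L ^ γ)

/-- the `W^{2,μ}` norm on `Γ₀ ≃ [0,1]` -/
def W2mu (μ : ℝ) (f : ℝ → ℝ) : ℝ :=
  (∫ t in (0:ℝ)..1, (|f t| ^ μ + |deriv f t| ^ μ + |deriv (deriv f) t| ^ μ)) ^ (1 / μ)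

/-- `ω₄(S_en, B_en, Φ_bd) = ‖(S_en, B_en − Φ_bd) − (S₀, B₀)‖_{W^{2,μ}(Γ₀)}` -/
def om4 (μ S₀ B₀ : ℝ) (Sen Ben Φbd0 : ℝ → ℝ) : ℝ :=
  W2mu μ (fun t => Sen t - S₀) + W2mu μ (fun t => Ben t - Φbd0 t - B₀)

/-- `(ρ, (u,v), p, Φ)` is a classical solution of the steady Euler–Poisson system in the
nozzle `N` with the boundary conditions of Problem 1 (entropy, Bernoulli function and
vanishing vertical velocity at the entrance; electric potential difference from the corner
`x̄ = (0,0)` on the non-insulated boundary; slip and insulation conditions on the walls;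
prescribed pressure at the exit), normalized by `Φ(x̄) = 0`. -/
def EPSol (γ 𝔭 cv L : ℝ) (b : Pt → ℝ) (Sen Ben Φbd0 ΦbdL pex : ℝ → ℝ)
    (ρ u v p Φ : Pt → ℝ) : Prop :=
  -- regularity: `(ρ, u, v, p) ∈ C¹` and `Φ ∈ C²` up to the boundary
  UpTo 1 ρ (closure (Noz L)) ∧ UpTo 1 u (closure (Noz L)) ∧ UpTo 1 v (closure (Noz L)) ∧
  UpTo 1 p (closure (Noz L)) ∧ UpTo 2 Φ (closure (Noz L)) ∧
  (∀ x ∈ closure (Noz L), 0 < ρ x ∧ 0 < u x) ∧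
  -- the steady Euler–Poisson system in `N`
  (∀ x ∈ Noz L,
    pd1 (fun y => ρ y * u y) x + pd2 (fun y => ρ y * v y) x = 0 ∧
    pd1 (fun y => ρ y * u y ^ 2 + p y) x + pd2 (fun y => ρ y * u y * v y) x
      = ρ x * pd1 Φ x ∧
    pd1 (fun y => ρ y * u y * v y) x + pd2 (fun y => ρ y * v y ^ 2 + p y) x
      = ρ x * pd2 Φ x ∧
    pd1 (fun y => ρ y * u y * BernFn γ ρ u v p y) x
      + pd2 (fun y => ρ y * v y * BernFn γ ρ u v p y) x
      = ρ x * (u x * pd1 Φ x + v x * pd2 Φ x) ∧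
    lap Φ x = ρ x - b x) ∧
  -- normalization `Φ(x̄) = 0` at `x̄ = (0,0) ∈ Γ₀`
  Φ (0, 0) = 0 ∧
  -- boundary conditions on the entrance and the exit
  (∀ t ∈ Icc (0:ℝ) 1,
    cv * Real.log (p (0, t) / (𝔭 * ρ (0, t) ^ γ)) = Sen t ∧
    BernFn γ ρ u v p (0, t) = Ben t ∧
    v (0, t) = 0 ∧
    Φ (0, t) - Φ (0, 0) = Φbd0 t ∧
    Φ (L, t) - Φ (0, 0) = ΦbdL t ∧
    p (L, t) = pex t) ∧
  -- boundary conditions on the walls: `(u,v)·n_w = 0` and `∂_{n_w}Φ = 0`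
  (∀ x ∈ GamW L, v x = 0 ∧ pd2 Φ x = 0)

/-- the weighted Hölder estimate for solutions of the Euler–Poisson problem -/
def EPEst (γ 𝔭 cv J₀ S₀ L α C : ℝ) (ρb Eb : ℝ → ℝ) (ρ u v p Φ : Pt → ℝ)
    (ω : ℝ≥0∞) : Prop :=
  whNorm 1 α (-α) (GamWbar L) (Noz L) (fun x => ρ x - ρb x.1)
  + whNorm 1 α (-α) (GamWbar L) (Noz L) (fun x => u x - J₀ / ρb x.1)
  + whNorm 1 α (-α) (GamWbar L) (Noz L) v
  + whNorm 1 α (-α) (GamWbar L) (Noz L) (fun x => p x - 𝔭 * exp (S₀ / cv) * ρb x.1 ^ γ)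
  + whNorm 2 α (-1-α) (GamWbar L) (Noz L) (fun x => Φ x - Phi0 Eb x)
  ≤ ENNReal.ofReal C * ω


/-! ### The closed nozzle and `C¹` functions on it -/

/-- the closed rectangle `[0,L] × [0,1]` -/
def Rect (L : ℝ) : Set Pt := Icc 0 L ×ˢ Icc 0 1

/-- `f` is `C¹` near every point of the closed rectangle -/
def C1R (L : ℝ) (f : Pt → ℝ) : Prop := ∀ x ∈ Rect L, ContDiffAt ℝ 1 f x

theorem closure_Noz {L : ℝ} (hL : 0 < L) : closure (Noz L) = Rect L := by
  rw [Noz, closure_prod_eq, closure_Ioo hL.ne, closure_Ioo zero_ne_one, Rect]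

theorem Noz_subset_Rect (L : ℝ) : Noz L ⊆ Rect L :=
  prod_mono Ioo_subset_Icc_self Ioo_subset_Icc_self

theorem isOpen_Noz (L : ℝ) : IsOpen (Noz L) := isOpen_Ioo.prod isOpen_Ioo

theorem isCompact_Rect (L : ℝ) : IsCompact (Rect L) := isCompact_Icc.prod isCompact_Icc

theorem measurableSet_Rect (L : ℝ) : MeasurableSet (Rect L) := (isCompact_Rect L).measurableSet

theorem Rect_eq_Icc (L : ℝ) : Rect L = Icc ((0, 0) : Pt) (L, 1) := by
  rw [Rect, Icc_prod_eq]

theorem mem_Rect {L a c : ℝ} (ha : a ∈ Icc 0 L) (hc : c ∈ Icc (0 : ℝ) 1) : ((a, c) : Pt) ∈ Rect L :=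
  ⟨ha, hc⟩

theorem Rect_mono {l L : ℝ} (h : l ≤ L) : Rect l ⊆ Rect L :=
  prod_mono (Icc_subset_Icc_right h) le_rfl

theorem Noz_mono {l L : ℝ} (h : l ≤ L) : Noz l ⊆ Noz L :=
  prod_mono (Ioo_subset_Ioo_right h) le_rfl

theorem le_on_Rect {L : ℝ} (hL : 0 < L) {F G : Pt → ℝ} (hF : ContinuousOn F (Rect L))
    (hG : ContinuousOn G (Rect L)) (h : ∀ x ∈ Noz L, F x ≤ G x) : ∀ x ∈ Rect L, F x ≤ G x := by
  intro x hx
  rw [← closure_Noz hL] at hF hG hx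
  exact ContinuousWithinAt.closure_le hx ((hF x hx).mono subset_closure)
    ((hG x hx).mono subset_closure) h

theorem eq_on_Rect {L : ℝ} (hL : 0 < L) {F G : Pt → ℝ} (hF : ContinuousOn F (Rect L))
    (hG : ContinuousOn G (Rect L)) (h : ∀ x ∈ Noz L, F x = G x) : ∀ x ∈ Rect L, F x = G x :=
  fun x hx => le_antisymm (le_on_Rect hL hF hG (fun y hy => (h y hy).le) x hx)
    (le_on_Rect hL hG hF (fun y hy => (h y hy).ge) x hx)

namespace C1R

variable {L : ℝ} {f g : Pt → ℝ}

theorem mono {l : ℝ} (hf : C1R L f) (h : l ≤ L) : C1R l f := fun x hx => hf x (Rect_mono h hx)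

theorem differentiableAt (hf : C1R L f) {x : Pt} (hx : x ∈ Rect L) : DifferentiableAt ℝ f x :=
  (hf x hx).differentiableAt one_ne_zero

theorem continuousOn (hf : C1R L f) : ContinuousOn f (Rect L) :=
  fun x hx => (hf x hx).continuousAt.continuousWithinAt

theorem continuousOn_fderiv_apply (hf : C1R L f) (e : Pt) :
    ContinuousOn (fun x => fderiv ℝ f x e) (Rect L) := fun x hx =>
  (((hf x hx).fderiv_right (m := 0) (by simp)).continuousAt.clm_apply
    continuousAt_const).continuousWithinAt

theorem continuousOn_pd1 (hf : C1R L f) : ContinuousOn (pd1 f) (Rect L) :=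
  hf.continuousOn_fderiv_apply _

theorem continuousOn_pd2 (hf : C1R L f) : ContinuousOn (pd2 f) (Rect L) :=
  hf.continuousOn_fderiv_apply _

theorem const (c : ℝ) : C1R L (fun _ => c) := fun _ _ => contDiffAt_const

theorem add (hf : C1R L f) (hg : C1R L g) : C1R L (fun x => f x + g x) :=
  fun x hx => (hf x hx).add (hg x hx)

theorem sub (hf : C1R L f) (hg : C1R L g) : C1R L (fun x => f x - g x) :=
  fun x hx => (hf x hx).sub (hg x hx)

theorem mul (hf : C1R L f) (hg : C1R L g) : C1R L (fun x => f x * g x) :=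
  fun x hx => (hf x hx).mul (hg x hx)

theorem neg (hf : C1R L f) : C1R L (fun x => - f x) :=
  fun x hx => (hf x hx).neg

theorem pow (hf : C1R L f) (n : ℕ) : C1R L (fun x => f x ^ n) :=
  fun x hx => (hf x hx).pow n

theorem inv (hf : C1R L f) (h0 : ∀ x ∈ Rect L, f x ≠ 0) : C1R L (fun x => (f x)⁻¹) :=
  fun x hx => (hf x hx).inv (h0 x hx)

end C1R

section rules

variable {f g : Pt → ℝ} {x : Pt}

theorem fderiv_mul_apply' (hf : DifferentiableAt ℝ f x) (hg : DifferentiableAt ℝ g x) (e : Pt) :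
    fderiv ℝ (fun y => f y * g y) x e = f x * fderiv ℝ g x e + g x * fderiv ℝ f x e := by
  rw [fderiv_fun_mul hf hg]; simp

theorem pd1_mul (hf : DifferentiableAt ℝ f x) (hg : DifferentiableAt ℝ g x) :
    pd1 (fun y => f y * g y) x = f x * pd1 g x + g x * pd1 f x := fderiv_mul_apply' hf hg _

theorem pd2_mul (hf : DifferentiableAt ℝ f x) (hg : DifferentiableAt ℝ g x) :
    pd2 (fun y => f y * g y) x = f x * pd2 g x + g x * pd2 f x := fderiv_mul_apply' hf hg _

theorem pd1_add (hf : DifferentiableAt ℝ f x) (hg : DifferentiableAt ℝ g x) :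
    pd1 (fun y => f y + g y) x = pd1 f x + pd1 g x := by
  simp only [pd1]; rw [fderiv_fun_add hf hg]; simp

theorem pd2_add (hf : DifferentiableAt ℝ f x) (hg : DifferentiableAt ℝ g x) :
    pd2 (fun y => f y + g y) x = pd2 f x + pd2 g x := by
  simp only [pd2]; rw [fderiv_fun_add hf hg]; simp

theorem pd1_sub (hf : DifferentiableAt ℝ f x) (hg : DifferentiableAt ℝ g x) :
    pd1 (fun y => f y - g y) x = pd1 f x - pd1 g x := by
  simp only [pd1]; rw [fderiv_fun_sub hf hg]; simp

theorem pd2_sub (hf : DifferentiableAt ℝ f x) (hg : DifferentiableAt ℝ g x) :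
    pd2 (fun y => f y - g y) x = pd2 f x - pd2 g x := by
  simp only [pd2]; rw [fderiv_fun_sub hf hg]; simp

theorem pd1_pow (hf : DifferentiableAt ℝ f x) (n : ℕ) :
    pd1 (fun y => f y ^ n) x = n * f x ^ (n - 1) * pd1 f x := by
  simp only [pd1]; rw [fderiv_fun_pow n hf]; simp

theorem pd2_pow (hf : DifferentiableAt ℝ f x) (n : ℕ) :
    pd2 (fun y => f y ^ n) x = n * f x ^ (n - 1) * pd2 f x := by
  simp only [pd2]; rw [fderiv_fun_pow n hf]; simp

theorem pd1_neg : pd1 (fun y => - f y) x = - pd1 f x := by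
  simp only [pd1]; rw [fderiv_fun_neg]; simp

theorem pd1_inv (hf : DifferentiableAt ℝ f x) (h0 : f x ≠ 0) :
    pd1 (fun y => (f y)⁻¹) x = - ((f x)⁻¹) ^ 2 * pd1 f x := by
  simp only [pd1]
  have h := ((hasDerivAt_inv h0).comp_hasFDerivAt x hf.hasFDerivAt).fderiv
  simp only [Function.comp_def] at h
  rw [h]; simp

theorem pd2_inv (hf : DifferentiableAt ℝ f x) (h0 : f x ≠ 0) :
    pd2 (fun y => (f y)⁻¹) x = - ((f x)⁻¹) ^ 2 * pd2 f x := by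
  simp only [pd2]
  have h := ((hasDerivAt_inv h0).comp_hasFDerivAt x hf.hasFDerivAt).fderiv
  simp only [Function.comp_def] at h
  rw [h]; simp

theorem hasDerivAt_fst (hf : DifferentiableAt ℝ f x) :
    HasDerivAt (fun t => f (t, x.2)) (pd1 f x) x.1 := by
  have h1 : HasFDerivAt f (fderiv ℝ f x) (x.1, x.2) := hf.hasFDerivAt
  exact h1.comp_hasDerivAt x.1 ((hasDerivAt_id x.1).prodMk (hasDerivAt_const x.1 x.2))

theorem hasDerivAt_snd (hf : DifferentiableAt ℝ f x) :
    HasDerivAt (fun t => f (x.1, t)) (pd2 f x) x.2 := by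
  have h1 : HasFDerivAt f (fderiv ℝ f x) (x.1, x.2) := hf.hasFDerivAt
  exact h1.comp_hasDerivAt x.2 ((hasDerivAt_const x.2 x.1).prodMk (hasDerivAt_id x.2))

end rules

/-! ### Integration over the rectangle -/

theorem ContinuousOn.integrableOn_Rect {L : ℝ} {F : Pt → ℝ} (hF : ContinuousOn F (Rect L)) :
    IntegrableOn F (Rect L) := hF.integrableOn_compact (isCompact_Rect L)

theorem ContinuousOn.slice_fst {L : ℝ} {F : Pt → ℝ} (hF : ContinuousOn F (Rect L)) {a : ℝ}
    (ha : a ∈ Icc 0 L) : ContinuousOn (fun y => F (a, y)) (Icc 0 1) :=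
  hF.comp (by fun_prop) fun _ hy => mem_Rect ha hy

theorem ContinuousOn.slice_snd {L : ℝ} {F : Pt → ℝ} (hF : ContinuousOn F (Rect L)) {c : ℝ}
    (hc : c ∈ Icc (0 : ℝ) 1) : ContinuousOn (fun x => F (x, c)) (Icc 0 L) :=
  hF.comp (by fun_prop) fun _ hy => mem_Rect hy hc

theorem integral_Rect_mono {L : ℝ} {F G : Pt → ℝ} (hF : ContinuousOn F (Rect L))
    (hG : ContinuousOn G (Rect L)) (h : ∀ x ∈ Rect L, F x ≤ G x) :
    ∫ x in Rect L, F x ≤ ∫ x in Rect L, G x :=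
  setIntegral_mono_on hF.integrableOn_Rect hG.integrableOn_Rect (measurableSet_Rect L) h

theorem integral_Rect_nonneg {L : ℝ} {F : Pt → ℝ} (h : ∀ x ∈ Rect L, 0 ≤ F x) :
    0 ≤ ∫ x in Rect L, F x := setIntegral_nonneg (measurableSet_Rect L) h

theorem integral_Rect_mono_domain {l L : ℝ} (hl : l ≤ L) {F : Pt → ℝ}
    (hF : ContinuousOn F (Rect L)) (h : ∀ x ∈ Rect L, 0 ≤ F x) :
    ∫ x in Rect l, F x ≤ ∫ x in Rect L, F x :=
  setIntegral_mono_set hF.integrableOn_Rect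
    ((ae_restrict_iff' (measurableSet_Rect L)).2 (Filter.Eventually.of_forall h))
    (Rect_mono hl).eventuallyLE

theorem integral_Rect_add {L : ℝ} {F G : Pt → ℝ} (hF : ContinuousOn F (Rect L))
    (hG : ContinuousOn G (Rect L)) :
    ∫ x in Rect L, (F x + G x) = (∫ x in Rect L, F x) + ∫ x in Rect L, G x :=
  integral_add hF.integrableOn_Rect hG.integrableOn_Rect

theorem integral_Rect_eq {L : ℝ} (hL : 0 ≤ L) {F : Pt → ℝ} (hF : ContinuousOn F (Rect L)) :
    ∫ x in Rect L, F x = ∫ x in (0:ℝ)..L, ∫ y in (0:ℝ)..1, F (x, y) := by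
  have hi := hF.integrableOn_Rect
  rw [Rect, Measure.volume_eq_prod] at *
  rw [setIntegral_prod _ hi, intervalIntegral.integral_of_le hL, integral_Icc_eq_integral_Ioc]
  simp_rw [intervalIntegral.integral_of_le (zero_le_one' ℝ), integral_Icc_eq_integral_Ioc]

theorem integral_Rect_eq_swap {L : ℝ} (hL : 0 ≤ L) {F : Pt → ℝ} (hF : ContinuousOn F (Rect L)) :
    ∫ x in Rect L, F x = ∫ y in (0:ℝ)..1, ∫ x in (0:ℝ)..L, F (x, y) := by
  have hi : IntegrableOn (fun z : ℝ × ℝ => F z.swap) (Icc (0:ℝ) 1 ×ˢ Icc (0:ℝ) L) := by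
    refine ContinuousOn.integrableOn_compact (isCompact_Icc.prod isCompact_Icc) ?_
    exact hF.comp continuous_swap.continuousOn fun x hx => ⟨hx.2, hx.1⟩
  rw [Rect]
  rw [Measure.volume_eq_prod] at *
  rw [← setIntegral_prod_swap, setIntegral_prod _ hi, intervalIntegral.integral_of_le zero_le_one,
    integral_Icc_eq_integral_Ioc]
  simp_rw [intervalIntegral.integral_of_le hL, integral_Icc_eq_integral_Ioc]
  rfl

/-- divergence theorem on `[0,l] × [0,1]` -/
theorem integral_Rect_div {l : ℝ} (hl : 0 ≤ l) {f g D : Pt → ℝ} (hf : ContinuousOn f (Rect l))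
    (hg : ContinuousOn g (Rect l)) (hD : ContinuousOn D (Rect l))
    (df : ∀ x ∈ Noz l, DifferentiableAt ℝ f x) (dg : ∀ x ∈ Noz l, DifferentiableAt ℝ g x)
    (h : ∀ x ∈ Noz l, pd1 f x + pd2 g x = D x) :
    ∫ x in Rect l, D x = (((∫ x in (0:ℝ)..l, g (x, 1)) - ∫ x in (0:ℝ)..l, g (x, 0)) +
      ∫ y in (0:ℝ)..1, f (l, y)) - ∫ y in (0:ℝ)..1, f (0, y) := by
  classical
  let f' : Pt → Pt →L[ℝ] ℝ := fun x =>
    if x ∈ Noz l then fderiv ℝ f x else D x • ContinuousLinearMap.fst ℝ ℝ ℝ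
  let g' : Pt → Pt →L[ℝ] ℝ := fun x => if x ∈ Noz l then fderiv ℝ g x else 0
  have hfg : ∀ x, f' x (1, 0) + g' x (0, 1) = D x := by
    intro x
    by_cases hx : x ∈ Noz l
    · simpa [f', g', hx, pd1, pd2] using h x hx
    · simp [f', g', hx]
  have key := integral_divergence_prod_Icc_of_hasFDerivAt_of_le f g f' g' (0, 0) (l, 1)
    ⟨hl, zero_le_one⟩ (by rwa [← Rect_eq_Icc]) (by rwa [← Rect_eq_Icc])
    (fun x hx => by
      have hx' : x ∈ Noz l := hx
      simpa [f', hx'] using (df x hx').hasFDerivAt)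
    (fun x hx => by
      have hx' : x ∈ Noz l := hx
      simpa [g', hx'] using (dg x hx').hasFDerivAt)
    (by simp_rw [hfg]; rw [← Rect_eq_Icc]; exact hD.integrableOn_Rect)
  simp_rw [hfg] at key
  rw [Rect_eq_Icc]
  exact key

/-! ### Primitives in the `x₁` direction -/

/-- the primitive of `f` in the `x₁` direction vanishing at the entrance -/
def prim (f : Pt → ℝ) : Pt → ℝ := fun x => ∫ s in (0:ℝ)..x.1, f (s, x.2)

theorem exists_continuous_eqOn_Rect {L : ℝ} (hL : 0 ≤ L) {F : Pt → ℝ}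
    (hF : ContinuousOn F (Rect L)) : ∃ G : Pt → ℝ, Continuous G ∧ EqOn G F (Rect L) := by
  refine ⟨fun x => F (max 0 (min L x.1), max 0 (min 1 x.2)), ?_, ?_⟩
  · refine hF.comp_continuous (by fun_prop) fun x => ?_
    exact ⟨⟨le_max_left _ _, max_le hL (min_le_left _ _)⟩,
      ⟨le_max_left _ _, max_le zero_le_one (min_le_left _ _)⟩⟩
  · rintro ⟨a, c⟩ ⟨⟨h1, h2⟩, ⟨h3, h4⟩⟩
    simp only at h1 h2 h3 h4
    simp [h1, h2, h3, h4]

theorem ContinuousOn.prim {L : ℝ} (hL : 0 ≤ L) {f : Pt → ℝ} (hf : ContinuousOn f (Rect L)) :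
    ContinuousOn (prim f) (Rect L) := by
  obtain ⟨G, hG, hGf⟩ := exists_continuous_eqOn_Rect hL hf
  have h : Continuous fun x : Pt => ∫ s in (0:ℝ)..x.1, G (s, x.2) :=
    intervalIntegral.continuous_parametric_intervalIntegral_of_continuous
      (f := fun (x : Pt) s => G (s, x.2)) (by unfold Function.uncurry; fun_prop) continuous_fst
  refine h.continuousOn.congr fun x hx => ?_
  refine intervalIntegral.integral_congr fun s hs => ?_
  rw [uIcc_of_le hx.1.1] at hs
  exact (hGf (mem_Rect ⟨hs.1, hs.2.trans hx.1.2⟩ hx.2)).symm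

theorem ContinuousOn.integral_snd {L : ℝ} (hL : 0 ≤ L) {F : Pt → ℝ}
    (hF : ContinuousOn F (Rect L)) :
    ContinuousOn (fun x => ∫ y in (0:ℝ)..1, F (x, y)) (Icc 0 L) := by
  obtain ⟨G, hG, hGf⟩ := exists_continuous_eqOn_Rect hL hF
  have h : Continuous fun x : ℝ => ∫ y in (0:ℝ)..1, G (x, y) :=
    intervalIntegral.continuous_parametric_intervalIntegral_of_continuous'
      (by unfold Function.uncurry; fun_prop) 0 1
  refine h.continuousOn.congr fun x hx => ?_
  refine intervalIntegral.integral_congr fun s hs => ?_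
  rw [uIcc_of_le zero_le_one] at hs
  exact (hGf (mem_Rect hx hs)).symm

theorem ContinuousOn.integral_fst {L : ℝ} (hL : 0 ≤ L) {F : Pt → ℝ}
    (hF : ContinuousOn F (Rect L)) :
    ContinuousOn (fun y => ∫ x in (0:ℝ)..L, F (x, y)) (Icc 0 1) := by
  obtain ⟨G, hG, hGf⟩ := exists_continuous_eqOn_Rect hL hF
  have h : Continuous fun y : ℝ => ∫ x in (0:ℝ)..L, G (x, y) :=
    intervalIntegral.continuous_parametric_intervalIntegral_of_continuous'
      (by unfold Function.uncurry; fun_prop) 0 L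
  refine h.continuousOn.congr fun x hx => ?_
  refine intervalIntegral.integral_congr fun s hs => ?_
  rw [uIcc_of_le hL] at hs
  exact (hGf (mem_Rect hs hx)).symm

theorem hasDerivAt_prim_fst {L : ℝ} {f : Pt → ℝ} (hf : ContinuousOn f (Rect L)) {x : Pt}
    (h1 : x.1 ∈ Ioo 0 L) (h2 : x.2 ∈ Icc (0 : ℝ) 1) :
    HasDerivAt (fun t => prim f (t, x.2)) (f x) x.1 := by
  have hc : ContinuousOn (fun s => f (s, x.2)) (Icc 0 L) := hf.slice_snd h2
  have hx : Icc 0 L ∈ nhds x.1 := Icc_mem_nhds h1.1 h1.2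
  refine intervalIntegral.integral_hasDerivAt_right (f := fun s => f (s, x.2)) ?_ ?_
    (hc.continuousAt hx)
  · exact (hc.mono (Icc_subset_Icc_right h1.2.le)).intervalIntegrable_of_Icc h1.1.le
  · exact hc.stronglyMeasurableAtFilter_nhdsWithin measurableSet_Icc x.1 |>.filter_mono
      (by rw [nhdsWithin_eq_nhds.2 hx])

theorem hasDerivAt_prim_snd {L : ℝ} {f : Pt → ℝ} (hf : C1R L f) {x : Pt}
    (h1 : x.1 ∈ Icc 0 L) (h2 : x.2 ∈ Ioo (0 : ℝ) 1) :
    HasDerivAt (fun t => prim f (x.1, t)) (prim (pd2 f) x) x.2 := by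
  obtain ⟨C, hC⟩ := (isCompact_Rect L).exists_bound_of_continuousOn hf.continuousOn_pd2
  have hsub : ∀ t ∈ uIoc 0 x.1, t ∈ Icc 0 L := by
    intro t ht
    rw [uIoc_of_le h1.1] at ht
    exact ⟨ht.1.le, ht.2.trans h1.2⟩
  have hi : ∀ {g : Pt → ℝ}, ContinuousOn g (Rect L) → ∀ y ∈ Icc (0:ℝ) 1,
      IntervalIntegrable (fun t => g (t, y)) volume 0 x.1 := fun hg y hy =>
    ((hg.slice_snd hy).mono (Icc_subset_Icc_right h1.2)).intervalIntegrable_of_Icc h1.1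
  have h2' : x.2 ∈ Icc (0:ℝ) 1 := Ioo_subset_Icc_self h2
  refine (intervalIntegral.hasDerivAt_integral_of_dominated_loc_of_deriv_le
    (F := fun y t => f (t, y)) (F' := fun y t => pd2 f (t, y)) (bound := fun _ => C)
    (s := Ioo 0 1) (Ioo_mem_nhds h2.1 h2.2) ?_ (hi hf.continuousOn _ h2') ?_ ?_ ?_ ?_).2
  · filter_upwards [Ioo_mem_nhds h2.1 h2.2] with y hy
    exact (hi hf.continuousOn y (Ioo_subset_Icc_self hy)).def'.aestronglyMeasurable
  · exact (hi hf.continuousOn_pd2 _ h2').def'.aestronglyMeasurable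
  · exact Filter.Eventually.of_forall fun t ht y hy =>
      hC _ (mem_Rect (hsub t ht) (Ioo_subset_Icc_self hy))
  · exact intervalIntegrable_const
  · exact Filter.Eventually.of_forall fun t ht y hy =>
      hasDerivAt_snd (x := (t, y))
        (hf.differentiableAt (mem_Rect (hsub t ht) (Ioo_subset_Icc_self hy)))

theorem hasFDerivAt_of_partials {L : ℝ} {φ a b : Pt → ℝ} (ha : ContinuousOn a (Rect L))
    (hb : ContinuousOn b (Rect L))
    (h1 : ∀ x ∈ Noz L, HasDerivAt (fun t => φ (t, x.2)) (a x) x.1)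
    (h2 : ∀ x ∈ Noz L, HasDerivAt (fun t => φ (x.1, t)) (b x) x.2) {x : Pt} (hx : x ∈ Noz L) :
    DifferentiableAt ℝ φ x ∧ pd1 φ x = a x ∧ pd2 φ x = b x := by
  have hn : Noz L ∈ nhds x := (isOpen_Noz L).mem_nhds hx
  have hn' : Rect L ∈ nhds x := Filter.mem_of_superset hn (Noz_subset_Rect L)
  have key := hasStrictFDerivAt_uncurry_coprod (𝕜 := ℝ) (u := x) (f := fun s t => φ (s, t))
    (f₁ := fun s t => ContinuousLinearMap.toSpanSingleton ℝ (a (s, t)))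
    (f₂ := fun s t => ContinuousLinearMap.toSpanSingleton ℝ (b (s, t)))
    (Filter.mem_of_superset hn fun y hy => (h1 y hy).hasFDerivAt)
    (Filter.mem_of_superset hn fun y hy => (h2 y hy).hasFDerivAt)
    ((ContinuousLinearMap.toSpanSingletonCLE (𝕜 := ℝ) (E := ℝ)).continuous.continuousAt.comp
      (ha.continuousAt hn'))
    ((ContinuousLinearMap.toSpanSingletonCLE (𝕜 := ℝ) (E := ℝ)).continuous.continuousAt.comp
      (hb.continuousAt hn'))
  have key' : HasFDerivAt φ _ x := key.hasFDerivAt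
  refine ⟨key'.differentiableAt, ?_, ?_⟩
  · simp only [pd1, key'.fderiv]; simp [Function.HasUncurry.uncurry]
  · simp only [pd2, key'.fderiv]; simp [Function.HasUncurry.uncurry]

theorem prim_derivs {L : ℝ} (hL : 0 ≤ L) {f : Pt → ℝ} (hf : C1R L f) {x : Pt} (hx : x ∈ Noz L) :
    DifferentiableAt ℝ (prim f) x ∧ pd1 (prim f) x = f x ∧ pd2 (prim f) x = prim (pd2 f) x :=
  hasFDerivAt_of_partials hf.continuousOn (hf.continuousOn_pd2.prim hL)
    (fun _ hx => hasDerivAt_prim_fst hf.continuousOn hx.1 (Ioo_subset_Icc_self hx.2))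
    (fun _ hx => hasDerivAt_prim_snd hf (Ioo_subset_Icc_self hx.1) hx.2) hx

theorem prim_zero (f : Pt → ℝ) (y : ℝ) : prim f (0, y) = 0 := by simp [prim]

/-! ### One-dimensional inequalities -/

theorem sq_integral_le {a : ℝ} (ha : 0 ≤ a) {f : ℝ → ℝ} (hf : ContinuousOn f (Icc 0 a)) :
    (∫ s in (0:ℝ)..a, f s) ^ 2 ≤ a * ∫ s in (0:ℝ)..a, f s ^ 2 := by
  rcases ha.eq_or_lt with rfl | ha'
  · simp
  set I := ∫ s in (0:ℝ)..a, f s with hI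
  have i1 : IntervalIntegrable f volume 0 a := hf.intervalIntegrable_of_Icc ha
  have i2 : IntervalIntegrable (fun s => f s ^ 2) volume 0 a :=
    (hf.pow 2).intervalIntegrable_of_Icc ha
  have h0 : 0 ≤ ∫ s in (0:ℝ)..a, (f s ^ 2 - 2 * (I / a) * f s + (I / a) ^ 2) :=
    intervalIntegral.integral_nonneg ha fun s _ => by nlinarith [sq_nonneg (f s - I / a)]
  rw [intervalIntegral.integral_add (i2.sub (i1.const_mul _)) intervalIntegrable_const,
    intervalIntegral.integral_sub i2 (i1.const_mul _), intervalIntegral.integral_const_mul,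
    intervalIntegral.integral_const, ← hI] at h0
  have : I ^ 2 = a * (2 * (I / a) * I - (a - 0) • (I / a) ^ 2) := by
    simp; field_simp; ring
  rw [this]
  exact mul_le_mul_of_nonneg_left (by linarith) ha

theorem prim_sq_le {L : ℝ} {g : Pt → ℝ} (hg : ContinuousOn g (Rect L)) {x : Pt}
    (hx : x ∈ Rect L) : prim g x ^ 2 ≤ L * ∫ s in (0:ℝ)..L, g (s, x.2) ^ 2 := by
  have h1 := sq_integral_le hx.1.1 ((hg.slice_snd hx.2).mono (Icc_subset_Icc_right hx.1.2))
  have hc := ((hg.pow 2).slice_snd hx.2)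
  have h2 : ∫ s in (0:ℝ)..x.1, g (s, x.2) ^ 2 ≤ ∫ s in (0:ℝ)..L, g (s, x.2) ^ 2 :=
    intervalIntegral.integral_mono_interval le_rfl hx.1.1 hx.1.2
      (Filter.Eventually.of_forall fun s => sq_nonneg _)
      (hc.intervalIntegrable_of_Icc (hx.1.1.trans hx.1.2))
  refine h1.trans (mul_le_mul hx.1.2 h2 ?_ (hx.1.1.trans hx.1.2))
  exact intervalIntegral.integral_nonneg hx.1.1 fun s _ => sq_nonneg _

theorem integral_prim_exit_sq_le {L : ℝ} (hL : 0 ≤ L) {g : Pt → ℝ}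
    (hg : ContinuousOn g (Rect L)) :
    ∫ y in (0:ℝ)..1, prim g (L, y) ^ 2 ≤ L * ∫ x in Rect L, g x ^ 2 := by
  have hg2 : ContinuousOn (fun x => g x ^ 2) (Rect L) := hg.pow 2
  rw [integral_Rect_eq_swap hL hg2, ← intervalIntegral.integral_const_mul]
  refine intervalIntegral.integral_mono_on zero_le_one ?_ ?_ fun y hy =>
    prim_sq_le hg (mem_Rect (right_mem_Icc.2 hL) hy)
  · exact (((hg.prim hL).slice_fst (right_mem_Icc.2 hL)).pow 2).intervalIntegrable_of_Icc
      zero_le_one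
  · exact ((hg2.integral_fst hL).const_mul L).intervalIntegrable_of_Icc zero_le_one

theorem integral_prim_sq_le {L : ℝ} (hL : 0 ≤ L) {g : Pt → ℝ} (hg : ContinuousOn g (Rect L)) :
    ∫ x in Rect L, prim g x ^ 2 ≤ L ^ 2 * ∫ x in Rect L, g x ^ 2 := by
  have hg2 : ContinuousOn (fun x => g x ^ 2) (Rect L) := hg.pow 2
  have hp : ContinuousOn (fun x => prim g x ^ 2) (Rect L) := (hg.prim hL).pow 2
  rw [integral_Rect_eq_swap hL hg2, integral_Rect_eq_swap hL hp, ← intervalIntegral.integral_const_mul]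
  refine intervalIntegral.integral_mono_on zero_le_one ?_ ?_ fun y hy => ?_
  · exact (hp.integral_fst hL).intervalIntegrable_of_Icc zero_le_one
  · exact ((hg2.integral_fst hL).const_mul (L ^ 2)).intervalIntegrable_of_Icc zero_le_one
  · have : ∫ x in (0:ℝ)..L, prim g (x, y) ^ 2 ≤
        ∫ x in (0:ℝ)..L, (L * ∫ s in (0:ℝ)..L, g (s, y) ^ 2) :=
      intervalIntegral.integral_mono_on hL ((hp.slice_snd hy).intervalIntegrable_of_Icc hL)
        intervalIntegrable_const fun x hx => prim_sq_le hg (mem_Rect hx hy)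
    refine this.trans (le_of_eq ?_)
    simp; ring

theorem sq_le_integral {g g' : ℝ → ℝ} (hg : ContinuousOn g (Icc 0 1))
    (hg' : ContinuousOn g' (Icc 0 1)) (hd : ∀ y ∈ Ioo (0:ℝ) 1, HasDerivAt g (g' y) y) {y : ℝ}
    (hy : y ∈ Icc (0:ℝ) 1) : g y ^ 2 ≤ 2 * ∫ t in (0:ℝ)..1, (g t ^ 2 + g' t ^ 2) := by
  have hc : ContinuousOn (fun t => g t ^ 2 + g' t ^ 2) (Icc 0 1) := (hg.pow 2).add (hg'.pow 2)
  have hi := hc.intervalIntegrable_of_Icc (μ := volume) zero_le_one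
  have ftc : ∀ a c, 0 ≤ a → a ≤ c → c ≤ 1 →
      |g c ^ 2 - g a ^ 2| ≤ ∫ t in (0:ℝ)..1, (g t ^ 2 + g' t ^ 2) := by
    intro a c ha hac hc1
    have hsub : Icc a c ⊆ Icc 0 1 := Icc_subset_Icc ha hc1
    rw [← intervalIntegral.integral_eq_sub_of_hasDerivAt_of_le hac
      (f := fun t => g t ^ 2) ((hg.pow 2).mono hsub)
      (f' := fun t => 2 * g t * g' t)
      (fun t ht => by
        simpa using (hd t ⟨ha.trans_lt ht.1, ht.2.trans_le hc1⟩).fun_pow 2)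
      (((continuousOn_const.mul hg).mul hg').mono hsub |>.intervalIntegrable_of_Icc hac)]
    refine (intervalIntegral.abs_integral_le_integral_abs hac).trans ?_
    refine (intervalIntegral.integral_mono_on hac ?_ ((hc.mono hsub).intervalIntegrable_of_Icc hac)
      (g := fun t => g t ^ 2 + g' t ^ 2) fun t _ => ?_).trans ?_
    · exact (((continuousOn_const.mul hg).mul hg').mono hsub).abs.intervalIntegrable_of_Icc hac
    · rw [abs_le]; constructor <;> nlinarith [sq_nonneg (g t - g' t), sq_nonneg (g t + g' t)]
    · exact intervalIntegral.integral_mono_interval ha hac hc1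
        (Filter.Eventually.of_forall fun s => by positivity) hi
  have hpt : ∀ t ∈ Icc (0:ℝ) 1, g y ^ 2 - g t ^ 2 ≤ ∫ t in (0:ℝ)..1, (g t ^ 2 + g' t ^ 2) := by
    intro t ht
    rcases le_total t y with h | h
    · exact (le_abs_self _).trans (ftc t y ht.1 h hy.2)
    · rw [← neg_sub]; exact (neg_le_abs _).trans (ftc y t hy.1 h ht.2)
  have i2 := ((hg.pow 2).intervalIntegrable_of_Icc (μ := volume) zero_le_one)
  have h1 := intervalIntegral.integral_mono_on zero_le_one
    ((intervalIntegrable_const (c := g y ^ 2)).sub i2) (intervalIntegrable_const) hpt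
  rw [intervalIntegral.integral_sub intervalIntegrable_const i2] at h1
  simp only [intervalIntegral.integral_const, sub_zero, one_smul] at h1
  have h2 : ∫ t in (0:ℝ)..1, g t ^ 2 ≤ ∫ t in (0:ℝ)..1, (g t ^ 2 + g' t ^ 2) :=
    intervalIntegral.integral_mono_on zero_le_one i2 hi fun t _ => by nlinarith [sq_nonneg (g' t)]
  simp only [Pi.pow_apply] at h1
  linarith

theorem integral_weight_exit_le {L : ℝ} (hL : 0 ≤ L) {z : Pt → ℝ} {β : ℝ → ℝ} (hz : C1R L z)
    (hβ : ContinuousOn β (Icc 0 1)) :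
    ∫ y in (0:ℝ)..1, β y * prim z (L, y) ^ 2 ≤ (∫ x in Rect L, z x ^ 2) +
      (∫ y in (0:ℝ)..1, β y ^ 2) *
        (2 * ∫ x in Rect L, (prim z x ^ 2 + prim (pd2 z) x ^ 2)) := by
  have hp := hz.continuousOn.prim hL
  have hp2 := hz.continuousOn_pd2.prim hL
  have hz' := hz.continuousOn
  have hβ' : ContinuousOn (fun x : Pt => β x.2) (Rect L) :=
    hβ.comp continuous_snd.continuousOn fun x hx => hx.2
  have hLm := right_mem_Icc.2 hL
  have c1 : ContinuousOn (fun x : Pt => z x ^ 2) (Rect L) := hz'.pow 2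
  have c2 : ContinuousOn (fun x : Pt => β x.2 ^ 2 * prim z x ^ 2) (Rect L) :=
    (hβ'.pow 2).mul (hp.pow 2)
  have c3 : ContinuousOn (fun x : Pt => prim z x ^ 2 + prim (pd2 z) x ^ 2) (Rect L) :=
    (hp.pow 2).add (hp2.pow 2)
  have c12 : ContinuousOn (fun x : Pt => z x ^ 2 + β x.2 ^ 2 * prim z x ^ 2) (Rect L) := c1.add c2
  have step1 : ∫ y in (0:ℝ)..1, β y * prim z (L, y) ^ 2 ≤
      ∫ x in Rect L, (z x ^ 2 + β x.2 ^ 2 * prim z x ^ 2) := by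
    rw [integral_Rect_eq_swap hL c12]
    refine intervalIntegral.integral_mono_on zero_le_one ?_ ?_ fun y hy => ?_
    · exact (hβ.mul ((hp.slice_fst hLm).pow 2)).intervalIntegrable_of_Icc zero_le_one
    · exact (c12.integral_fst hL).intervalIntegrable_of_Icc zero_le_one
    · have hps := hp.slice_snd hy
      have hzs := hz'.slice_snd hy
      have ftc := intervalIntegral.integral_eq_sub_of_hasDerivAt_of_le hL (hps.pow 2)
        (f' := fun s => 2 * prim z (s, y) * z (s, y))
        (fun s hs => by
          simpa using (hasDerivAt_prim_fst (x := (s, y)) hz' hs hy).pow 2)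
        (((continuousOn_const.mul hps).mul hzs).intervalIntegrable_of_Icc hL)
      simp only [Pi.pow_apply, prim_zero, ne_eq, OfNat.ofNat_ne_zero, not_false_eq_true, zero_pow,
        sub_zero] at ftc
      rw [← ftc, ← intervalIntegral.integral_const_mul]
      refine intervalIntegral.integral_mono_on hL ?_ ?_ fun s hs => ?_
      · exact (continuousOn_const.mul ((continuousOn_const.mul hps).mul
          hzs)).intervalIntegrable_of_Icc hL
      · exact (c12.slice_snd hy).intervalIntegrable_of_Icc hL
      · simp only
        nlinarith [sq_nonneg (z (s, y) - β y * prim z (s, y))]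
  refine step1.trans ?_
  rw [integral_Rect_add c1 c2]
  refine add_le_add le_rfl ?_
  rw [integral_Rect_eq hL c2, integral_Rect_eq hL c3, ← intervalIntegral.integral_const_mul,
    ← intervalIntegral.integral_const_mul]
  refine intervalIntegral.integral_mono_on hL ?_ ?_ fun s hs => ?_
  · exact (c2.integral_snd hL).intervalIntegrable_of_Icc hL
  · exact (continuousOn_const.mul (continuousOn_const.mul
      (c3.integral_snd hL))).intervalIntegrable_of_Icc hL
  · simp only
    rw [← intervalIntegral.integral_mul_const]
    refine intervalIntegral.integral_mono_on zero_le_one ?_ ?_ fun y hy => ?_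
    · exact (c2.slice_fst hs).intervalIntegrable_of_Icc zero_le_one
    · exact ((hβ.pow 2).mul continuousOn_const).intervalIntegrable_of_Icc zero_le_one
    · refine mul_le_mul_of_nonneg_left ?_ (sq_nonneg _)
      exact sq_le_integral (hp.slice_fst hs) (hp2.slice_fst hs)
        (fun t ht => hasDerivAt_prim_snd (x := (s, t)) hz hs ht) hy

/-! ### Energy identities -/

theorem intervalIntegral_eq_zero_of_Icc {L : ℝ} (hL : 0 ≤ L) {f : ℝ → ℝ}
    (h : ∀ x ∈ Icc 0 L, f x = 0) : ∫ x in (0:ℝ)..L, f x = 0 := by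
  rw [intervalIntegral.integral_congr (g := fun _ => 0) (fun x hx => h x (by
    rwa [uIcc_of_le hL] at hx))]
  simp

/-- testing a divergence free field, tangential on the walls, with a gradient -/
theorem integral_div_free {L : ℝ} (hL : 0 ≤ L) {m₁ m₂ φ a b : Pt → ℝ} (h1 : C1R L m₁)
    (h2 : C1R L m₂) (hdiv : ∀ x ∈ Noz L, pd1 m₁ x + pd2 m₂ x = 0)
    (hw0 : ∀ s ∈ Icc 0 L, m₂ (s, 0) = 0) (hw1 : ∀ s ∈ Icc 0 L, m₂ (s, 1) = 0)
    (hφ : ContinuousOn φ (Rect L)) (ha : ContinuousOn a (Rect L)) (hb : ContinuousOn b (Rect L))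
    (hd : ∀ x ∈ Noz L, DifferentiableAt ℝ φ x ∧ pd1 φ x = a x ∧ pd2 φ x = b x)
    (h0 : ∀ y ∈ Icc (0:ℝ) 1, φ (0, y) = 0) :
    ∫ x in Rect L, (m₁ x * a x + m₂ x * b x) = ∫ y in (0:ℝ)..1, m₁ (L, y) * φ (L, y) := by
  have dm : ∀ {m : Pt → ℝ}, C1R L m → ∀ x ∈ Noz L, DifferentiableAt ℝ m x :=
    fun hm x hx => hm.differentiableAt (Noz_subset_Rect L hx)
  rw [integral_Rect_div hL (f := fun x => m₁ x * φ x) (g := fun x => m₂ x * φ x)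
    (D := fun x => m₁ x * a x + m₂ x * b x) (h1.continuousOn.mul hφ) (h2.continuousOn.mul hφ)
    ((h1.continuousOn.mul ha).add (h2.continuousOn.mul hb))
    (fun x hx => (dm h1 x hx).mul (hd x hx).1) (fun x hx => (dm h2 x hx).mul (hd x hx).1)
    (fun x hx => by
      rw [pd1_mul (dm h1 x hx) (hd x hx).1, pd2_mul (dm h2 x hx) (hd x hx).1, (hd x hx).2.1,
        (hd x hx).2.2]
      linear_combination φ x * hdiv x hx)]
  rw [intervalIntegral_eq_zero_of_Icc hL (f := fun s => m₂ (s, 1) * φ (s, 1))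
      fun s hs => by rw [hw1 s hs, zero_mul],
    intervalIntegral_eq_zero_of_Icc hL (f := fun s => m₂ (s, 0) * φ (s, 0))
      fun s hs => by rw [hw0 s hs, zero_mul],
    intervalIntegral_eq_zero_of_Icc zero_le_one (f := fun y => m₁ (0, y) * φ (0, y))
      fun y hy => by rw [h0 y hy, mul_zero]]
  ring

theorem transport_slice_le {L c : ℝ} (hL : 0 < L) {m₁ m₂ k G : Pt → ℝ} (h1 : C1R L m₁)
    (h2 : C1R L m₂) (hk : C1R L k) (hG : ContinuousOn G (Rect L))
    (hdiv : ∀ x ∈ Noz L, pd1 m₁ x + pd2 m₂ x = 0)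
    (hw0 : ∀ s ∈ Icc 0 L, m₂ (s, 0) = 0) (hw1 : ∀ s ∈ Icc 0 L, m₂ (s, 1) = 0)
    (htr : ∀ x ∈ Noz L, m₁ x * pd1 k x + m₂ x * pd2 k x = G x)
    (h0 : ∀ y ∈ Icc (0:ℝ) 1, k (0, y) = 0) (hm : ∀ x ∈ Rect L, c ≤ m₁ x) {l : ℝ}
    (hl : l ∈ Icc 0 L) :
    c * ∫ y in (0:ℝ)..1, k (l, y) ^ 2 ≤ 2 * ∫ x in Rect L, |k x| * |G x| := by
  have hmono := Rect_mono hl.2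
  have hsub : ∀ s ∈ Icc 0 l, s ∈ Icc 0 L := fun s hs => ⟨hs.1, hs.2.trans hl.2⟩
  have cc : ContinuousOn (fun x => |k x| * |G x|) (Rect L) := hk.continuousOn.abs.mul hG.abs
  have ckG : ContinuousOn (fun x => 2 * k x * G x) (Rect L) :=
    (continuousOn_const.mul hk.continuousOn).mul hG
  have dk : ∀ x ∈ Noz l, DifferentiableAt ℝ k x := fun x hx =>
    hk.differentiableAt (hmono (Noz_subset_Rect l hx))
  have key := integral_div_free hl.1 (h1.mono hl.2) (h2.mono hl.2)
    (fun x hx => hdiv x (Noz_mono hl.2 hx)) (fun s hs => hw0 s (hsub s hs))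
    (fun s hs => hw1 s (hsub s hs)) (φ := fun x => k x ^ 2)
    (a := fun x => 2 * k x * pd1 k x) (b := fun x => 2 * k x * pd2 k x)
    ((hk.continuousOn.mono hmono).pow 2)
    ((continuousOn_const.mul (hk.continuousOn.mono hmono)).mul (hk.continuousOn_pd1.mono hmono))
    ((continuousOn_const.mul (hk.continuousOn.mono hmono)).mul (hk.continuousOn_pd2.mono hmono))
    (fun x hx => ⟨(dk x hx).pow 2, by rw [pd1_pow (dk x hx)]; simp,
      by rw [pd2_pow (dk x hx)]; simp⟩)
    (fun y hy => by simp [h0 y hy])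
  have hG' := eq_on_Rect hL ((h1.continuousOn.mul hk.continuousOn_pd1).add
    (h2.continuousOn.mul hk.continuousOn_pd2)) hG htr
  calc c * ∫ y in (0:ℝ)..1, k (l, y) ^ 2 = ∫ y in (0:ℝ)..1, c * k (l, y) ^ 2 :=
        (intervalIntegral.integral_const_mul _ _).symm
    _ ≤ ∫ y in (0:ℝ)..1, m₁ (l, y) * k (l, y) ^ 2 := by
        have ck := (hk.continuousOn.slice_fst hl).pow 2
        refine intervalIntegral.integral_mono_on zero_le_one
          ((continuousOn_const.mul ck).intervalIntegrable_of_Icc zero_le_one)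
          (((h1.continuousOn.slice_fst hl).mul ck).intervalIntegrable_of_Icc zero_le_one)
          fun y hy => mul_le_mul_of_nonneg_right (hm _ (mem_Rect hl hy)) (sq_nonneg _)
    _ = ∫ x in Rect l, 2 * k x * G x := by
        rw [← key]
        refine setIntegral_congr_fun (measurableSet_Rect l) fun x hx => ?_
        simp only [← hG' x (hmono hx), Pi.add_apply, Pi.mul_apply]; ring
    _ ≤ ∫ x in Rect l, 2 * (|k x| * |G x|) :=
        integral_Rect_mono (ckG.mono hmono) ((continuousOn_const.mul cc).mono hmono) fun x _ => by
          rw [← abs_mul, mul_assoc]; exact mul_le_mul_of_nonneg_left (le_abs_self _) zero_le_two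
    _ ≤ ∫ x in Rect L, 2 * (|k x| * |G x|) :=
        integral_Rect_mono_domain hl.2 (continuousOn_const.mul cc) fun x _ => by positivity
    _ = 2 * ∫ x in Rect L, |k x| * |G x| := integral_const_mul _ _

theorem transport_le {L c : ℝ} (hL : 0 < L) {m₁ m₂ k G : Pt → ℝ} (h1 : C1R L m₁)
    (h2 : C1R L m₂) (hk : C1R L k) (hG : ContinuousOn G (Rect L))
    (hdiv : ∀ x ∈ Noz L, pd1 m₁ x + pd2 m₂ x = 0)
    (hw0 : ∀ s ∈ Icc 0 L, m₂ (s, 0) = 0) (hw1 : ∀ s ∈ Icc 0 L, m₂ (s, 1) = 0)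
    (htr : ∀ x ∈ Noz L, m₁ x * pd1 k x + m₂ x * pd2 k x = G x)
    (h0 : ∀ y ∈ Icc (0:ℝ) 1, k (0, y) = 0) (hm : ∀ x ∈ Rect L, c ≤ m₁ x) :
    c * ∫ x in Rect L, k x ^ 2 ≤ 2 * L * ∫ x in Rect L, |k x| * |G x| := by
  have ck : ContinuousOn (fun x => k x ^ 2) (Rect L) := hk.continuousOn.pow 2
  rw [integral_Rect_eq hL.le ck, ← intervalIntegral.integral_const_mul]
  have := intervalIntegral.integral_mono_on hL.le
    ((continuousOn_const.mul (ck.integral_snd hL.le)).intervalIntegrable_of_Icc hL.le)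
    (intervalIntegrable_const (μ := volume)) fun l hl =>
      transport_slice_le hL h1 h2 hk hG hdiv hw0 hw1 htr h0 hm hl
  refine this.trans (le_of_eq ?_)
  simp; ring

theorem C1R.of_contDiffAt_two_pd1 {L : ℝ} {Ψ : Pt → ℝ} (h : ∀ x ∈ Rect L, ContDiffAt ℝ 2 Ψ x) :
    C1R L (pd1 Ψ) := fun x hx =>
  ((h x hx).fderiv_right (m := 1) (by norm_num)).clm_apply contDiffAt_const

theorem C1R.of_contDiffAt_two_pd2 {L : ℝ} {Ψ : Pt → ℝ} (h : ∀ x ∈ Rect L, ContDiffAt ℝ 2 Ψ x) :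
    C1R L (pd2 Ψ) := fun x hx =>
  ((h x hx).fderiv_right (m := 1) (by norm_num)).clm_apply contDiffAt_const

theorem integral_poisson_nonpos {L : ℝ} (hL : 0 < L) {Ψ r : Pt → ℝ}
    (h : ∀ x ∈ Rect L, ContDiffAt ℝ 2 Ψ x) (hr : ContinuousOn r (Rect L))
    (hp : ∀ x ∈ Noz L, lap Ψ x = r x) (h0 : ∀ y ∈ Icc (0:ℝ) 1, Ψ (0, y) = 0)
    (hLy : ∀ y ∈ Icc (0:ℝ) 1, Ψ (L, y) = 0) (hw0 : ∀ s ∈ Ioo 0 L, pd2 Ψ (s, 0) = 0)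
    (hw1 : ∀ s ∈ Ioo 0 L, pd2 Ψ (s, 1) = 0) : ∫ x in Rect L, r x * Ψ x ≤ 0 := by
  have hΨ : C1R L Ψ := fun x hx => (h x hx).of_le (by norm_num)
  have c1 := C1R.of_contDiffAt_two_pd1 h
  have c2 := C1R.of_contDiffAt_two_pd2 h
  have hwall : ∀ y ∈ Icc (0:ℝ) 1, (∀ s ∈ Ioo 0 L, pd2 Ψ (s, y) = 0) →
      ∀ s ∈ Icc 0 L, Ψ (s, y) * pd2 Ψ (s, y) = 0 := by
    intro y hy hw s hs
    rcases hs.1.eq_or_lt with rfl | h1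
    · rw [h0 y hy, zero_mul]
    rcases hs.2.eq_or_lt with rfl | h2
    · rw [hLy y hy, zero_mul]
    · rw [hw s ⟨h1, h2⟩, mul_zero]
  have dd : ∀ {m : Pt → ℝ}, C1R L m → ∀ x ∈ Noz L, DifferentiableAt ℝ m x :=
    fun hm x hx => hm.differentiableAt (Noz_subset_Rect L hx)
  have cg : ContinuousOn (fun x => pd1 Ψ x ^ 2 + pd2 Ψ x ^ 2) (Rect L) :=
    (c1.continuousOn.pow 2).add (c2.continuousOn.pow 2)
  have cr : ContinuousOn (fun x => r x * Ψ x) (Rect L) := hr.mul hΨ.continuousOn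
  have key := integral_Rect_div hL.le (f := fun x => Ψ x * pd1 Ψ x) (g := fun x => Ψ x * pd2 Ψ x)
    (D := fun x => r x * Ψ x + (pd1 Ψ x ^ 2 + pd2 Ψ x ^ 2))
    (hΨ.mul c1).continuousOn (hΨ.mul c2).continuousOn (cr.add cg)
    (dd (hΨ.mul c1)) (dd (hΨ.mul c2)) (fun x hx => by
      rw [pd1_mul (dd hΨ x hx) (dd c1 x hx), pd2_mul (dd hΨ x hx) (dd c2 x hx), ← hp x hx, lap]
      ring)
  rw [intervalIntegral_eq_zero_of_Icc hL.le (hwall 1 (by simp) hw1),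
    intervalIntegral_eq_zero_of_Icc hL.le (hwall 0 (by simp) hw0),
    intervalIntegral_eq_zero_of_Icc zero_le_one (f := fun y => Ψ (L, y) * pd1 Ψ (L, y))
      fun y hy => by rw [hLy y hy, zero_mul],
    intervalIntegral_eq_zero_of_Icc zero_le_one (f := fun y => Ψ (0, y) * pd1 Ψ (0, y))
      fun y hy => by rw [h0 y hy, zero_mul], integral_Rect_add cr cg] at key
  have := integral_Rect_nonneg (L := L) (F := fun x => pd1 Ψ x ^ 2 + pd2 Ψ x ^ 2)
    fun x _ => by positivity
  linarith

theorem integral_mul_deriv_sq {q q' f f' : ℝ → ℝ} (hq : ContinuousOn q (Icc 0 1))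
    (hq' : ContinuousOn q' (Icc 0 1)) (hf : ContinuousOn f (Icc 0 1))
    (hf' : ContinuousOn f' (Icc 0 1)) (dq : ∀ y ∈ Ioo (0:ℝ) 1, HasDerivAt q (q' y) y)
    (df : ∀ y ∈ Ioo (0:ℝ) 1, HasDerivAt f (f' y) y) (h0 : q 0 = 0) (h1 : q 1 = 0) :
    ∫ y in (0:ℝ)..1, q y * f y * f' y = - (1 / 2) * ∫ y in (0:ℝ)..1, q' y * f y ^ 2 := by
  have i1 := (hq'.mul (hf.pow 2)).intervalIntegrable_of_Icc (μ := volume) zero_le_one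
  have i2 := (continuousOn_const (c := (2:ℝ)).mul ((hq.mul hf).mul hf')).intervalIntegrable_of_Icc
    (μ := volume) zero_le_one
  have key := intervalIntegral.integral_eq_sub_of_hasDerivAt_of_le zero_le_one
    (f := fun y => q y * f y ^ 2) (f' := fun y => q' y * f y ^ 2 + 2 * (q y * f y * f' y))
    (hq.mul (hf.pow 2)) (fun y hy => by
      refine ((dq y hy).fun_mul ((df y hy).fun_pow 2)).congr_deriv ?_
      norm_num; ring) (i1.add i2)
  have e := intervalIntegral.integral_add i1 i2
  simp only [Pi.mul_apply, Pi.pow_apply] at e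
  rw [e, intervalIntegral.integral_const_mul, h0, h1] at key
  linarith

/-! ### Quantities constant along streamlines -/

theorem eqOn_zero_of_integral_Icc {f : ℝ → ℝ} {a b : ℝ} (hab : a < b)
    (hf : ContinuousOn f (Icc a b)) (h0 : ∀ x ∈ Icc a b, 0 ≤ f x) (hi : ∫ x in a..b, f x ≤ 0) :
    ∀ x ∈ Icc a b, f x = 0 := by
  intro x hx
  by_contra hne
  exact (intervalIntegral.integral_pos hab hf (fun y hy => h0 y (Ioc_subset_Icc_self hy))
    ⟨x, hx, lt_of_le_of_ne (h0 x hx) (Ne.symm hne)⟩).not_ge hi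

theorem eqOn_zero_of_integral_Rect {L : ℝ} (hL : 0 < L) {F : Pt → ℝ}
    (hF : ContinuousOn F (Rect L)) (h0 : ∀ x ∈ Rect L, 0 ≤ F x)
    (hi : ∫ x in Rect L, F x ≤ 0) : ∀ x ∈ Rect L, F x = 0 := by
  rw [integral_Rect_eq hL.le hF] at hi
  have h1 := eqOn_zero_of_integral_Icc hL (hF.integral_snd hL.le)
    (fun x hx => intervalIntegral.integral_nonneg zero_le_one fun y hy => h0 _ (mem_Rect hx hy)) hi
  intro x hx
  exact eqOn_zero_of_integral_Icc zero_lt_one (hF.slice_fst hx.1)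
    (fun y hy => h0 _ (mem_Rect hx.1 hy)) (h1 x.1 hx.1).le x.2 hx.2

/-- uniqueness for the transport equation in the nozzle -/
theorem eqOn_zero_of_transport {L : ℝ} {m₁ m₂ k : Pt → ℝ} (h1 : C1R L m₁)
    (h2 : C1R L m₂) (hk : ContinuousOn k (Rect L)) (dk : ∀ x ∈ Noz L, DifferentiableAt ℝ k x)
    (hdiv : ∀ x ∈ Noz L, pd1 m₁ x + pd2 m₂ x = 0)
    (hw0 : ∀ s ∈ Icc 0 L, m₂ (s, 0) = 0) (hw1 : ∀ s ∈ Icc 0 L, m₂ (s, 1) = 0)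
    (htr : ∀ x ∈ Noz L, m₁ x * pd1 k x + m₂ x * pd2 k x = 0)
    (h0 : ∀ y ∈ Icc (0:ℝ) 1, k (0, y) = 0) (hm : ∀ x ∈ Rect L, 0 < m₁ x) :
    ∀ x ∈ Rect L, k x = 0 := by
  rintro ⟨l, y⟩ ⟨hl, hy⟩
  simp only at hl hy
  have hmono := Rect_mono hl.2
  have dm : ∀ {m : Pt → ℝ}, C1R L m → ∀ x ∈ Noz l, DifferentiableAt ℝ m x :=
    fun hm x hx => hm.differentiableAt (hmono (Noz_subset_Rect l hx))
  have dk2 : ∀ x ∈ Noz l, DifferentiableAt ℝ (fun x => k x ^ 2) x :=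
    fun x hx => (dk x (Noz_mono hl.2 hx)).fun_pow 2
  have ck2 : ContinuousOn (fun x => k x ^ 2) (Rect L) := hk.pow 2
  have key := integral_Rect_div hl.1 (f := fun x => m₁ x * k x ^ 2) (g := fun x => m₂ x * k x ^ 2)
    (D := fun _ => 0) ((h1.continuousOn.mul ck2).mono hmono) ((h2.continuousOn.mul ck2).mono hmono)
    continuousOn_const (fun x hx => (dm h1 x hx).fun_mul (dk2 x hx))
    (fun x hx => (dm h2 x hx).fun_mul (dk2 x hx)) (fun x hx => by
      have hx' := Noz_mono hl.2 hx
      rw [pd1_mul (dm h1 x hx) (dk2 x hx), pd2_mul (dm h2 x hx) (dk2 x hx),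
        pd1_pow (dk x hx'), pd2_pow (dk x hx')]
      norm_num
      linear_combination k x ^ 2 * hdiv x hx' + 2 * k x * htr x hx')
  rw [intervalIntegral_eq_zero_of_Icc hl.1 (f := fun s => m₂ (s, 1) * k (s, 1) ^ 2)
      fun s hs => by rw [hw1 s ⟨hs.1, hs.2.trans hl.2⟩, zero_mul],
    intervalIntegral_eq_zero_of_Icc hl.1 (f := fun s => m₂ (s, 0) * k (s, 0) ^ 2)
      fun s hs => by rw [hw0 s ⟨hs.1, hs.2.trans hl.2⟩, zero_mul],
    intervalIntegral_eq_zero_of_Icc zero_le_one (f := fun y => m₁ (0, y) * k (0, y) ^ 2)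
      fun y hy => by rw [h0 y hy]; ring] at key
  have h := eqOn_zero_of_integral_Icc zero_lt_one (f := fun y => m₁ (l, y) * k (l, y) ^ 2)
    ((h1.continuousOn.mul ck2).slice_fst hl)
    (fun y hy => mul_nonneg (hm _ (mem_Rect hl hy)).le (sq_nonneg _))
    (by simpa using key.symm.le) y hy
  simpa [(hm _ (mem_Rect hl hy)).ne'] using h

/-- a global `C¹` diffeomorphism of the line with prescribed derivative on `[0,1]` -/
theorem exists_inverse_primitive {m : ℝ → ℝ} (hm : ContinuousOn m (Icc 0 1)) {c : ℝ} (hc : 0 < c)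
    (hcm : ∀ t ∈ Icc (0:ℝ) 1, c ≤ m t) : ∃ A T : ℝ → ℝ, StrictMono A ∧ A 0 = 0 ∧
      (∀ t ∈ Icc (0:ℝ) 1, HasDerivAt A (m t) t) ∧ (∀ t, T (A t) = t) ∧ (∀ r, A (T r) = r) ∧
      Continuous T ∧ (∀ r, T r ∈ Icc (0:ℝ) 1 → HasDerivAt T (m (T r))⁻¹ r) := by
  set a : ℝ → ℝ := fun t => m (max 0 (min 1 t)) with ha
  have hclamp : ∀ t : ℝ, max 0 (min 1 t) ∈ Icc (0:ℝ) 1 := fun t =>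
    ⟨le_max_left _ _, max_le zero_le_one (min_le_left _ _)⟩
  have ac : Continuous a := hm.comp_continuous (by fun_prop) hclamp
  have alow : ∀ t, c ≤ a t := fun t => hcm _ (hclamp t)
  have aeq : ∀ t ∈ Icc (0:ℝ) 1, a t = m t := by
    rintro t ⟨h1, h2⟩; simp [ha, h1, h2]
  set A : ℝ → ℝ := fun t => ∫ s in (0:ℝ)..t, a s with hA
  have dA : ∀ t, HasDerivAt A (a t) t := fun t => ac.integral_hasStrictDerivAt 0 t |>.hasDerivAt
  have Amono : StrictMono A := strictMono_of_hasDerivAt_pos dA fun t => hc.trans_le (alow t)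
  have A0 : A 0 = 0 := by simp [hA]
  have Acont : Continuous A := continuous_iff_continuousAt.2 fun t => (dA t).continuousAt
  have Bmono : Monotone fun t => A t - c * t :=
    monotone_of_hasDerivAt_nonneg (f' := fun t => a t - c)
      (fun t => ((dA t).sub (((hasDerivAt_id t).const_mul c).congr_deriv (mul_one c))))
      fun t => sub_nonneg.2 (alow t)
  have hlo : ∀ t, 0 ≤ t → c * t ≤ A t := fun t ht => by
    have := Bmono ht; simp only [A0] at this; linarith
  have hhi : ∀ t, t ≤ 0 → A t ≤ c * t := fun t ht => by
    have := Bmono ht; simp only [A0] at this; linarith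
  have Asurj : Function.Surjective A := by
    refine Acont.surjective ?_ ?_
    · exact Filter.tendsto_atTop_mono' _ ((Filter.eventually_ge_atTop 0).mono hlo)
        (Filter.tendsto_id.const_mul_atTop hc)
    · exact Filter.tendsto_atBot_mono' _ ((Filter.eventually_le_atBot 0).mono hhi)
        (Filter.tendsto_id.const_mul_atBot hc)
  let e := Amono.orderIsoOfSurjective A Asurj
  have eA : ∀ r, A (e.symm r) = r := fun r => e.apply_symm_apply r
  refine ⟨A, e.symm, Amono, A0, fun t ht => aeq t ht ▸ dA t, fun t => e.symm_apply_apply t, eA,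
    e.symm.continuous, fun r hr => ?_⟩
  rw [← aeq _ hr]
  exact HasDerivAt.of_local_left_inverse e.symm.continuous.continuousAt (dA _)
    (hc.trans_le (alow _)).ne' (Filter.Eventually.of_forall eA)

theorem abs_pd2_le_of_transport {L c M A₀ : ℝ} (hL : 0 < L) (hc : 0 < c) {m₁ m₂ K : Pt → ℝ}
    (h1 : C1R L m₁) (h2 : C1R L m₂) (hK : C1R L K)
    (hdiv : ∀ x ∈ Noz L, pd1 m₁ x + pd2 m₂ x = 0)
    (hw0 : ∀ s ∈ Icc 0 L, m₂ (s, 0) = 0) (hw1 : ∀ s ∈ Icc 0 L, m₂ (s, 1) = 0)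
    (htr : ∀ x ∈ Noz L, m₁ x * pd1 K x + m₂ x * pd2 K x = 0)
    (hlo : ∀ x ∈ Rect L, c ≤ m₁ x) (hhi : ∀ x ∈ Rect L, m₁ x ≤ M)
    (h0 : ∀ t ∈ Ioo (0:ℝ) 1, |pd2 K (0, t)| ≤ A₀) : ∀ x ∈ Rect L, |pd2 K x| ≤ A₀ * (M / c) := by
  have z0 : (0:ℝ) ∈ Icc 0 L := left_mem_Icc.2 hL.le
  obtain ⟨A, T, Amono, A0, dA, TA, AT, Tc, dT⟩ := exists_inverse_primitive
    (h1.continuousOn.slice_fst z0) hc fun t ht => hlo _ (mem_Rect z0 ht)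
  set ψ : Pt → ℝ := fun x => A x.2 - prim m₂ x with hψ
  have ψc : ContinuousOn ψ (Rect L) := by
    refine ContinuousOn.sub (fun x hx => ?_) (h2.continuousOn.prim hL.le)
    exact ((dA x.2 hx.2).continuousAt.comp continuous_snd.continuousAt).continuousWithinAt
  have pderiv : ∀ x ∈ Noz L, DifferentiableAt ℝ ψ x ∧ pd1 ψ x = - m₂ x ∧ pd2 ψ x = m₁ x := by
    intro x hx
    refine hasFDerivAt_of_partials (a := fun x => - m₂ x) (b := m₁) h2.neg.continuousOn
      h1.continuousOn (fun x hx => ?_) (fun x hx => ?_) hx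
    · exact ((hasDerivAt_const x.1 (A x.2)).sub (hasDerivAt_prim_fst (x := x) h2.continuousOn hx.1
        (Ioo_subset_Icc_self hx.2))).congr_deriv (zero_sub _)
    · have hy := Ioo_subset_Icc_self hx.2
      have hx1 := Ioo_subset_Icc_self hx.1
      refine ((dA x.2 hy).sub (hasDerivAt_prim_snd (x := x) h2 hx1 hx.2)).congr_deriv ?_
      have e : ∀ s ∈ Icc 0 L, pd2 m₂ (s, x.2) = - pd1 m₁ (s, x.2) := fun s hs =>
        eq_on_Rect hL h2.continuousOn_pd2 h1.continuousOn_pd1.neg (fun z hz => by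
          have := hdiv z hz; simp only [Pi.neg_apply]; linarith) _ (mem_Rect hs hy)
      have ftc := intervalIntegral.integral_eq_sub_of_hasDerivAt (a := 0) (b := x.1)
        (f := fun s => m₁ (s, x.2)) (f' := fun s => pd1 m₁ (s, x.2)) (fun s hs => by
          rw [uIcc_of_le hx1.1] at hs
          exact hasDerivAt_fst (x := (s, x.2))
            (h1.differentiableAt (mem_Rect ⟨hs.1, hs.2.trans hx1.2⟩ hy)))
        (((h1.continuousOn_pd1.slice_snd hy).mono
          (Icc_subset_Icc_right hx1.2)).intervalIntegrable_of_Icc hx1.1)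
      have e2 : prim (pd2 m₂) x = - (m₁ (x.1, x.2) - m₁ (0, x.2)) := by
        rw [← ftc, ← intervalIntegral.integral_neg, prim]
        refine intervalIntegral.integral_congr fun s hs => ?_
        rw [uIcc_of_le hx1.1] at hs
        exact e s ⟨hs.1, hs.2.trans hx1.2⟩
      rw [e2]; ring
  have prim0 : ∀ y ∈ ({0, 1} : Set ℝ), ∀ s ∈ Icc 0 L, prim m₂ (s, y) = 0 := by
    intro y hy s hs
    refine intervalIntegral_eq_zero_of_Icc hs.1 fun r hr => ?_
    rcases hy with rfl | rfl
    · exact hw0 r ⟨hr.1, hr.2.trans hs.2⟩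
    · exact hw1 r ⟨hr.1, hr.2.trans hs.2⟩
  have ψmono : ∀ s ∈ Ioo 0 L, StrictMonoOn (fun y => ψ (s, y)) (Icc 0 1) := by
    intro s hs
    have hs' := Ioo_subset_Icc_self hs
    refine strictMonoOn_of_deriv_pos (convex_Icc 0 1) (ψc.slice_fst hs') fun y hy => ?_
    rw [interior_Icc] at hy
    have hx : ((s, y) : Pt) ∈ Noz L := ⟨hs, hy⟩
    rw [(hasDerivAt_snd (pderiv _ hx).1).deriv, (pderiv _ hx).2.2]
    exact hc.trans_le (hlo _ (mem_Rect hs' (Ioo_subset_Icc_self hy)))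
  have tIoo : ∀ x ∈ Noz L, T (ψ x) ∈ Ioo (0:ℝ) 1 := by
    rintro ⟨s, y⟩ ⟨hs, hy⟩
    simp only at hs hy
    have hs' := Ioo_subset_Icc_self hs
    have hy' := Ioo_subset_Icc_self hy
    have e0 : ψ (s, 0) = A 0 := by simp [hψ, prim0 0 (by simp) s hs']
    have e1 : ψ (s, 1) = A 1 := by simp [hψ, prim0 1 (by simp) s hs']
    have l0 := ψmono s hs (left_mem_Icc.2 zero_le_one) hy' hy.1
    have l1 := ψmono s hs hy' (right_mem_Icc.2 zero_le_one) hy.2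
    simp only [e0, e1] at l0 l1
    rw [← AT (ψ (s, y))] at l0 l1
    exact ⟨Amono.lt_iff_lt.1 l0, Amono.lt_iff_lt.1 l1⟩
  have tc : ContinuousOn (fun x => T (ψ x)) (Rect L) := Tc.comp_continuousOn ψc
  have tIcc : ∀ x ∈ Rect L, T (ψ x) ∈ Icc (0:ℝ) 1 := fun x hx =>
    ⟨le_on_Rect hL continuousOn_const tc (fun x hx => (tIoo x hx).1.le) x hx,
      le_on_Rect hL tc continuousOn_const (fun x hx => (tIoo x hx).2.le) x hx⟩
  set K' : Pt → ℝ := fun x => K (0, T (ψ x)) with hK'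
  have K'c : ContinuousOn K' (Rect L) :=
    hK.continuousOn.comp (continuousOn_const.prodMk tc) fun x hx => mem_Rect z0 (tIcc x hx)
  have dK' : ∀ x ∈ Noz L, HasFDerivAt K'
      ((pd2 K (0, T (ψ x)) * (m₁ (0, T (ψ x)))⁻¹) • fderiv ℝ ψ x) x := by
    intro x hx
    have ht := Ioo_subset_Icc_self (tIoo x hx)
    have d1 : HasDerivAt (fun t => K (0, t)) (pd2 K (0, T (ψ x))) (T (ψ x)) :=
      hasDerivAt_snd (x := (0, T (ψ x))) (hK.differentiableAt (mem_Rect z0 ht))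
    exact (d1.comp (ψ x) (dT _ ht)).comp_hasFDerivAt x (pderiv x hx).1.hasFDerivAt
  have p1 : ∀ x ∈ Noz L, pd1 K' x = pd2 K (0, T (ψ x)) * (m₁ (0, T (ψ x)))⁻¹ * - m₂ x := by
    intro x hx
    rw [← (pderiv x hx).2.1]
    simp [pd1, (dK' x hx).fderiv]
  have p2 : ∀ x ∈ Noz L, pd2 K' x = pd2 K (0, T (ψ x)) * (m₁ (0, T (ψ x)))⁻¹ * m₁ x := by
    intro x hx
    rw [← (pderiv x hx).2.2]
    simp [pd2, (dK' x hx).fderiv]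
  have dK : ∀ x ∈ Noz L, DifferentiableAt ℝ K x := fun x hx =>
    hK.differentiableAt (Noz_subset_Rect L hx)
  have hz := eqOn_zero_of_transport (k := fun x => K x - K' x) h1 h2 (hK.continuousOn.sub K'c)
    (fun x hx => (dK x hx).fun_sub (dK' x hx).differentiableAt) hdiv hw0 hw1
    (fun x hx => by
      rw [pd1_sub (dK x hx) (dK' x hx).differentiableAt,
        pd2_sub (dK x hx) (dK' x hx).differentiableAt, p1 x hx, p2 x hx]
      linear_combination htr x hx)
    (fun y hy => by simp [hK', hψ, prim_zero, TA]) fun x hx => hc.trans_le (hlo x hx)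
  refine le_on_Rect hL hK.continuousOn_pd2.abs continuousOn_const fun x hx => ?_
  have hloc : K =ᶠ[nhds x] K' := Filter.mem_of_superset ((isOpen_Noz L).mem_nhds hx) fun y hy =>
    sub_eq_zero.1 (hz y (Noz_subset_Rect L hy))
  have e : pd2 K x = pd2 K' x := by simp only [pd2, hloc.fderiv_eq]
  rw [e, p2 x hx, mul_assoc, abs_mul]
  have ht := tIoo x hx
  have hb := hlo _ (mem_Rect z0 (Ioo_subset_Icc_self ht))
  have hx' := Noz_subset_Rect L hx
  refine mul_le_mul (h0 _ ht) ?_ (abs_nonneg _) ((abs_nonneg _).trans (h0 _ ht))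
  rw [abs_of_nonneg (mul_nonneg (inv_nonneg.2 (hc.le.trans hb)) (hc.le.trans (hlo x hx'))),
    inv_mul_eq_div]
  exact div_le_div₀ (hc.le.trans ((hlo x hx').trans (hhi x hx'))) (hhi x hx') hc hb

/-! ### Pointwise estimates for the equation of state -/

theorem abs_exp_sub_exp_le {B x y : ℝ} (hx : x ≤ B) (hy : y ≤ B) :
    |exp x - exp y| ≤ exp B * |x - y| := by
  have key : ∀ a b : ℝ, a ≤ B → b ≤ a → |exp a - exp b| ≤ exp B * |a - b| := by
    intro a b ha hba
    rw [abs_of_nonneg (sub_nonneg.2 (exp_le_exp.2 hba)), abs_of_nonneg (sub_nonneg.2 hba)]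
    have h1 := add_one_le_exp (b - a)
    have h2 : exp b = exp a * exp (b - a) := by rw [← exp_add]; congr 1; ring
    have h3 : exp a - exp b ≤ exp a * (a - b) := by
      rw [h2]; nlinarith [exp_pos a]
    exact h3.trans (mul_le_mul_of_nonneg_right (exp_le_exp.2 ha) (sub_nonneg.2 hba))
  rcases le_total y x with h | h
  · exact key x y hx h
  · rw [abs_sub_comm, abs_sub_comm x]; exact key y x hy h

theorem exists_rpow_sub_rpow {x y p : ℝ} (hx : 0 < x) (hy : 0 < y) :
    ∃ ξ ∈ uIcc x y, x ^ p - y ^ p = p * ξ ^ (p - 1) * (x - y) := by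
  have key : ∀ a b : ℝ, 0 < a → a < b → ∃ ξ ∈ Icc a b, b ^ p - a ^ p = p * ξ ^ (p - 1) * (b - a) := by
    intro a b ha hab
    obtain ⟨ξ, hξ, he⟩ := exists_hasDerivAt_eq_slope (fun t => t ^ p)
      (fun t => p * t ^ (p - 1)) hab
      (fun t ht => (continuousAt_rpow_const t p (Or.inl (ha.trans_le ht.1).ne')).continuousWithinAt)
      (fun t ht => hasDerivAt_rpow_const (Or.inl (ha.trans ht.1).ne'))
    refine ⟨ξ, Ioo_subset_Icc_self hξ, ?_⟩
    rw [he]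
    field_simp [(sub_pos.2 hab).ne']
  rcases lt_trichotomy x y with h | rfl | h
  · obtain ⟨ξ, hξ, he⟩ := key x y hx h
    exact ⟨ξ, Icc_subset_uIcc hξ, by linarith⟩
  · exact ⟨x, left_mem_uIcc, by simp⟩
  · obtain ⟨ξ, hξ, he⟩ := key y x hy h
    exact ⟨ξ, Icc_subset_uIcc' hξ, he⟩

/-- `∂h/∂ρ` at entropy `s` and density `ξ` -/
def hrho (γ s ξ : ℝ) : ℝ := γ * exp (γ * s) * ξ ^ (γ - 2)

/-- enthalpy as a function of entropy and density -/
def enth (γ s ρ : ℝ) : ℝ := γ / (γ - 1) * exp (γ * s) * ρ ^ (γ - 1)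

theorem hrho_bounds {γ M : ℝ} (hγ : 1 < γ) (hM : 1 ≤ M) : ∃ c > 0, ∃ C > 0, ∀ s ξ : ℝ,
    |s| ≤ M → ξ ∈ Icc M⁻¹ M → c ≤ hrho γ s ξ ∧ hrho γ s ξ ≤ C := by
  have h0 : 0 < γ := by linarith
  set B := γ * M + |γ - 2| * log M with hB
  refine ⟨γ * exp (-B), by positivity, γ * exp B, by positivity, fun s ξ hs hξ => ?_⟩
  have hM0 : 0 < M := by linarith
  have hξ0 : 0 < ξ := (inv_pos.2 hM0).trans_le hξ.1
  have hl : |log ξ| ≤ log M := by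
    rw [abs_le, ← log_inv]
    exact ⟨log_le_log (inv_pos.2 hM0) hξ.1, log_le_log hξ0 hξ.2⟩
  have e : hrho γ s ξ = γ * exp (γ * s + (γ - 2) * log ξ) := by
    rw [hrho, rpow_def_of_pos hξ0, exp_add, mul_comm (log ξ)]; ring
  have hb : |γ * s + (γ - 2) * log ξ| ≤ B := by
    refine (abs_add_le _ _).trans (add_le_add ?_ ?_)
    · rw [abs_mul, abs_of_pos h0]; exact mul_le_mul_of_nonneg_left hs h0.le
    · rw [abs_mul]; exact mul_le_mul_of_nonneg_left hl (abs_nonneg _)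
  rw [abs_le] at hb
  rw [e]
  exact ⟨mul_le_mul_of_nonneg_left (exp_le_exp.2 hb.1) h0.le,
    mul_le_mul_of_nonneg_left (exp_le_exp.2 hb.2) h0.le⟩

theorem uIcc_subset_Icc' {a b c d : ℝ} (ha : a ∈ Icc c d) (hb : b ∈ Icc c d) : uIcc a b ⊆ Icc c d :=
  fun _ hx => ⟨(le_inf ha.1 hb.1).trans hx.1, hx.2.trans (sup_le ha.2 hb.2)⟩

theorem enth_sub_enth {γ M : ℝ} (hγ : 1 < γ) : ∃ C > 0, ∀ s s' ρ ρ' : ℝ,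
    |s| ≤ M → |s'| ≤ M → 0 < ρ → 0 < ρ' → enth γ s' ρ' ≤ M →
    ∃ ξ ∈ uIcc ρ ρ', |enth γ s ρ - enth γ s' ρ' - hrho γ s ξ * (ρ - ρ')| ≤ C * |s - s'| := by
  refine ⟨(|M| + 1) * exp (2 * γ * |M|) * γ, by positivity, fun s s' ρ ρ' hs hs' hρ hρ' hh => ?_⟩
  obtain ⟨ξ, hξ, he⟩ := exists_rpow_sub_rpow (p := γ - 1) hρ hρ'
  refine ⟨ξ, hξ, ?_⟩
  have h1 : γ - 1 ≠ 0 := by linarith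
  have hMM := le_abs_self M
  have hid : enth γ s ρ - enth γ s' ρ' - hrho γ s ξ * (ρ - ρ') =
      enth γ s' ρ' * (exp (γ * (s - s')) - exp 0) := by
    have e2 : exp (γ * s) = exp (γ * s') * exp (γ * (s - s')) := by rw [← exp_add]; congr 1; ring
    have e3 : γ - 1 - 1 = γ - 2 := by ring
    rw [e3] at he
    have e4 : ρ ^ (γ - 1) = ρ' ^ (γ - 1) + (γ - 1) * ξ ^ (γ - 2) * (ρ - ρ') := by linarith
    rw [enth, enth, hrho, e4, exp_zero, e2]
    field_simp
    ring
  have h0 : 0 ≤ enth γ s' ρ' := by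
    rw [enth]
    have : 0 < γ - 1 := by linarith
    positivity
  rw [hid, abs_mul, abs_of_nonneg h0]
  rw [abs_le] at hs hs'
  have hx : γ * (s - s') ≤ 2 * γ * |M| := by nlinarith
  have := abs_exp_sub_exp_le hx (show (0:ℝ) ≤ 2 * γ * |M| by positivity)
  rw [sub_zero, abs_mul, abs_of_pos (show 0 < γ by linarith)] at this
  calc enth γ s' ρ' * |exp (γ * (s - s')) - exp 0|
      ≤ (|M| + 1) * (exp (2 * γ * |M|) * (γ * |s - s'|)) :=
        mul_le_mul (by linarith) this (abs_nonneg _) (by positivity)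
    _ = _ := by ring

theorem abs_sub_le_of_pressure_eq {γ M : ℝ} (hγ : 1 < γ) (hM : 1 ≤ M) {s s' ρ ρ' : ℝ}
    (hs : |s| ≤ M) (hs' : |s'| ≤ M) (hρ : ρ ∈ Icc M⁻¹ M) (hρ' : ρ' ∈ Icc M⁻¹ M)
    (hp : exp (γ * s) * ρ ^ γ = exp (γ * s') * ρ' ^ γ) :
    |ρ - ρ'| ≤ M * exp (2 * M) * |s - s'| := by
  have hM0 : 0 < M := by linarith
  have hρ0 : 0 < ρ := (inv_pos.2 hM0).trans_le hρ.1
  have hρ0' : 0 < ρ' := (inv_pos.2 hM0).trans_le hρ'.1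
  have hl := congrArg log hp
  rw [log_mul (exp_pos _).ne' (rpow_pos_of_pos hρ0 _).ne', log_mul (exp_pos _).ne'
    (rpow_pos_of_pos hρ0' _).ne', log_exp, log_exp, log_rpow hρ0, log_rpow hρ0'] at hl
  have hl' : log ρ = log ρ' + (s' - s) :=
    mul_left_cancel₀ (show γ ≠ 0 by linarith) (by linarith)
  have e : ρ - ρ' = ρ' * (exp (s' - s) - exp 0) := by
    rw [← exp_log hρ0, hl', exp_add, exp_log hρ0', exp_zero]; ring
  rw [abs_le] at hs hs'
  have := abs_exp_sub_exp_le (show s' - s ≤ 2 * M by linarith) (show (0:ℝ) ≤ 2 * M by linarith)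
  rw [sub_zero, abs_sub_comm s'] at this
  rw [e, abs_mul, abs_of_pos hρ0', mul_assoc]
  exact mul_le_mul hρ'.2 this (abs_nonneg _) hM0.le

theorem density_bound {H c C M δh r a k Ψ w₁ w₂ um vm : ℝ} (hc : 0 < c) (hC : 0 ≤ C) (hM : 1 ≤ M)
    (hH : c ≤ H) (hr : |δh - H * r| ≤ C * |a|) (hδ : δh = k + Ψ - um * w₁ - vm * w₂)
    (hu : |um| ≤ M) (hv : |vm| ≤ M) :
    |r| ≤ (M + C) / c * (|w₁| + |w₂| + |Ψ| + |k| + |a|) := by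
  have h1 : c * |r| ≤ |δh| + C * |a| := by
    have : |H * r| ≤ |δh| + C * |a| := by
      have h := abs_sub_abs_le_abs_sub (H * r) δh
      rw [abs_sub_comm] at h; linarith
    rw [abs_mul, abs_of_pos (hc.trans_le hH)] at this
    nlinarith [abs_nonneg r]
  have h2 : |δh| ≤ |k| + |Ψ| + M * |w₁| + M * |w₂| := by
    rw [hδ]
    have e1 : |um * w₁| ≤ M * |w₁| := by
      rw [abs_mul]; exact mul_le_mul_of_nonneg_right hu (abs_nonneg _)
    have e2 : |vm * w₂| ≤ M * |w₂| := by
      rw [abs_mul]; exact mul_le_mul_of_nonneg_right hv (abs_nonneg _)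
    have := abs_sub (k + Ψ - um * w₁) (vm * w₂)
    have := abs_sub (k + Ψ) (um * w₁)
    have := abs_add_le k Ψ
    linarith
  rw [div_mul_eq_mul_div, le_div_iff₀ hc]
  nlinarith [abs_nonneg w₁, abs_nonneg w₂, abs_nonneg Ψ, abs_nonneg k, abs_nonneg a,
    mul_nonneg hC (abs_nonneg w₁), mul_nonneg hC (abs_nonneg w₂), mul_nonneg hC (abs_nonneg Ψ),
    mul_nonneg hC (abs_nonneg k), mul_nonneg (sub_nonneg.2 hM) (abs_nonneg Ψ),
    mul_nonneg (sub_nonneg.2 hM) (abs_nonneg k), mul_nonneg (sub_nonneg.2 hM) (abs_nonneg a)]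

theorem coercive_bound {H c C₂ C M l δh r a k Ψ w₁ w₂ um vm ρm : ℝ} (hc : 0 < c) (hC : 0 ≤ C)
    (hM : 1 ≤ M) (hl : 0 < l) (hl1 : l ≤ 1) (hH : c ≤ H) (hH2 : H ≤ C₂)
    (hr : |δh - H * r| ≤ C * |a|) (hδ : δh = k + Ψ - um * w₁ - vm * w₂)
    (hu : |um| ≤ M) (hv : |vm| ≤ M) (hco : l ≤ H * ρm - (um ^ 2 + vm ^ 2)) :
    l / C₂ * (w₁ ^ 2 + w₂ ^ 2 + Ψ ^ 2) ≤
      (ρm * w₁ + um * r) * w₁ + (ρm * w₂ + vm * r) * w₂ + r * Ψ +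
      (1 + C) * M / c * ((|k| + |a|) * (|w₁| + |w₂| + |Ψ| + |k| + |a|)) := by
  set D := |w₁| + |w₂| + |Ψ| + |k| + |a| with hD
  set S := um * w₁ + vm * w₂ with hS
  set e := H * r - δh with he
  have hH0 : 0 < H := hc.trans_le hH
  have hea : |e| ≤ C * |a| := by rw [he, abs_sub_comm]; exact hr
  have hSD : |S + Ψ| ≤ M * D := by
    have e1 : |um * w₁| ≤ M * |w₁| := by
      rw [abs_mul]; exact mul_le_mul_of_nonneg_right hu (abs_nonneg _)
    have e2 : |vm * w₂| ≤ M * |w₂| := by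
      rw [abs_mul]; exact mul_le_mul_of_nonneg_right hv (abs_nonneg _)
    have := abs_add_le (um * w₁ + vm * w₂) Ψ
    have := abs_add_le (um * w₁) (vm * w₂)
    nlinarith [abs_nonneg k, abs_nonneg a, mul_nonneg (sub_nonneg.2 hM) (abs_nonneg Ψ)]
  have hD0 : 0 ≤ D := by positivity
  have hke : |k + e| ≤ (1 + C) * (|k| + |a|) := by
    have := abs_add_le k e
    nlinarith [abs_nonneg k, abs_nonneg a, mul_nonneg hC (abs_nonneg k)]
  have herr : -((1 + C) * M * ((|k| + |a|) * D)) ≤ (k + e) * (S + Ψ) := by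
    have h1 : |(k + e) * (S + Ψ)| ≤ (1 + C) * (|k| + |a|) * (M * D) := by
      rw [abs_mul]; exact mul_le_mul hke hSD (abs_nonneg _) (by positivity)
    have h2 := neg_abs_le ((k + e) * (S + Ψ))
    have h3 : (1 + C) * (|k| + |a|) * (M * D) = (1 + C) * M * ((|k| + |a|) * D) := by ring
    linarith
  have hS2 : S ^ 2 ≤ (um ^ 2 + vm ^ 2) * (w₁ ^ 2 + w₂ ^ 2) := by
    rw [hS]; nlinarith [sq_nonneg (um * w₂ - vm * w₁)]
  set Q := (ρm * w₁ + um * r) * w₁ + (ρm * w₂ + vm * r) * w₂ + r * Ψ with hQ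
  have hHQ : H * Q = H * ρm * (w₁ ^ 2 + w₂ ^ 2) + Ψ ^ 2 - S ^ 2 + (k + e) * (S + Ψ) := by
    have : H * r = k + Ψ - S + e := by rw [he, hδ, hS]; ring
    rw [hQ]
    linear_combination (S + Ψ) * this
  set X := l * (w₁ ^ 2 + w₂ ^ 2 + Ψ ^ 2) with hX
  set Y := (1 + C) * M * ((|k| + |a|) * D) with hY
  have hX0 : 0 ≤ X := by positivity
  have hY0 : 0 ≤ Y := by positivity
  have hmain : X - Y ≤ H * Q := by
    rw [hHQ, hX]
    have h1 := mul_le_mul_of_nonneg_right hco (add_nonneg (sq_nonneg w₁) (sq_nonneg w₂))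
    have h2 := mul_le_mul_of_nonneg_right hl1 (sq_nonneg Ψ)
    linarith
  have e1 : l / C₂ * (w₁ ^ 2 + w₂ ^ 2 + Ψ ^ 2) = X / C₂ := by rw [hX]; ring
  have e2 : (1 + C) * M / c * ((|k| + |a|) * D) = Y / c := by rw [hY]; ring
  rw [e1, e2]
  have h1 : X / C₂ ≤ X / H := div_le_div_of_nonneg_left hX0 hH0 hH2
  have h2 : Y / H ≤ Y / c := div_le_div_of_nonneg_left hY0 hc hH
  have h3 : (X - Y) / H ≤ Q := by rw [div_le_iff₀ hH0]; linarith
  rw [sub_div] at h3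
  linarith

/-- the functions entering the linear system satisfied by the difference of two flows -/
structure DiffFields where
  (w₁ w₂ Ψ k a r m₁ m₂ n₁ n₂ U₁ U₂ V₁ V₂ c Gk Ga : Pt → ℝ)
  (q q' : ℝ → ℝ)

namespace DiffFields

variable (S : DiffFields)

/-- sum of the absolute values of the independent differences -/
def D (x : Pt) : ℝ := |S.w₁ x| + |S.w₂ x| + |S.Ψ x| + |S.k x| + |S.a x|

/-- sum of the squares of the independent differences -/
def e (x : Pt) : ℝ := S.w₁ x ^ 2 + S.w₂ x ^ 2 + S.Ψ x ^ 2 + S.k x ^ 2 + S.a x ^ 2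

/-- first component of the velocity difference corrected by its vortical part -/
def z₁ (x : Pt) : ℝ := S.w₁ x - S.k x * S.U₁ x + S.a x * S.V₁ x

/-- second component of the velocity difference corrected by its vortical part -/
def z₂ (x : Pt) : ℝ := S.w₂ x - S.k x * S.U₂ x + S.a x * S.V₂ x

theorem sq_D_le (x : Pt) : S.D x ^ 2 ≤ 5 * S.e x := by
  have h : ∀ t1 t2 t3 t4 t5 : ℝ, (t1 + t2 + t3 + t4 + t5) ^ 2 ≤
      5 * (t1 ^ 2 + t2 ^ 2 + t3 ^ 2 + t4 ^ 2 + t5 ^ 2) := by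
    intro t1 t2 t3 t4 t5
    nlinarith [sq_nonneg (t1 - t2), sq_nonneg (t1 - t3), sq_nonneg (t1 - t4), sq_nonneg (t1 - t5),
      sq_nonneg (t2 - t3), sq_nonneg (t2 - t4), sq_nonneg (t2 - t5), sq_nonneg (t3 - t4),
      sq_nonneg (t3 - t5), sq_nonneg (t4 - t5)]
  simpa [D, e, sq_abs] using h |S.w₁ x| |S.w₂ x| |S.Ψ x| |S.k x| |S.a x|

theorem D_nonneg (x : Pt) : 0 ≤ S.D x := by unfold D; positivity

theorem e_nonneg (x : Pt) : 0 ≤ S.e x := by unfold e; positivity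

theorem abs_k_le (x : Pt) : |S.k x| ≤ S.D x := by
  unfold D; linarith [abs_nonneg (S.w₁ x), abs_nonneg (S.w₂ x), abs_nonneg (S.Ψ x),
    abs_nonneg (S.a x)]

theorem abs_a_le (x : Pt) : |S.a x| ≤ S.D x := by
  unfold D; linarith [abs_nonneg (S.w₁ x), abs_nonneg (S.w₂ x), abs_nonneg (S.Ψ x),
    abs_nonneg (S.k x)]

end DiffFields

/-- the linear system satisfied by the difference of two flows, with quantitative bounds -/
structure DiffSystem (L C l ε : ℝ) (S : DiffFields) : Prop where
  hw₁ : C1R L S.w₁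
  hw₂ : C1R L S.w₂
  hk : C1R L S.k
  ha : C1R L S.a
  hΨ : ∀ x ∈ Rect L, ContDiffAt ℝ 2 S.Ψ x
  hr : ContinuousOn S.r (Rect L)
  hm₁ : C1R L S.m₁
  hm₂ : C1R L S.m₂
  hn₁ : C1R L S.n₁
  hn₂ : C1R L S.n₂
  hU₁ : C1R L S.U₁
  hU₂ : C1R L S.U₂
  hV₁ : C1R L S.V₁
  hV₂ : C1R L S.V₂
  hc : ContinuousOn S.c (Rect L)
  hGk : ContinuousOn S.Gk (Rect L)
  hGa : ContinuousOn S.Ga (Rect L)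
  hq : ContinuousOn S.q (Icc 0 1)
  hq' : ContinuousOn S.q' (Icc 0 1)
  dq : ∀ y ∈ Ioo (0:ℝ) 1, HasDerivAt S.q (S.q' y) y
  q0 : S.q 0 = 0
  q1 : S.q 1 = 0
  q_le : ∀ y ∈ Icc (0:ℝ) 1, |S.q y| ≤ C
  q'_le : ∫ y in (0:ℝ)..1, (S.q' y / ε) ^ 2 ≤ C
  divm : ∀ x ∈ Noz L, pd1 S.m₁ x + pd2 S.m₂ x = 0
  divn : ∀ x ∈ Noz L, pd1 S.n₁ x + pd2 S.n₂ x = 0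
  m_w0 : ∀ s ∈ Icc 0 L, S.m₂ (s, 0) = 0
  m_w1 : ∀ s ∈ Icc 0 L, S.m₂ (s, 1) = 0
  n_w0 : ∀ s ∈ Icc 0 L, S.n₂ (s, 0) = 0
  n_w1 : ∀ s ∈ Icc 0 L, S.n₂ (s, 1) = 0
  m_lo : ∀ x ∈ Rect L, C⁻¹ ≤ S.m₁ x
  tr_k : ∀ x ∈ Noz L, S.m₁ x * pd1 S.k x + S.m₂ x * pd2 S.k x = S.Gk x
  tr_a : ∀ x ∈ Noz L, S.m₁ x * pd1 S.a x + S.m₂ x * pd2 S.a x = S.Ga x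
  Gk_le : ∀ x ∈ Rect L, |S.Gk x| ≤ C * ε * S.D x
  Ga_le : ∀ x ∈ Rect L, |S.Ga x| ≤ C * ε * S.D x
  k_in : ∀ y ∈ Icc (0:ℝ) 1, S.k (0, y) = 0
  a_in : ∀ y ∈ Icc (0:ℝ) 1, S.a (0, y) = 0
  w₂_in : ∀ y ∈ Icc (0:ℝ) 1, S.w₂ (0, y) = 0
  lapΨ : ∀ x ∈ Noz L, lap S.Ψ x = S.r x
  Ψ_in : ∀ y ∈ Icc (0:ℝ) 1, S.Ψ (0, y) = 0
  Ψ_ex : ∀ y ∈ Icc (0:ℝ) 1, S.Ψ (L, y) = 0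
  Ψ_w0 : ∀ s ∈ Ioo 0 L, pd2 S.Ψ (s, 0) = 0
  Ψ_w1 : ∀ s ∈ Ioo 0 L, pd2 S.Ψ (s, 1) = 0
  curl : ∀ x ∈ Rect L, pd1 S.z₂ x - pd2 S.z₁ x = S.c x
  c_le : ∀ x ∈ Rect L, |S.c x| ≤ C * (ε * S.D x + |S.k x| + |S.a x|)
  U₁_le : ∀ x ∈ Rect L, |S.U₁ x| ≤ C
  U₂_le : ∀ x ∈ Rect L, |S.U₂ x| ≤ C
  V₁_le : ∀ x ∈ Rect L, |S.V₁ x| ≤ C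
  V₂_le : ∀ x ∈ Rect L, |S.V₂ x| ≤ C
  n₁_le : ∀ x ∈ Rect L, |S.n₁ x| ≤ C * S.D x
  n₂_le : ∀ x ∈ Rect L, |S.n₂ x| ≤ C * S.D x
  coercive : ∀ x ∈ Rect L, l * (S.w₁ x ^ 2 + S.w₂ x ^ 2 + S.Ψ x ^ 2) ≤
    S.n₁ x * S.w₁ x + S.n₂ x * S.w₂ x + S.r x * S.Ψ x + C * ((|S.k x| + |S.a x|) * S.D x)
  exit : ∀ y ∈ Icc (0:ℝ) 1, |S.n₁ (L, y) + S.q y * S.w₂ (L, y)| ≤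
    C * (|S.k (L, y)| + |S.a (L, y)|)

theorem integral_Rect_const_mul {L c : ℝ} {F : Pt → ℝ} :
    ∫ x in Rect L, c * F x = c * ∫ x in Rect L, F x := integral_const_mul c F

/-- Young's inequality for a product of one quantity with a sum of three -/
theorem mul_sum_three_le {η d p₁ p₂ p₃ : ℝ} (hη : 0 < η) :
    d * (p₁ + p₂ + p₃) ≤ η / 2 * d ^ 2 + 3 / (2 * η) * (p₁ ^ 2 + p₂ ^ 2 + p₃ ^ 2) := by
  have h3 : (p₁ + p₂ + p₃) ^ 2 ≤ 3 * (p₁ ^ 2 + p₂ ^ 2 + p₃ ^ 2) := by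
    nlinarith [sq_nonneg (p₁ - p₂), sq_nonneg (p₁ - p₃), sq_nonneg (p₂ - p₃)]
  have h : 0 ≤ (η * d - (p₁ + p₂ + p₃)) ^ 2 / (2 * η) := by positivity
  have h' : (η * d - (p₁ + p₂ + p₃)) ^ 2 / (2 * η) =
      η / 2 * d ^ 2 - d * (p₁ + p₂ + p₃) + (p₁ + p₂ + p₃) ^ 2 / (2 * η) := by
    field_simp; ring
  have h4 : (p₁ + p₂ + p₃) ^ 2 / (2 * η) ≤ 3 * (p₁ ^ 2 + p₂ ^ 2 + p₃ ^ 2) / (2 * η) := by gcongr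
  have h5 : 3 * (p₁ ^ 2 + p₂ ^ 2 + p₃ ^ 2) / (2 * η) =
    3 / (2 * η) * (p₁ ^ 2 + p₂ ^ 2 + p₃ ^ 2) := by ring
  linarith

namespace DiffSystem

variable {L C l ε : ℝ} {S : DiffFields}

theorem C1R_z₁ (h : DiffSystem L C l ε S) : C1R L S.z₁ :=
  (h.hw₁.sub (h.hk.mul h.hU₁)).add (h.ha.mul h.hV₁)

theorem C1R_z₂ (h : DiffSystem L C l ε S) : C1R L S.z₂ :=
  (h.hw₂.sub (h.hk.mul h.hU₂)).add (h.ha.mul h.hV₂)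

theorem contΨ (h : DiffSystem L C l ε S) : ContinuousOn S.Ψ (Rect L) := fun x hx =>
  (h.hΨ x hx).continuousAt.continuousWithinAt

theorem cont_e (h : DiffSystem L C l ε S) : ContinuousOn S.e (Rect L) :=
  ((((h.hw₁.continuousOn.pow 2).add (h.hw₂.continuousOn.pow 2)).add (h.contΨ.pow 2)).add
    (h.hk.continuousOn.pow 2)).add (h.ha.continuousOn.pow 2)

theorem E_nonneg : 0 ≤ ∫ x in Rect L, S.e x := integral_Rect_nonneg fun x _ => S.e_nonneg x

theorem integral_mul_G_le (h : DiffSystem L C l ε S) {k G : Pt → ℝ} (hε : 0 < ε)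
    (hC : 1 ≤ C)
    (hk : ContinuousOn k (Rect L)) (hG : ContinuousOn G (Rect L)) (hkD : ∀ x, |k x| ≤ S.D x)
    (hGD : ∀ x ∈ Rect L, |G x| ≤ C * ε * S.D x) :
    ∫ x in Rect L, |k x| * |G x| ≤ 5 * C * ε * ∫ x in Rect L, S.e x := by
  rw [← integral_Rect_const_mul]
  refine integral_Rect_mono (hk.abs.mul hG.abs) (continuousOn_const.mul h.cont_e) fun x hx => ?_
  calc |k x| * |G x| ≤ S.D x * (C * ε * S.D x) :=
        mul_le_mul (hkD x) (hGD x hx) (abs_nonneg _) (S.D_nonneg x)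
    _ = C * ε * S.D x ^ 2 := by ring
    _ ≤ C * ε * (5 * S.e x) := by gcongr; exact S.sq_D_le x
    _ = 5 * C * ε * S.e x := by ring

theorem le_of_inv_mul_le {C A B : ℝ} (hC : 1 ≤ C) (h : C⁻¹ * A ≤ B) : A ≤ C * B := by
  have h' := mul_le_mul_of_nonneg_left h (by linarith : (0:ℝ) ≤ C)
  rwa [← mul_assoc, mul_inv_cancel₀ (by linarith), one_mul] at h'

theorem integral_k_sq_le (h : DiffSystem L C l ε S) (hL : 0 < L) (hε : 0 < ε) (hC : 1 ≤ C) :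
    ∫ x in Rect L, S.k x ^ 2 ≤ 10 * L * C ^ 2 * ε * ∫ x in Rect L, S.e x := by
  have h1 := le_of_inv_mul_le hC (transport_le hL h.hm₁ h.hm₂ h.hk h.hGk h.divm h.m_w0 h.m_w1
    h.tr_k h.k_in h.m_lo)
  have h2 := h.integral_mul_G_le hε hC h.hk.continuousOn h.hGk S.abs_k_le h.Gk_le
  calc _ ≤ _ := h1
    _ ≤ C * (2 * L * (5 * C * ε * ∫ x in Rect L, S.e x)) := by gcongr
    _ = _ := by ring

theorem integral_a_sq_le (h : DiffSystem L C l ε S) (hL : 0 < L) (hε : 0 < ε) (hC : 1 ≤ C) :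
    ∫ x in Rect L, S.a x ^ 2 ≤ 10 * L * C ^ 2 * ε * ∫ x in Rect L, S.e x := by
  have h1 := le_of_inv_mul_le hC (transport_le hL h.hm₁ h.hm₂ h.ha h.hGa h.divm h.m_w0 h.m_w1
    h.tr_a h.a_in h.m_lo)
  have h2 := h.integral_mul_G_le hε hC h.ha.continuousOn h.hGa S.abs_a_le h.Ga_le
  calc _ ≤ _ := h1
    _ ≤ C * (2 * L * (5 * C * ε * ∫ x in Rect L, S.e x)) := by gcongr
    _ = _ := by ring

theorem exit_k_sq_le (h : DiffSystem L C l ε S) (hL : 0 < L) (hε : 0 < ε) (hC : 1 ≤ C) :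
    ∫ y in (0:ℝ)..1, S.k (L, y) ^ 2 ≤ 10 * C ^ 2 * ε * ∫ x in Rect L, S.e x := by
  have h1 := le_of_inv_mul_le hC (transport_slice_le hL h.hm₁ h.hm₂ h.hk h.hGk h.divm h.m_w0
    h.m_w1 h.tr_k h.k_in h.m_lo (right_mem_Icc.2 hL.le))
  have h2 := h.integral_mul_G_le hε hC h.hk.continuousOn h.hGk S.abs_k_le h.Gk_le
  calc _ ≤ _ := h1
    _ ≤ C * (2 * (5 * C * ε * ∫ x in Rect L, S.e x)) := by gcongr
    _ = _ := by ring

theorem exit_a_sq_le (h : DiffSystem L C l ε S) (hL : 0 < L) (hε : 0 < ε) (hC : 1 ≤ C) :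
    ∫ y in (0:ℝ)..1, S.a (L, y) ^ 2 ≤ 10 * C ^ 2 * ε * ∫ x in Rect L, S.e x := by
  have h1 := le_of_inv_mul_le hC (transport_slice_le hL h.hm₁ h.hm₂ h.ha h.hGa h.divm h.m_w0
    h.m_w1 h.tr_a h.a_in h.m_lo (right_mem_Icc.2 hL.le))
  have h2 := h.integral_mul_G_le hε hC h.ha.continuousOn h.hGa S.abs_a_le h.Ga_le
  calc _ ≤ _ := h1
    _ ≤ C * (2 * (5 * C * ε * ∫ x in Rect L, S.e x)) := by gcongr
    _ = _ := by ring

theorem integral_c_sq_le (h : DiffSystem L C l ε S) (hL : 0 < L) (hε : 0 < ε) (hε1 : ε ≤ 1)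
    (hC : 1 ≤ C) : ∫ x in Rect L, S.c x ^ 2 ≤
      (15 * C ^ 2 + 60 * L * C ^ 4) * ε * ∫ x in Rect L, S.e x := by
  have c1 : ContinuousOn (fun x => 15 * C ^ 2 * ε * S.e x) (Rect L) :=
    continuousOn_const.mul h.cont_e
  have c2 : ContinuousOn (fun x => 3 * C ^ 2 * S.k x ^ 2) (Rect L) :=
    continuousOn_const.mul (h.hk.continuousOn.pow 2)
  have c3 : ContinuousOn (fun x => 3 * C ^ 2 * S.a x ^ 2) (Rect L) :=
    continuousOn_const.mul (h.ha.continuousOn.pow 2)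
  have c12 : ContinuousOn (fun x => 15 * C ^ 2 * ε * S.e x + 3 * C ^ 2 * S.k x ^ 2) (Rect L) :=
    c1.add c2
  have key : ∫ x in Rect L, S.c x ^ 2 ≤
      ∫ x in Rect L, (15 * C ^ 2 * ε * S.e x + 3 * C ^ 2 * S.k x ^ 2 + 3 * C ^ 2 * S.a x ^ 2) := by
    refine integral_Rect_mono (h.hc.pow 2) (c12.add c3) fun x hx => ?_
    have h1 : S.c x ^ 2 ≤ (C * (ε * S.D x + |S.k x| + |S.a x|)) ^ 2 :=
      sq_le_sq' (by linarith [(abs_le.1 (h.c_le x hx)).1]) (abs_le.1 (h.c_le x hx)).2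
    have h2 : (ε * S.D x + |S.k x| + |S.a x|) ^ 2 ≤
        3 * (ε ^ 2 * S.D x ^ 2 + S.k x ^ 2 + S.a x ^ 2) := by
      rw [← sq_abs (S.k x), ← sq_abs (S.a x)]
      nlinarith [sq_nonneg (ε * S.D x - |S.k x|), sq_nonneg (ε * S.D x - |S.a x|),
        sq_nonneg (|S.k x| - |S.a x|)]
    have h3 : ε ^ 2 * S.D x ^ 2 ≤ ε * (5 * S.e x) := by
      have := S.sq_D_le x
      have : ε ^ 2 ≤ ε := by nlinarith
      exact mul_le_mul this (S.sq_D_le x) (sq_nonneg _) hε.le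
    calc S.c x ^ 2 ≤ C ^ 2 * (ε * S.D x + |S.k x| + |S.a x|) ^ 2 := by
          rw [← mul_pow]; exact h1
      _ ≤ C ^ 2 * (3 * (ε * (5 * S.e x) + S.k x ^ 2 + S.a x ^ 2)) := by
          gcongr; linarith
      _ = _ := by ring
  rw [integral_Rect_add c12 c3, integral_Rect_add c1 c2, integral_Rect_const_mul,
    integral_Rect_const_mul, integral_Rect_const_mul] at key
  have hk := mul_le_mul_of_nonneg_left (h.integral_k_sq_le hL hε hC)
    (by positivity : (0:ℝ) ≤ 3 * C ^ 2)
  have ha := mul_le_mul_of_nonneg_left (h.integral_a_sq_le hL hε hC)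
    (by positivity : (0:ℝ) ≤ 3 * C ^ 2)
  nlinarith

theorem sq_corrected_le {w k a U V C : ℝ} (hC : 1 ≤ C) (hU : |U| ≤ C) (hV : |V| ≤ C) :
    (w - k * U + a * V) ^ 2 ≤ 3 * C ^ 2 * (w ^ 2 + k ^ 2 + a ^ 2) := by
  have h1 : U ^ 2 ≤ C ^ 2 := sq_le_sq' (by linarith [(abs_le.1 hU).1]) (abs_le.1 hU).2
  have h2 : V ^ 2 ≤ C ^ 2 := sq_le_sq' (by linarith [(abs_le.1 hV).1]) (abs_le.1 hV).2
  have h3 : (w - k * U + a * V) ^ 2 ≤ 3 * (w ^ 2 + k ^ 2 * U ^ 2 + a ^ 2 * V ^ 2) := by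
    nlinarith [sq_nonneg (w + k * U), sq_nonneg (w - a * V), sq_nonneg (k * U + a * V)]
  have h4 : k ^ 2 * U ^ 2 ≤ k ^ 2 * C ^ 2 := by gcongr
  have h5 : a ^ 2 * V ^ 2 ≤ a ^ 2 * C ^ 2 := by gcongr
  have h6 : w ^ 2 ≤ w ^ 2 * C ^ 2 := le_mul_of_one_le_right (sq_nonneg _) (by nlinarith)
  nlinarith

theorem integral_z₁_sq_le (h : DiffSystem L C l ε S) (hC : 1 ≤ C) :
    ∫ x in Rect L, S.z₁ x ^ 2 ≤ 3 * C ^ 2 * ∫ x in Rect L, S.e x := by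
  rw [← integral_Rect_const_mul]
  refine integral_Rect_mono (h.C1R_z₁.continuousOn.pow 2) (continuousOn_const.mul h.cont_e)
    fun x hx => (sq_corrected_le hC (h.U₁_le x hx) (h.V₁_le x hx)).trans ?_
  gcongr
  unfold DiffFields.e
  nlinarith [sq_nonneg (S.w₂ x), sq_nonneg (S.Ψ x)]

theorem integral_z₂_sq_le (h : DiffSystem L C l ε S) (hC : 1 ≤ C) :
    ∫ x in Rect L, S.z₂ x ^ 2 ≤ 3 * C ^ 2 * ∫ x in Rect L, S.e x := by
  rw [← integral_Rect_const_mul]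
  refine integral_Rect_mono (h.C1R_z₂.continuousOn.pow 2) (continuousOn_const.mul h.cont_e)
    fun x hx => (sq_corrected_le hC (h.U₂_le x hx) (h.V₂_le x hx)).trans ?_
  gcongr
  unfold DiffFields.e
  nlinarith [sq_nonneg (S.w₁ x), sq_nonneg (S.Ψ x)]

/-- the vertical derivative of the potential of the corrected velocity difference -/
theorem prim_pd2_z₁ (h : DiffSystem L C l ε S) {x : Pt} (hx : x ∈ Rect L) :
    prim (pd2 S.z₁) x = S.z₂ x - prim S.c x := by
  have hx1 : x.1 ∈ Icc 0 L := hx.1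
  have sub : Icc 0 x.1 ⊆ Icc 0 L := Icc_subset_Icc_right hx1.2
  have hu : uIcc 0 x.1 = Icc 0 x.1 := uIcc_of_le hx1.1
  have i1 : IntervalIntegrable (fun s => pd1 S.z₂ (s, x.2)) volume 0 x.1 := by
    apply ContinuousOn.intervalIntegrable
    rw [hu]
    exact ((h.C1R_z₂.continuousOn_pd1).slice_snd hx.2).mono sub
  have i2 : IntervalIntegrable (fun s => S.c (s, x.2)) volume 0 x.1 := by
    apply ContinuousOn.intervalIntegrable
    rw [hu]
    exact (h.hc.slice_snd hx.2).mono sub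
  have e1 : prim (pd2 S.z₁) x = ∫ s in (0:ℝ)..x.1, (pd1 S.z₂ (s, x.2) - S.c (s, x.2)) := by
    refine intervalIntegral.integral_congr fun s hs => ?_
    rw [hu] at hs
    have := h.curl (s, x.2) ⟨sub hs, hx.2⟩
    linarith
  have e2 : ∫ s in (0:ℝ)..x.1, pd1 S.z₂ (s, x.2) = S.z₂ (x.1, x.2) - S.z₂ (0, x.2) := by
    refine intervalIntegral.integral_eq_sub_of_hasDerivAt (f := fun s => S.z₂ (s, x.2))
      (fun s hs => ?_) i1
    rw [hu] at hs
    exact hasDerivAt_fst (x := (s, x.2)) (h.C1R_z₂.differentiableAt ⟨sub hs, hx.2⟩)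
  have e3 : S.z₂ (0, x.2) = 0 := by
    simp [DiffFields.z₂, h.w₂_in x.2 hx.2, h.k_in x.2 hx.2, h.a_in x.2 hx.2]
  rw [e1, intervalIntegral.integral_sub i1 i2, e2, e3, sub_zero]
  rfl

end DiffSystem

namespace DiffSystem

variable {L C l ε : ℝ} {S : DiffFields}

theorem integral_prim_c_sq_le (h : DiffSystem L C l ε S) (hL : 0 < L) (hε : 0 < ε) (hε1 : ε ≤ 1)
    (hC : 1 ≤ C) : ∫ x in Rect L, prim S.c x ^ 2 ≤
      L ^ 2 * ((15 * C ^ 2 + 60 * L * C ^ 4) * ε * ∫ x in Rect L, S.e x) :=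
  (integral_prim_sq_le hL.le h.hc).trans
    (mul_le_mul_of_nonneg_left (h.integral_c_sq_le hL hε hε1 hC) (by positivity))

theorem exit_prim_c_sq_le (h : DiffSystem L C l ε S) (hL : 0 < L) (hε : 0 < ε) (hε1 : ε ≤ 1)
    (hC : 1 ≤ C) : ∫ y in (0:ℝ)..1, prim S.c (L, y) ^ 2 ≤
      L * ((15 * C ^ 2 + 60 * L * C ^ 4) * ε * ∫ x in Rect L, S.e x) :=
  (integral_prim_exit_sq_le hL.le h.hc).trans
    (mul_le_mul_of_nonneg_left (h.integral_c_sq_le hL hε hε1 hC) hL.le)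

theorem abs_corrected_le {k a U V C : ℝ} (hU : |U| ≤ C) (hV : |V| ≤ C) :
    |k * U - a * V| ≤ C * (|k| + |a|) := by
  calc |k * U - a * V| ≤ |k * U| + |a * V| := abs_sub _ _
    _ = |k| * |U| + |a| * |V| := by rw [abs_mul, abs_mul]
    _ ≤ |k| * C + |a| * C := by gcongr
    _ = _ := by ring

theorem pointwise_le (h : DiffSystem L C l ε S) (hC : 1 ≤ C) {η : ℝ} (hη : 0 < η) {x : Pt}
    (hx : x ∈ Rect L) : l * (S.w₁ x ^ 2 + S.w₂ x ^ 2 + S.Ψ x ^ 2) ≤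
      (S.n₁ x * S.z₁ x + S.n₂ x * (S.z₂ x - prim S.c x)) + S.r x * S.Ψ x +
      3 * C ^ 2 * (5 / 2 * η * S.e x + 3 / (2 * η) * (S.k x ^ 2 + S.a x ^ 2 + prim S.c x ^ 2)) := by
  have hD := S.D_nonneg x
  have h0 := h.coercive x hx
  have hn₁ := h.n₁_le x hx
  have hn₂ := h.n₂_le x hx
  have hu1 := abs_corrected_le (k := S.k x) (a := S.a x) (h.U₁_le x hx) (h.V₁_le x hx)
  have hu2 := abs_corrected_le (k := S.k x) (a := S.a x) (h.U₂_le x hx) (h.V₂_le x hx)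
  have t1 : S.n₁ x * (S.k x * S.U₁ x - S.a x * S.V₁ x) ≤
      C * S.D x * (C * (|S.k x| + |S.a x|)) :=
    (le_abs_self _).trans (by rw [abs_mul]; gcongr)
  have t2 : S.n₂ x * (S.k x * S.U₂ x - S.a x * S.V₂ x) ≤
      C * S.D x * (C * (|S.k x| + |S.a x|)) :=
    (le_abs_self _).trans (by rw [abs_mul]; gcongr)
  have t3 : S.n₂ x * prim S.c x ≤ C * S.D x * |prim S.c x| :=
    (le_abs_self _).trans (by rw [abs_mul]; gcongr)
  have y := mul_sum_three_le (d := S.D x) (p₁ := |S.k x|) (p₂ := |S.a x|) (p₃ := |prim S.c x|) hη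
  simp only [sq_abs] at y
  have y2 : η / 2 * S.D x ^ 2 ≤ 5 / 2 * η * S.e x := by nlinarith [S.sq_D_le x]
  have y3 := mul_le_mul_of_nonneg_left (y.trans (add_le_add_left y2 _))
    (by positivity : (0:ℝ) ≤ 3 * C ^ 2)
  have g1 : C * ((|S.k x| + |S.a x|) * S.D x) ≤ C ^ 2 * ((|S.k x| + |S.a x|) * S.D x) := by
    gcongr; nlinarith
  have g2 : C * S.D x * |prim S.c x| ≤ 3 * C ^ 2 * (S.D x * |prim S.c x|) := by
    rw [mul_assoc]; gcongr; nlinarith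
  have z1 : S.w₁ x = S.z₁ x + (S.k x * S.U₁ x - S.a x * S.V₁ x) := by
    simp only [DiffFields.z₁]; ring
  have z2 : S.w₂ x = (S.z₂ x - prim S.c x) + prim S.c x +
    (S.k x * S.U₂ x - S.a x * S.V₂ x) := by simp only [DiffFields.z₂]; ring
  have e1 : S.n₁ x * S.w₁ x = S.n₁ x * S.z₁ x +
    S.n₁ x * (S.k x * S.U₁ x - S.a x * S.V₁ x) := by rw [← mul_add, ← z1]
  have e2 : S.n₂ x * S.w₂ x = S.n₂ x * (S.z₂ x - prim S.c x) + S.n₂ x * prim S.c x +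
    S.n₂ x * (S.k x * S.U₂ x - S.a x * S.V₂ x) := by rw [← mul_add, ← mul_add, ← z2]
  linarith

theorem cont_prim_c (h : DiffSystem L C l ε S) (hL : 0 < L) : ContinuousOn (prim S.c) (Rect L) :=
  h.hc.prim hL.le

theorem integral_flux_eq (h : DiffSystem L C l ε S) (hL : 0 < L) :
    ∫ x in Rect L, (S.n₁ x * S.z₁ x + S.n₂ x * (S.z₂ x - prim S.c x)) =
      ∫ y in (0:ℝ)..1, S.n₁ (L, y) * prim S.z₁ (L, y) := by
  refine integral_div_free hL.le h.hn₁ h.hn₂ h.divn h.n_w0 h.n_w1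
    (h.C1R_z₁.continuousOn.prim hL.le) h.C1R_z₁.continuousOn
    (h.C1R_z₂.continuousOn.sub (h.cont_prim_c hL)) (fun x hx => ?_) (fun y _ => prim_zero _ y)
  obtain ⟨d, d1, d2⟩ := prim_derivs hL.le h.C1R_z₁ hx
  exact ⟨d, d1, d2.trans (h.prim_pd2_z₁ (Noz_subset_Rect L hx))⟩

theorem interior_le (h : DiffSystem L C l ε S) (hL : 0 < L) (hC : 1 ≤ C) {η : ℝ} (hη : 0 < η)
    (hη1 : η ≤ 1) (hε : ε = η ^ 2) :
    l * ∫ x in Rect L, (S.w₁ x ^ 2 + S.w₂ x ^ 2 + S.Ψ x ^ 2) ≤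
      (∫ y in (0:ℝ)..1, S.n₁ (L, y) * prim S.z₁ (L, y)) +
      3 * C ^ 2 * (5 / 2 + 3 / 2 * (20 * L * C ^ 2 + L ^ 2 * (15 * C ^ 2 + 60 * L * C ^ 4))) * η *
        ∫ x in Rect L, S.e x := by
  have hε0 : 0 < ε := by rw [hε]; positivity
  have hε1 : ε ≤ 1 := by rw [hε]; nlinarith
  have cw : ContinuousOn (fun x => S.w₁ x ^ 2 + S.w₂ x ^ 2 + S.Ψ x ^ 2) (Rect L) :=
    ((h.hw₁.continuousOn.pow 2).add (h.hw₂.continuousOn.pow 2)).add (h.contΨ.pow 2)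
  have cP := h.cont_prim_c hL
  have c1 : ContinuousOn (fun x => S.n₁ x * S.z₁ x + S.n₂ x * (S.z₂ x - prim S.c x)) (Rect L) :=
    (h.hn₁.continuousOn.mul h.C1R_z₁.continuousOn).add
      (h.hn₂.continuousOn.mul (h.C1R_z₂.continuousOn.sub cP))
  have c2 : ContinuousOn (fun x => S.r x * S.Ψ x) (Rect L) := h.hr.mul h.contΨ
  have c12 : ContinuousOn (fun x => S.n₁ x * S.z₁ x + S.n₂ x * (S.z₂ x - prim S.c x) +
    S.r x * S.Ψ x) (Rect L) := c1.add c2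
  have ck : ContinuousOn (fun x => S.k x ^ 2) (Rect L) := h.hk.continuousOn.pow 2
  have ca : ContinuousOn (fun x => S.a x ^ 2) (Rect L) := h.ha.continuousOn.pow 2
  have cP2 : ContinuousOn (fun x => prim S.c x ^ 2) (Rect L) := cP.pow 2
  have cka : ContinuousOn (fun x => S.k x ^ 2 + S.a x ^ 2) (Rect L) := ck.add ca
  have ckaP : ContinuousOn (fun x => S.k x ^ 2 + S.a x ^ 2 + prim S.c x ^ 2) (Rect L) :=
    cka.add cP2
  have c3 : ContinuousOn (fun x => 5 / 2 * η * S.e x) (Rect L) := continuousOn_const.mul h.cont_e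
  have c4 : ContinuousOn (fun x => 3 / (2 * η) * (S.k x ^ 2 + S.a x ^ 2 + prim S.c x ^ 2))
    (Rect L) := continuousOn_const.mul ckaP
  have c34 : ContinuousOn (fun x => 3 * C ^ 2 * (5 / 2 * η * S.e x +
    3 / (2 * η) * (S.k x ^ 2 + S.a x ^ 2 + prim S.c x ^ 2))) (Rect L) :=
    continuousOn_const.mul (c3.add c4)
  have cl : ContinuousOn (fun x => l * (S.w₁ x ^ 2 + S.w₂ x ^ 2 + S.Ψ x ^ 2)) (Rect L) :=
    continuousOn_const.mul cw
  have c14 : ContinuousOn (fun x => S.n₁ x * S.z₁ x + S.n₂ x * (S.z₂ x - prim S.c x) +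
    S.r x * S.Ψ x + 3 * C ^ 2 * (5 / 2 * η * S.e x +
    3 / (2 * η) * (S.k x ^ 2 + S.a x ^ 2 + prim S.c x ^ 2))) (Rect L) := c12.add c34
  have key := integral_Rect_mono cl c14
    fun x hx => h.pointwise_le hC hη hx
  rw [integral_Rect_const_mul, integral_Rect_add c12 c34, integral_Rect_add c1 c2,
    integral_Rect_const_mul, integral_Rect_add c3 c4, integral_Rect_const_mul,
    integral_Rect_const_mul, integral_Rect_add cka cP2, integral_Rect_add ck ca,
    h.integral_flux_eq hL] at key
  have hp := integral_poisson_nonpos hL h.hΨ h.hr h.lapΨ h.Ψ_in h.Ψ_ex h.Ψ_w0 h.Ψ_w1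
  have hk := h.integral_k_sq_le hL hε0 hC
  have ha := h.integral_a_sq_le hL hε0 hC
  have hP := h.integral_prim_c_sq_le hL hε0 hε1 hC
  set E := ∫ x in Rect L, S.e x
  have hs : 3 / (2 * η) * ((∫ x in Rect L, S.k x ^ 2) + (∫ x in Rect L, S.a x ^ 2) +
      ∫ x in Rect L, prim S.c x ^ 2) ≤ 3 / (2 * η) *
        ((20 * L * C ^ 2 + L ^ 2 * (15 * C ^ 2 + 60 * L * C ^ 4)) * ε * E) := by
    gcongr; linarith
  have hs2 : 3 / (2 * η) *
        ((20 * L * C ^ 2 + L ^ 2 * (15 * C ^ 2 + 60 * L * C ^ 4)) * ε * E) =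
      3 / 2 * (20 * L * C ^ 2 + L ^ 2 * (15 * C ^ 2 + 60 * L * C ^ 4)) * η * E := by
    rw [hε]; field_simp
  rw [hs2] at hs
  have := mul_le_mul_of_nonneg_left (add_le_add_left hs (5 / 2 * η * E))
    (by positivity : (0:ℝ) ≤ 3 * C ^ 2)
  linarith

theorem exit_pointwise_le (h : DiffSystem L C l ε S) (hL : 0 < L) (hC : 1 ≤ C) {η : ℝ}
    (hη : 0 < η) {y : ℝ} (hy : y ∈ Icc (0:ℝ) 1) :
    S.n₁ (L, y) * prim S.z₁ (L, y) ≤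
      - (S.q y * prim S.z₁ (L, y) * (S.z₂ (L, y) - prim S.c (L, y))) +
      2 * C ^ 2 * (η / 2 * prim S.z₁ (L, y) ^ 2 +
        3 / (2 * η) * (S.k (L, y) ^ 2 + S.a (L, y) ^ 2 + prim S.c (L, y) ^ 2)) := by
  have hx : ((L, y) : Pt) ∈ Rect L := mem_Rect (right_mem_Icc.2 hL.le) hy
  have h0 := h.exit y hy
  have hq := h.q_le y hy
  have hu2 := abs_corrected_le (k := S.k (L, y)) (a := S.a (L, y)) (h.U₂_le _ hx) (h.V₂_le _ hx)
  set φ := prim S.z₁ (L, y)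
  set P := prim S.c (L, y)
  set k := S.k (L, y)
  set a := S.a (L, y)
  have t1 : (S.n₁ (L, y) + S.q y * S.w₂ (L, y)) * φ ≤ C * (|k| + |a|) * |φ| :=
    (le_abs_self _).trans (by rw [abs_mul]; gcongr)
  have t2 : -(S.q y * (P + (k * S.U₂ (L, y) - a * S.V₂ (L, y))) * φ) ≤
      C * (|P| + C * (|k| + |a|)) * |φ| := by
    refine (neg_le_abs _).trans ?_
    rw [abs_mul, abs_mul]
    gcongr
    exact (abs_add_le _ _).trans (by gcongr)
  have y1 := mul_le_mul_of_nonneg_left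
    (mul_sum_three_le (d := |φ|) (p₁ := |k|) (p₂ := |a|) (p₃ := |P|) hη)
    (by positivity : (0:ℝ) ≤ 2 * C ^ 2)
  simp only [sq_abs] at y1
  have g1 : C * (|k| + |a|) * |φ| ≤ C ^ 2 * ((|k| + |a|) * |φ|) := by
    rw [mul_assoc]; gcongr; nlinarith
  have g2 : C * |P| * |φ| ≤ 2 * C ^ 2 * (|P| * |φ|) := by
    rw [mul_assoc]; gcongr; nlinarith
  have z2 : S.w₂ (L, y) = (S.z₂ (L, y) - P) + (P + (k * S.U₂ (L, y) - a * S.V₂ (L, y))) := by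
    simp only [DiffFields.z₂, k, a]; ring
  have e2 : S.n₁ (L, y) * φ = (S.n₁ (L, y) + S.q y * S.w₂ (L, y)) * φ -
      S.q y * φ * (S.z₂ (L, y) - P) - S.q y * (P + (k * S.U₂ (L, y) - a * S.V₂ (L, y))) * φ := by
    rw [z2]; ring
  linarith

theorem exit_quadratic_le (h : DiffSystem L C l ε S) (hL : 0 < L) (hC : 1 ≤ C) (hε : 0 < ε)
    (hε1 : ε ≤ 1) :
    ∫ y in (0:ℝ)..1, -(S.q y * prim S.z₁ (L, y) * (S.z₂ (L, y) - prim S.c (L, y))) ≤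
      ε / 2 * ((3 * C ^ 2 + C * (2 * (L ^ 2 * (3 * C ^ 2) + 2 * (3 * C ^ 2) +
        2 * (L ^ 2 * (15 * C ^ 2 + 60 * L * C ^ 4))))) * ∫ x in Rect L, S.e x) := by
  have hLm : L ∈ Icc 0 L := right_mem_Icc.2 hL.le
  have cφ : ContinuousOn (prim S.z₁) (Rect L) := h.C1R_z₁.continuousOn.prim hL.le
  have cP := h.cont_prim_c hL
  have cb : ContinuousOn (fun x => S.z₂ x - prim S.c x) (Rect L) :=
    h.C1R_z₂.continuousOn.sub cP
  have cφy : ContinuousOn (fun y => prim S.z₁ (L, y)) (Icc 0 1) := cφ.slice_fst hLm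
  have hparts := integral_mul_deriv_sq h.hq h.hq' cφy (cb.slice_fst hLm) h.dq
    (fun y hy => by
      have := hasDerivAt_prim_snd (x := (L, y)) h.C1R_z₁ hLm hy
      rwa [h.prim_pd2_z₁ (mem_Rect hLm (Ioo_subset_Icc_self hy))] at this) h.q0 h.q1
  rw [intervalIntegral.integral_neg, hparts]
  have cβ : ContinuousOn (fun y => |S.q' y| / ε) (Icc 0 1) := h.hq'.abs.div_const _
  have hw := integral_weight_exit_le hL.le h.C1R_z₁ cβ
  have hβ : ∫ y in (0:ℝ)..1, (|S.q' y| / ε) ^ 2 ≤ C := by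
    refine le_trans (le_of_eq ?_) h.q'_le
    congr 1; ext y; rw [div_pow, div_pow, sq_abs]
  have c1 : ContinuousOn (fun x => prim S.z₁ x ^ 2) (Rect L) := cφ.pow 2
  have c2 : ContinuousOn (fun x => prim (pd2 S.z₁) x ^ 2) (Rect L) :=
    (h.C1R_z₁.continuousOn_pd2.prim hL.le).pow 2
  rw [integral_Rect_add c1 c2] at hw
  have cz : ContinuousOn (fun x => 2 * S.z₂ x ^ 2) (Rect L) :=
    continuousOn_const.mul (h.C1R_z₂.continuousOn.pow 2)
  have cPP : ContinuousOn (fun x => 2 * prim S.c x ^ 2) (Rect L) :=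
    continuousOn_const.mul (cP.pow 2)
  have hφ2 : ∫ x in Rect L, prim (pd2 S.z₁) x ^ 2 ≤
      2 * (∫ x in Rect L, S.z₂ x ^ 2) + 2 * ∫ x in Rect L, prim S.c x ^ 2 := by
    rw [← integral_Rect_const_mul, ← integral_Rect_const_mul, ← integral_Rect_add cz cPP]
    refine integral_Rect_mono c2 (cz.add cPP) fun x hx => ?_
    rw [h.prim_pd2_z₁ hx]
    nlinarith [sq_nonneg (S.z₂ x + prim S.c x)]
  have hφ := integral_prim_sq_le hL.le h.C1R_z₁.continuousOn
  have hz1 := h.integral_z₁_sq_le hC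
  have hz2 := h.integral_z₂_sq_le hC
  have hP := h.integral_prim_c_sq_le hL hε hε1 hC
  have hE : 0 ≤ ∫ x in Rect L, S.e x := E_nonneg
  have hmono : ∫ y in (0:ℝ)..1, S.q' y * prim S.z₁ (L, y) ^ 2 ≤
      ∫ y in (0:ℝ)..1, ε * (|S.q' y| / ε * prim S.z₁ (L, y) ^ 2) := by
    have u : uIcc (0:ℝ) 1 = Icc 0 1 := uIcc_of_le zero_le_one
    refine intervalIntegral.integral_mono_on zero_le_one
      (ContinuousOn.intervalIntegrable (by rw [u]; exact h.hq'.mul (cφy.pow 2)))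
      (ContinuousOn.intervalIntegrable
        (by rw [u]; exact continuousOn_const.mul (cβ.mul (cφy.pow 2)))) fun y _ => ?_
    have : ε * (|S.q' y| / ε * prim S.z₁ (L, y) ^ 2) = |S.q' y| * prim S.z₁ (L, y) ^ 2 := by
      field_simp
    rw [this]
    gcongr
    exact le_abs_self _
  rw [intervalIntegral.integral_const_mul] at hmono
  have hsum : (∫ x in Rect L, prim S.z₁ x ^ 2) + ∫ x in Rect L, prim (pd2 S.z₁) x ^ 2 ≤
      (L ^ 2 * (3 * C ^ 2) + 2 * (3 * C ^ 2) +
        2 * (L ^ 2 * (15 * C ^ 2 + 60 * L * C ^ 4))) * ∫ x in Rect L, S.e x := by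
    have t1 := mul_le_mul_of_nonneg_left hz1 (sq_nonneg L)
    have t2 : (15 * C ^ 2 + 60 * L * C ^ 4) * ε * (∫ x in Rect L, S.e x) ≤
      (15 * C ^ 2 + 60 * L * C ^ 4) * 1 * ∫ x in Rect L, S.e x := by gcongr
    have t3 := mul_le_mul_of_nonneg_left t2 (sq_nonneg L)
    linarith
  have hsn : 0 ≤ (∫ x in Rect L, prim S.z₁ x ^ 2) + ∫ x in Rect L, prim (pd2 S.z₁) x ^ 2 :=
    add_nonneg (integral_Rect_nonneg fun _ _ => sq_nonneg _)
      (integral_Rect_nonneg fun _ _ => sq_nonneg _)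
  have hprod := mul_le_mul hβ (mul_le_mul_of_nonneg_left hsum zero_le_two)
    (by positivity) (by linarith)
  have hfin := mul_le_mul_of_nonneg_left (hw.trans (add_le_add hz1 hprod)) hε.le
  linarith

theorem exit_le (h : DiffSystem L C l ε S) (hL : 0 < L) (hC : 1 ≤ C) {η : ℝ} (hη : 0 < η)
    (hη1 : η ≤ 1) (hε : ε = η ^ 2) :
    ∫ y in (0:ℝ)..1, S.n₁ (L, y) * prim S.z₁ (L, y) ≤
      (1 / 2 * (3 * C ^ 2 + C * (2 * (L ^ 2 * (3 * C ^ 2) + 2 * (3 * C ^ 2) +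
        2 * (L ^ 2 * (15 * C ^ 2 + 60 * L * C ^ 4))))) + 2 * C ^ 2 * (1 / 2 * (L * (3 * C ^ 2)) +
        3 / 2 * (20 * C ^ 2 + L * (15 * C ^ 2 + 60 * L * C ^ 4)))) * η *
        ∫ x in Rect L, S.e x := by
  have hε0 : 0 < ε := by rw [hε]; positivity
  have hε1 : ε ≤ 1 := by rw [hε]; nlinarith
  have hLm : L ∈ Icc 0 L := right_mem_Icc.2 hL.le
  have cφ : ContinuousOn (prim S.z₁) (Rect L) := h.C1R_z₁.continuousOn.prim hL.le
  have cP := h.cont_prim_c hL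
  have cb : ContinuousOn (fun x => S.z₂ x - prim S.c x) (Rect L) :=
    h.C1R_z₂.continuousOn.sub cP
  have ii : ∀ {f : ℝ → ℝ}, ContinuousOn f (Icc 0 1) → IntervalIntegrable f volume 0 1 :=
    fun hf => ContinuousOn.intervalIntegrable (by rwa [uIcc_of_le zero_le_one])
  have cφy : ContinuousOn (fun y => prim S.z₁ (L, y)) (Icc 0 1) := cφ.slice_fst hLm
  have i1 : IntervalIntegrable
      (fun y => -(S.q y * prim S.z₁ (L, y) * (S.z₂ (L, y) - prim S.c (L, y)))) volume 0 1 :=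
    ii (h.hq.mul cφy |>.mul (cb.slice_fst hLm)).neg
  have i0 : IntervalIntegrable (fun y => S.n₁ (L, y) * prim S.z₁ (L, y)) volume 0 1 :=
    ii ((h.hn₁.continuousOn.slice_fst hLm).mul cφy)
  have ik : IntervalIntegrable (fun y => S.k (L, y) ^ 2) volume 0 1 :=
    ii ((h.hk.continuousOn.slice_fst hLm).pow 2)
  have ia : IntervalIntegrable (fun y => S.a (L, y) ^ 2) volume 0 1 :=
    ii ((h.ha.continuousOn.slice_fst hLm).pow 2)
  have iP : IntervalIntegrable (fun y => prim S.c (L, y) ^ 2) volume 0 1 :=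
    ii ((cP.slice_fst hLm).pow 2)
  have iφ : IntervalIntegrable (fun y => prim S.z₁ (L, y) ^ 2) volume 0 1 := ii (cφy.pow 2)
  have ikaP := ((ik.add ia).add iP).const_mul (3 / (2 * η))
  have iφ' := iφ.const_mul (η / 2)
  have i2 := (iφ'.add ikaP).const_mul (2 * C ^ 2)
  have key := intervalIntegral.integral_mono_on zero_le_one
    i0 (i1.add i2) fun y hy => h.exit_pointwise_le hL hC hη hy
  rw [intervalIntegral.integral_add i1 i2, intervalIntegral.integral_const_mul,
    intervalIntegral.integral_add iφ' ikaP, intervalIntegral.integral_const_mul,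
    intervalIntegral.integral_const_mul, intervalIntegral.integral_add (ik.add ia) iP,
    intervalIntegral.integral_add ik ia] at key
  have hquad := h.exit_quadratic_le hL hC hε0 hε1
  have hk := h.exit_k_sq_le hL hε0 hC
  have ha := h.exit_a_sq_le hL hε0 hC
  have hP := h.exit_prim_c_sq_le hL hε0 hε1 hC
  have hφ := (integral_prim_exit_sq_le hL.le h.C1R_z₁.continuousOn).trans
    (mul_le_mul_of_nonneg_left (h.integral_z₁_sq_le hC) hL.le)
  have hE : 0 ≤ ∫ x in Rect L, S.e x := E_nonneg
  set E := ∫ x in Rect L, S.e x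
  have hs : 3 / (2 * η) * ((∫ y in (0:ℝ)..1, S.k (L, y) ^ 2) + (∫ y in (0:ℝ)..1, S.a (L, y) ^ 2) +
      ∫ y in (0:ℝ)..1, prim S.c (L, y) ^ 2) ≤ 3 / (2 * η) *
        ((20 * C ^ 2 + L * (15 * C ^ 2 + 60 * L * C ^ 4)) * ε * E) := by
    gcongr; linarith
  have hs2 : 3 / (2 * η) * ((20 * C ^ 2 + L * (15 * C ^ 2 + 60 * L * C ^ 4)) * ε * E) =
      3 / 2 * (20 * C ^ 2 + L * (15 * C ^ 2 + 60 * L * C ^ 4)) * η * E := by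
    rw [hε]; field_simp
  rw [hs2] at hs
  have hφ' := mul_le_mul_of_nonneg_left hφ (by positivity : (0:ℝ) ≤ η / 2)
  have t := mul_le_mul_of_nonneg_left (add_le_add hφ' hs) (by positivity : (0:ℝ) ≤ 2 * C ^ 2)
  have t2 : ε / 2 * ((3 * C ^ 2 + C * (2 * (L ^ 2 * (3 * C ^ 2) + 2 * (3 * C ^ 2) +
        2 * (L ^ 2 * (15 * C ^ 2 + 60 * L * C ^ 4))))) * E) ≤
      η / 2 * ((3 * C ^ 2 + C * (2 * (L ^ 2 * (3 * C ^ 2) + 2 * (3 * C ^ 2) +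
        2 * (L ^ 2 * (15 * C ^ 2 + 60 * L * C ^ 4))))) * E) := by
    gcongr; rw [hε]; nlinarith
  linarith

end DiffSystem

/-- the difference system has only the trivial solution when its coefficients are small -/
theorem DiffSystem.exists_small (L C l : ℝ) (hL : 0 < L) (hC : 1 ≤ C) (hl : 0 < l) (hl1 : l ≤ 1) :
    ∃ η₀ > 0, ∀ η, 0 < η → η ≤ η₀ → ∀ S : DiffFields, DiffSystem L C l (η ^ 2) S →
      ∀ x ∈ Rect L, S.e x = 0 := by
  set A := 3 * C ^ 2 * (5 / 2 + 3 / 2 * (20 * L * C ^ 2 + L ^ 2 * (15 * C ^ 2 + 60 * L * C ^ 4)))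
    with hA
  set B := 1 / 2 * (3 * C ^ 2 + C * (2 * (L ^ 2 * (3 * C ^ 2) + 2 * (3 * C ^ 2) +
        2 * (L ^ 2 * (15 * C ^ 2 + 60 * L * C ^ 4))))) + 2 * C ^ 2 * (1 / 2 * (L * (3 * C ^ 2)) +
        3 / 2 * (20 * C ^ 2 + L * (15 * C ^ 2 + 60 * L * C ^ 4))) with hB
  have hA0 : 0 < A := by positivity
  have hB0 : 0 < B := by positivity
  have hT : 0 < A + B + 20 * L * C ^ 2 := by positivity
  refine ⟨min 1 (l / 2 / (A + B + 20 * L * C ^ 2)), lt_min one_pos (by positivity),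
    fun η hη hη0 S h => ?_⟩
  have hη1 : η ≤ 1 := hη0.trans (min_le_left _ _)
  have hη2 : (A + B + 20 * L * C ^ 2) * η ≤ l / 2 := by
    have := hη0.trans (min_le_right _ _)
    rw [le_div_iff₀ hT] at this
    linarith
  have h1 := h.interior_le hL hC hη hη1 rfl
  have h2 := h.exit_le hL hC hη hη1 rfl
  rw [← hA] at h1
  rw [← hB] at h2
  have hk := h.integral_k_sq_le hL (by positivity) hC
  have ha := h.integral_a_sq_le hL (by positivity) hC
  have hE : 0 ≤ ∫ x in Rect L, S.e x := DiffSystem.E_nonneg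
  refine eqOn_zero_of_integral_Rect hL h.cont_e (fun x _ => S.e_nonneg x) ?_
  have cw : ContinuousOn (fun x => S.w₁ x ^ 2 + S.w₂ x ^ 2 + S.Ψ x ^ 2) (Rect L) :=
    ((h.hw₁.continuousOn.pow 2).add (h.hw₂.continuousOn.pow 2)).add (h.contΨ.pow 2)
  have ck : ContinuousOn (fun x => S.k x ^ 2) (Rect L) := h.hk.continuousOn.pow 2
  have ca : ContinuousOn (fun x => S.a x ^ 2) (Rect L) := h.ha.continuousOn.pow 2
  have cwk : ContinuousOn (fun x => S.w₁ x ^ 2 + S.w₂ x ^ 2 + S.Ψ x ^ 2 + S.k x ^ 2) (Rect L) :=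
    cw.add ck
  have split : ∫ x in Rect L, S.e x = (∫ x in Rect L, (S.w₁ x ^ 2 + S.w₂ x ^ 2 + S.Ψ x ^ 2)) +
      (∫ x in Rect L, S.k x ^ 2) + ∫ x in Rect L, S.a x ^ 2 := by
    rw [← integral_Rect_add cw ck, ← integral_Rect_add cwk ca]
    rfl
  set E := ∫ x in Rect L, S.e x
  have hη3 : η ^ 2 ≤ η := by nlinarith
  have hka : (∫ x in Rect L, S.k x ^ 2) + (∫ x in Rect L, S.a x ^ 2) ≤
      20 * L * C ^ 2 * η * E := by
    have : 20 * L * C ^ 2 * η ^ 2 * E ≤ 20 * L * C ^ 2 * η * E := by gcongr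
    linarith
  have hka0 : 0 ≤ (∫ x in Rect L, S.k x ^ 2) + (∫ x in Rect L, S.a x ^ 2) :=
    add_nonneg (integral_Rect_nonneg fun _ _ => sq_nonneg _)
      (integral_Rect_nonneg fun _ _ => sq_nonneg _)
  have hlka : l * ((∫ x in Rect L, S.k x ^ 2) + (∫ x in Rect L, S.a x ^ 2)) ≤
      20 * L * C ^ 2 * η * E := (mul_le_of_le_one_left hka0 hl1).trans hka
  have hfin : l * E ≤ (A + B + 20 * L * C ^ 2) * η * E := by
    have : l * E = l * (∫ x in Rect L, (S.w₁ x ^ 2 + S.w₂ x ^ 2 + S.Ψ x ^ 2)) +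
        l * ((∫ x in Rect L, S.k x ^ 2) + ∫ x in Rect L, S.a x ^ 2) := by rw [split]; ring
    linarith
  have := mul_le_mul_of_nonneg_right hη2 hE
  nlinarith

/-- density, velocity, enthalpy, normalized entropy, pseudo-Bernoulli function and potential -/
structure Fields where
  (ρ u v h s K Φ : Pt → ℝ)

namespace Fields

variable (F : Fields)

/-- first component of the field dual to the velocity -/
def U₁ (x : Pt) : ℝ := (F.u x)⁻¹ + F.v x ^ 2 * (F.u x)⁻¹ ^ 3

/-- second component of the field dual to the velocity -/
def U₂ (x : Pt) : ℝ := -(F.v x * (F.u x)⁻¹ ^ 2)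

/-- first component of the field whose product with the velocity is the enthalpy -/
def V₁ (x : Pt) : ℝ := F.h x * F.U₁ x + F.v x ^ 2 * (F.u x)⁻¹

/-- second component of the field whose product with the velocity is the enthalpy -/
def V₂ (x : Pt) : ℝ := F.h x * F.U₂ x - F.v x

end Fields

/-- a smooth subsonic Euler–Poisson flow in a nozzle, with quantitative bounds -/
structure IsFlow (γ L M ε : ℝ) (W : ℝ → ℝ) (F : Fields) : Prop where
  cρ : C1R L F.ρ
  cu : C1R L F.u
  cv : C1R L F.v
  ch : C1R L F.h
  cs : C1R L F.s
  cK : C1R L F.K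
  cΦ : ∀ x ∈ Rect L, ContDiffAt ℝ 2 F.Φ x
  h_eq : ∀ x, F.h x = F.K x + F.Φ x - (F.u x ^ 2 + F.v x ^ 2) / 2
  h_enth : ∀ x ∈ Rect L, F.h x = enth γ (F.s x) (F.ρ x)
  mass : ∀ x ∈ Noz L, pd1 (fun y => F.ρ y * F.u y) x + pd2 (fun y => F.ρ y * F.v y) x = 0
  trK : ∀ x ∈ Rect L, F.u x * pd1 F.K x + F.v x * pd2 F.K x = 0
  trs : ∀ x ∈ Rect L, F.u x * pd1 F.s x + F.v x * pd2 F.s x = 0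
  crocco : ∀ x ∈ Rect L, F.u x * (pd1 F.v x - pd2 F.u x) = F.h x * pd2 F.s x - pd2 F.K x
  v_w0 : ∀ t ∈ Icc 0 L, F.v (t, 0) = 0
  v_w1 : ∀ t ∈ Icc 0 L, F.v (t, 1) = 0
  v_in : ∀ y ∈ Icc (0:ℝ) 1, F.v (0, y) = 0
  ρ_mem : ∀ x ∈ Rect L, F.ρ x ∈ Icc M⁻¹ M
  u_mem : ∀ x ∈ Rect L, F.u x ∈ Icc M⁻¹ M
  h_le : ∀ x ∈ Rect L, |F.h x| ≤ M
  s_le : ∀ x ∈ Rect L, |F.s x| ≤ M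
  v_le : ∀ x ∈ Rect L, |F.v x| ≤ M * ε
  K₂_le : ∀ x ∈ Rect L, |pd2 F.K x| ≤ M * ε
  s₂_le : ∀ x ∈ Rect L, |pd2 F.s x| ≤ M * ε
  Φ₁_le : ∀ x ∈ Rect L, |pd1 F.Φ x| ≤ M
  Φ₂_le : ∀ x ∈ Rect L, |pd2 F.Φ x| ≤ M
  vu₁_le : ∀ x ∈ Rect L, |F.v x * pd1 F.u x| ≤ M
  vu₂_le : ∀ x ∈ Rect L, |F.v x * pd2 F.u x| ≤ M
  vv₁_le : ∀ x ∈ Rect L, |F.v x * pd1 F.v x| ≤ M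
  vv₂_le : ∀ x ∈ Rect L, |F.v x * pd2 F.v x| ≤ M
  ρ₂_exit : ∀ y ∈ Ioo (0:ℝ) 1, |pd2 F.ρ (L, y)| ≤ M * W y
  u₂_exit : ∀ y ∈ Ioo (0:ℝ) 1, |pd2 F.u (L, y)| ≤ M * W y
  v₂_exit : ∀ y ∈ Ioo (0:ℝ) 1, |pd2 F.v (L, y)| ≤ M * ε * W y

/-- two flows with the same boundary data, whose segment is uniformly subsonic -/
structure Matched (γ L lam : ℝ) (F F' : Fields) : Prop where
  K_in : ∀ y ∈ Icc (0:ℝ) 1, F.K (0, y) = F'.K (0, y)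
  s_in : ∀ y ∈ Icc (0:ℝ) 1, F.s (0, y) = F'.s (0, y)
  Φ_in : ∀ y ∈ Icc (0:ℝ) 1, F.Φ (0, y) = F'.Φ (0, y)
  Φ_ex : ∀ y ∈ Icc (0:ℝ) 1, F.Φ (L, y) = F'.Φ (L, y)
  p_ex : ∀ y ∈ Icc (0:ℝ) 1, exp (γ * F.s (L, y)) * F.ρ (L, y) ^ γ =
    exp (γ * F'.s (L, y)) * F'.ρ (L, y) ^ γ
  poisson : ∀ x ∈ Noz L, lap F.Φ x - lap F'.Φ x = F.ρ x - F'.ρ x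
  Φ_w0 : ∀ t ∈ Ioo 0 L, pd2 F.Φ (t, 0) = pd2 F'.Φ (t, 0)
  Φ_w1 : ∀ t ∈ Ioo 0 L, pd2 F.Φ (t, 1) = pd2 F'.Φ (t, 1)
  subsonic : ∀ x ∈ Rect L, ∀ ξ ∈ uIcc (F.ρ x) (F'.ρ x),
    lam ≤ hrho γ (F.s x) ξ * ((F.ρ x + F'.ρ x) / 2) -
      (((F.u x + F'.u x) / 2) ^ 2 + ((F.v x + F'.v x) / 2) ^ 2)

/-- the fields of the difference system of two flows -/
def diffFields (L : ℝ) (F F' : Fields) : DiffFields where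
  w₁ x := F.u x - F'.u x
  w₂ x := F.v x - F'.v x
  Ψ x := F.Φ x - F'.Φ x
  k x := F.K x - F'.K x
  a x := F.s x - F'.s x
  r x := F.ρ x - F'.ρ x
  m₁ x := F.ρ x * F.u x
  m₂ x := F.ρ x * F.v x
  n₁ x := F.ρ x * F.u x - F'.ρ x * F'.u x
  n₂ x := F.ρ x * F.v x - F'.ρ x * F'.v x
  U₁ := F'.U₁
  U₂ := F'.U₂
  V₁ := F'.V₁
  V₂ := F'.V₂
  c x := pd1 F.K x * (F.U₂ x - F'.U₂ x) - pd2 F.K x * (F.U₁ x - F'.U₁ x) -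
    (pd1 F.s x * (F.V₂ x - F'.V₂ x) - pd2 F.s x * (F.V₁ x - F'.V₁ x)) -
    (F.K x - F'.K x) * (pd1 F'.U₂ x - pd2 F'.U₁ x) +
    (F.s x - F'.s x) * (pd1 F'.V₂ x - pd2 F'.V₁ x)
  Gk x := -((F.ρ x * F.u x - F'.ρ x * F'.u x) * pd1 F'.K x +
    (F.ρ x * F.v x - F'.ρ x * F'.v x) * pd2 F'.K x)
  Ga x := -((F.ρ x * F.u x - F'.ρ x * F'.u x) * pd1 F'.s x +
    (F.ρ x * F.v x - F'.ρ x * F'.v x) * pd2 F'.s x)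
  q y := ((F.ρ (L, y) + F'.ρ (L, y)) / 2) * ((F.v (L, y) + F'.v (L, y)) / 2) *
    ((F.u (L, y) + F'.u (L, y)) / 2)⁻¹
  q' y := pd2 (fun x => ((F.ρ x + F'.ρ x) / 2) * ((F.v x + F'.v x) / 2) *
    ((F.u x + F'.u x) / 2)⁻¹) (L, y)

theorem abs_mul_le_mul {X Y A B : ℝ} (hX : |X| ≤ A) (hY : |Y| ≤ B) : |X * Y| ≤ A * B := by
  rw [abs_mul]; exact mul_le_mul hX hY (abs_nonneg _) ((abs_nonneg _).trans hX)

theorem abs_add_le_add {X Y A B : ℝ} (hX : |X| ≤ A) (hY : |Y| ≤ B) : |X + Y| ≤ A + B :=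
  (abs_add_le _ _).trans (add_le_add hX hY)

theorem abs_sub_le_add {X Y A B : ℝ} (hX : |X| ≤ A) (hY : |Y| ≤ B) : |X - Y| ≤ A + B :=
  (abs_sub _ _).trans (add_le_add hX hY)

theorem abs_neg_le {X A : ℝ} (hX : |X| ≤ A) : |-X| ≤ A := by rwa [abs_neg]

theorem abs_pow_le_pow {X A : ℝ} (hX : |X| ≤ A) (n : ℕ) : |X ^ n| ≤ A ^ n := by
  rw [abs_pow]; gcongr

theorem abs_inv_le_of_mem {u M : ℝ} (hM : 1 ≤ M) (hu : u ∈ Icc M⁻¹ M) : |u⁻¹| ≤ M := by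
  have h0 : 0 < M⁻¹ := by positivity
  rw [abs_inv, abs_of_pos (h0.trans_le hu.1)]
  exact inv_le_of_inv_le₀ (by linarith) hu.1

theorem pos_of_mem {u M : ℝ} (hM : 1 ≤ M) (hu : u ∈ Icc M⁻¹ M) : 0 < u :=
  (by positivity : 0 < M⁻¹).trans_le hu.1

theorem abs_le_of_mem {u M : ℝ} (hM : 1 ≤ M) (hu : u ∈ Icc M⁻¹ M) : |u| ≤ M := by
  rw [abs_of_pos (pos_of_mem hM hu)]; exact hu.2

/-- two quantities bounded by `B` and whose difference is at most `B * D` -/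
def PairBd (B D X X' : ℝ) : Prop := |X| ≤ B ∧ |X'| ≤ B ∧ |X - X'| ≤ B * D

namespace PairBd

variable {B B' D X X' Y Y' : ℝ}

theorem add (h : PairBd B D X X') (h' : PairBd B' D Y Y') :
    PairBd (B + B') D (X + Y) (X' + Y') := by
  refine ⟨abs_add_le_add h.1 h'.1, abs_add_le_add h.2.1 h'.2.1, ?_⟩
  have : X + Y - (X' + Y') = (X - X') + (Y - Y') := by ring
  rw [this, add_mul]
  exact abs_add_le_add h.2.2 h'.2.2

theorem neg (h : PairBd B D X X') : PairBd B D (-X) (-X') := by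
  refine ⟨abs_neg_le h.1, abs_neg_le h.2.1, ?_⟩
  have : -X - -X' = -(X - X') := by ring
  rw [this]
  exact abs_neg_le h.2.2

theorem sub (h : PairBd B D X X') (h' : PairBd B' D Y Y') :
    PairBd (B + B') D (X - Y) (X' - Y') := by
  simpa [sub_eq_add_neg] using h.add h'.neg

theorem mul (h : PairBd B D X X') (h' : PairBd B' D Y Y') :
    PairBd (2 * (B * B')) D (X * Y) (X' * Y') := by
  have hB : 0 ≤ B * B' := mul_nonneg ((abs_nonneg _).trans h.1) ((abs_nonneg _).trans h'.1)
  have h1 := abs_mul_le_mul h.1 h'.1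
  have h2 := abs_mul_le_mul h.2.1 h'.2.1
  refine ⟨by linarith, by linarith, ?_⟩
  have : X * Y - X' * Y' = X * (Y - Y') + (X - X') * Y' := by ring
  rw [this]
  refine (abs_add_le_add (abs_mul_le_mul h.1 h'.2.2) (abs_mul_le_mul h.2.2 h'.2.1)).trans ?_
  linarith

theorem inv {M : ℝ} (hM : 1 ≤ M) (hX : X ∈ Icc M⁻¹ M) (hX' : X' ∈ Icc M⁻¹ M)
    (h : |X - X'| ≤ D) : PairBd (M ^ 2) D X⁻¹ X'⁻¹ := by
  have hMM : M ≤ M ^ 2 := by nlinarith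
  have g := abs_inv_le_of_mem hM hX
  have g' := abs_inv_le_of_mem hM hX'
  refine ⟨g.trans hMM, g'.trans hMM, ?_⟩
  have e : X⁻¹ - X'⁻¹ = X⁻¹ * X'⁻¹ * -(X - X') := by
    have := (pos_of_mem hM hX).ne'
    have := (pos_of_mem hM hX').ne'
    field_simp
    ring
  rw [e]
  refine (abs_mul_le_mul (abs_mul_le_mul g g') (abs_neg_le h)).trans ?_
  rw [sq]

end PairBd

namespace IsFlow

variable {γ L M ε : ℝ} {W : ℝ → ℝ} {F F' : Fields}

theorem u_ne (hF : IsFlow γ L M ε W F) (hM : 1 ≤ M) {x : Pt} (hx : x ∈ Rect L) : F.u x ≠ 0 :=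
  (pos_of_mem hM (hF.u_mem x hx)).ne'

theorem v_le' (hF : IsFlow γ L M ε W F) (hM : 1 ≤ M) (hε : ε ≤ 1) {x : Pt} (hx : x ∈ Rect L) :
    |F.v x| ≤ M := (hF.v_le x hx).trans (mul_le_of_le_one_right (by linarith) hε)

theorem cg (hF : IsFlow γ L M ε W F) (hM : 1 ≤ M) : C1R L (fun x => (F.u x)⁻¹) :=
  hF.cu.inv fun _ hx => hF.u_ne hM hx

theorem cU₁ (hF : IsFlow γ L M ε W F) (hM : 1 ≤ M) : C1R L F.U₁ :=
  (hF.cg hM).add ((hF.cv.pow 2).mul ((hF.cg hM).pow 3))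

theorem cU₂ (hF : IsFlow γ L M ε W F) (hM : 1 ≤ M) : C1R L F.U₂ :=
  (hF.cv.mul ((hF.cg hM).pow 2)).neg

theorem cV₁ (hF : IsFlow γ L M ε W F) (hM : 1 ≤ M) : C1R L F.V₁ :=
  (hF.ch.mul (hF.cU₁ hM)).add ((hF.cv.pow 2).mul (hF.cg hM))

theorem cV₂ (hF : IsFlow γ L M ε W F) (hM : 1 ≤ M) : C1R L F.V₂ :=
  (hF.ch.mul (hF.cU₂ hM)).sub hF.cv

theorem pd1_h (hF : IsFlow γ L M ε W F) {x : Pt} (hx : x ∈ Rect L) :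
    pd1 F.h x = pd1 F.K x + pd1 F.Φ x - (F.u x * pd1 F.u x + F.v x * pd1 F.v x) := by
  have dΦ := (hF.cΦ x hx).differentiableAt (by norm_num)
  have dK := hF.cK.differentiableAt hx
  have du := hF.cu.differentiableAt hx
  have dv := hF.cv.differentiableAt hx
  have e : F.h = fun x => F.K x + F.Φ x - (F.u x ^ 2 + F.v x ^ 2) * 2⁻¹ := by
    funext x; rw [hF.h_eq x]; ring
  have dKΦ : DifferentiableAt ℝ (fun y => F.K y + F.Φ y) x := dK.add dΦ
  have du2 : DifferentiableAt ℝ (fun y => F.u y ^ 2) x := du.pow 2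
  have dv2 : DifferentiableAt ℝ (fun y => F.v y ^ 2) x := dv.pow 2
  have duv : DifferentiableAt ℝ (fun y => F.u y ^ 2 + F.v y ^ 2) x := du2.add dv2
  have dq : DifferentiableAt ℝ (fun y => (F.u y ^ 2 + F.v y ^ 2) * 2⁻¹) x := duv.mul_const _
  rw [e, pd1_sub dKΦ dq, pd1_add dK dΦ, pd1_mul duv (differentiableAt_const _),
    pd1_add du2 dv2, pd1_pow du, pd1_pow dv]
  have : pd1 (fun _ : Pt => (2:ℝ)⁻¹) x = 0 := by simp [pd1]
  rw [this]
  push_cast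
  ring

theorem pd2_h (hF : IsFlow γ L M ε W F) {x : Pt} (hx : x ∈ Rect L) :
    pd2 F.h x = pd2 F.K x + pd2 F.Φ x - (F.u x * pd2 F.u x + F.v x * pd2 F.v x) := by
  have dΦ := (hF.cΦ x hx).differentiableAt (by norm_num)
  have dK := hF.cK.differentiableAt hx
  have du := hF.cu.differentiableAt hx
  have dv := hF.cv.differentiableAt hx
  have e : F.h = fun x => F.K x + F.Φ x - (F.u x ^ 2 + F.v x ^ 2) * 2⁻¹ := by
    funext x; rw [hF.h_eq x]; ring
  have dKΦ : DifferentiableAt ℝ (fun y => F.K y + F.Φ y) x := dK.add dΦ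
  have du2 : DifferentiableAt ℝ (fun y => F.u y ^ 2) x := du.pow 2
  have dv2 : DifferentiableAt ℝ (fun y => F.v y ^ 2) x := dv.pow 2
  have duv : DifferentiableAt ℝ (fun y => F.u y ^ 2 + F.v y ^ 2) x := du2.add dv2
  have dq : DifferentiableAt ℝ (fun y => (F.u y ^ 2 + F.v y ^ 2) * 2⁻¹) x := duv.mul_const _
  rw [e, pd2_sub dKΦ dq, pd2_add dK dΦ, pd2_mul duv (differentiableAt_const _),
    pd2_add du2 dv2, pd2_pow du, pd2_pow dv]
  have : pd2 (fun _ : Pt => (2:ℝ)⁻¹) x = 0 := by simp [pd2]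
  rw [this]
  push_cast
  ring

theorem curl_U (hF : IsFlow γ L M ε W F) (hM : 1 ≤ M) {x : Pt} (hx : x ∈ Rect L) :
    pd1 F.U₂ x - pd2 F.U₁ x = -((F.u x)⁻¹ ^ 2 * (pd1 F.v x - pd2 F.u x)) +
      2 * ((F.u x)⁻¹ ^ 3 * (F.v x * pd1 F.u x)) - 2 * ((F.u x)⁻¹ ^ 3 * (F.v x * pd2 F.v x)) +
      3 * ((F.u x)⁻¹ ^ 4 * F.v x * (F.v x * pd2 F.u x)) := by
  have hu := hF.u_ne hM hx
  have du := hF.cu.differentiableAt hx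
  have dv := hF.cv.differentiableAt hx
  have dg := (hF.cg hM).differentiableAt hx
  have e1 : pd1 F.U₂ x = pd1 (fun x => -(F.v x * (F.u x)⁻¹ ^ 2)) x := rfl
  have e2 : pd2 F.U₁ x = pd2 (fun x => (F.u x)⁻¹ + F.v x ^ 2 * (F.u x)⁻¹ ^ 3) x := rfl
  have dg2 : DifferentiableAt ℝ (fun y => (F.u y)⁻¹ ^ 2) x := dg.pow 2
  have dg3 : DifferentiableAt ℝ (fun y => (F.u y)⁻¹ ^ 3) x := dg.pow 3
  have dv2 : DifferentiableAt ℝ (fun y => F.v y ^ 2) x := dv.pow 2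
  have dvg : DifferentiableAt ℝ (fun y => F.v y ^ 2 * (F.u y)⁻¹ ^ 3) x := dv2.mul dg3
  rw [e1, e2, pd1_neg, pd1_mul dv dg2, pd1_pow dg, pd1_inv du hu,
    pd2_add dg dvg, pd2_mul dv2 dg3, pd2_pow dg, pd2_pow dv,
    pd2_inv du hu]
  push_cast
  ring

theorem curl_V (hF : IsFlow γ L M ε W F) (hM : 1 ≤ M) {x : Pt} (hx : x ∈ Rect L) :
    pd1 F.V₂ x - pd2 F.V₁ x = F.h x * (pd1 F.U₂ x - pd2 F.U₁ x) -
      (F.u x)⁻¹ ^ 2 * (F.v x * (pd1 F.K x + pd1 F.Φ x) - F.u x * (F.v x * pd1 F.u x) -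
        F.v x * (F.v x * pd1 F.v x)) - (pd2 F.K x + pd2 F.Φ x) * F.U₁ x -
      (pd1 F.v x - pd2 F.u x) + 2 * (F.v x * (F.u x)⁻¹ ^ 2 * (F.v x * pd2 F.u x)) +
      (F.v x * pd2 F.v x) * F.U₁ x - 2 * ((F.u x)⁻¹ * (F.v x * pd2 F.v x)) := by
  have hu := hF.u_ne hM hx
  have du := hF.cu.differentiableAt hx
  have dv := hF.cv.differentiableAt hx
  have dh := hF.ch.differentiableAt hx
  have dg := (hF.cg hM).differentiableAt hx
  have dU₁ := (hF.cU₁ hM).differentiableAt hx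
  have dU₂ := (hF.cU₂ hM).differentiableAt hx
  have e1 : pd1 F.V₂ x = pd1 (fun x => F.h x * F.U₂ x - F.v x) x := rfl
  have e2 : pd2 F.V₁ x = pd2 (fun x => F.h x * F.U₁ x + F.v x ^ 2 * (F.u x)⁻¹) x := rfl
  have dv2 : DifferentiableAt ℝ (fun y => F.v y ^ 2) x := dv.pow 2
  have dvg : DifferentiableAt ℝ (fun y => F.v y ^ 2 * (F.u y)⁻¹) x := dv2.mul dg
  have dhU₁ : DifferentiableAt ℝ (fun y => F.h y * F.U₁ y) x := dh.mul dU₁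
  have dhU₂ : DifferentiableAt ℝ (fun y => F.h y * F.U₂ y) x := dh.mul dU₂
  rw [e1, e2, pd1_sub dhU₂ dv, pd1_mul dh dU₂,
    pd2_add dhU₁ dvg, pd2_mul dh dU₁, pd2_mul dv2 dg, pd2_pow dv,
    pd2_inv du hu, hF.pd1_h hx, hF.pd2_h hx]
  have hU1 : F.u x * F.U₁ x = 1 + F.v x ^ 2 * (F.u x)⁻¹ ^ 2 := by
    simp only [Fields.U₁]; field_simp
  have hU1' : F.u x * pd2 F.u x * F.U₁ x = pd2 F.u x * (1 + F.v x ^ 2 * (F.u x)⁻¹ ^ 2) := by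
    rw [← hU1]; ring
  have hU2 : F.U₂ x = -(F.v x * (F.u x)⁻¹ ^ 2) := rfl
  rw [hU2]
  push_cast
  linear_combination hU1'

theorem vorticity_eq (hF : IsFlow γ L M ε W F) (hM : 1 ≤ M) {x : Pt} (hx : x ∈ Rect L) :
    pd1 F.v x - pd2 F.u x = pd1 F.K x * F.U₂ x - pd2 F.K x * F.U₁ x -
      (pd1 F.s x * F.V₂ x - pd2 F.s x * F.V₁ x) := by
  have hu := hF.u_ne hM hx
  have hK := hF.trK x hx
  have hs := hF.trs x hx
  have hc := hF.crocco x hx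
  have hK' : pd1 F.K x = -(F.v x * pd2 F.K x) * (F.u x)⁻¹ := by
    field_simp; linarith
  have hs' : pd1 F.s x = -(F.v x * pd2 F.s x) * (F.u x)⁻¹ := by
    field_simp; linarith
  have hc' : pd1 F.v x - pd2 F.u x = (F.h x * pd2 F.s x - pd2 F.K x) * (F.u x)⁻¹ := by
    field_simp; linarith
  rw [hc', hK', hs']
  simp only [Fields.V₁, Fields.V₂, Fields.U₁, Fields.U₂]
  field_simp
  ring

end IsFlow

theorem C1R.half_add {L : ℝ} {f g : Pt → ℝ} (hf : C1R L f) (hg : C1R L g) :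
    C1R L (fun x => (f x + g x) / 2) := by
  simpa only [div_eq_mul_inv] using (hf.add hg).mul (C1R.const 2⁻¹)

theorem pd2_half_add {f g : Pt → ℝ} {x : Pt} (hf : DifferentiableAt ℝ f x)
    (hg : DifferentiableAt ℝ g x) :
    pd2 (fun y => (f y + g y) / 2) x = (pd2 f x + pd2 g x) / 2 := by
  have d : DifferentiableAt ℝ (fun y => f y + g y) x := hf.add hg
  have e : (fun y => (f y + g y) / 2) = fun y => (f y + g y) * 2⁻¹ := by
    funext y; rw [div_eq_mul_inv]
  have z : pd2 (fun _ : Pt => (2:ℝ)⁻¹) x = 0 := by simp [pd2]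
  rw [e, pd2_mul d (differentiableAt_const _), pd2_add hf hg, z]
  ring

theorem half_add_mem {a b c d : ℝ} (ha : a ∈ Icc c d) (hb : b ∈ Icc c d) :
    (a + b) / 2 ∈ Icc c d := ⟨by linarith [ha.1, hb.1], by linarith [ha.2, hb.2]⟩

theorem abs_half_add_le {a b A : ℝ} (ha : |a| ≤ A) (hb : |b| ≤ A) : |(a + b) / 2| ≤ A := by
  rw [abs_le] at *; constructor <;> linarith [ha.1, hb.1, ha.2, hb.2]

theorem PairBd.mono {B B' D X X' : ℝ} (h : PairBd B D X X') (hB : B ≤ B') (hD : 0 ≤ D) :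
    PairBd B' D X X' :=
  ⟨h.1.trans hB, h.2.1.trans hB, h.2.2.trans (mul_le_mul_of_nonneg_right hB hD)⟩

theorem exists_pairBd_dual (M : ℝ) : ∃ B ≥ 1, ∀ D u u' v v' h h' : ℝ, 0 ≤ D →
    PairBd M D u⁻¹ u'⁻¹ → PairBd M D v v' → PairBd M D h h' →
    PairBd B D (u⁻¹ + v ^ 2 * u⁻¹ ^ 3) (u'⁻¹ + v' ^ 2 * u'⁻¹ ^ 3) ∧
    PairBd B D (-(v * u⁻¹ ^ 2)) (-(v' * u'⁻¹ ^ 2)) ∧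
    PairBd B D (h * (u⁻¹ + v ^ 2 * u⁻¹ ^ 3) + v ^ 2 * u⁻¹)
      (h' * (u'⁻¹ + v' ^ 2 * u'⁻¹ ^ 3) + v' ^ 2 * u'⁻¹) ∧
    PairBd B D (h * (-(v * u⁻¹ ^ 2)) - v) (h' * (-(v' * u'⁻¹ ^ 2)) - v') := by
  set N₁ := M + 2 * (2 * (M * M) * (2 * (2 * (M * M) * M)))
  set N₂ := 2 * (M * (2 * (M * M)))
  set N₃ := 2 * (M * N₁) + 2 * (2 * (M * M) * M)
  set N₄ := 2 * (M * N₂) + M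
  refine ⟨max 1 (max N₁ (max N₂ (max N₃ N₄))), le_max_left _ _,
    fun D u u' v v' h h' hD hg hv hh => ?_⟩
  have g2 : PairBd (2 * (M * M)) D (u⁻¹ ^ 2) (u'⁻¹ ^ 2) := by simpa only [sq] using hg.mul hg
  have v2 : PairBd (2 * (M * M)) D (v ^ 2) (v' ^ 2) := by simpa only [sq] using hv.mul hv
  have g3 : PairBd (2 * (2 * (M * M) * M)) D (u⁻¹ ^ 3) (u'⁻¹ ^ 3) := by
    simpa only [pow_succ _ 2] using g2.mul hg
  have hU₁ : PairBd N₁ D (u⁻¹ + v ^ 2 * u⁻¹ ^ 3) (u'⁻¹ + v' ^ 2 * u'⁻¹ ^ 3) := hg.add (v2.mul g3)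
  have hU₂ : PairBd N₂ D (-(v * u⁻¹ ^ 2)) (-(v' * u'⁻¹ ^ 2)) := (hv.mul g2).neg
  exact ⟨hU₁.mono (by simp) hD, hU₂.mono (by simp) hD,
    PairBd.mono (B := N₃) ((hh.mul hU₁).add (v2.mul hg)) (by simp) hD,
    PairBd.mono (B := N₄) ((hh.mul hU₂).sub hv) (by simp) hD⟩

theorem exists_slope {γ M : ℝ} (hγ : 1 < γ) (hM : 1 ≤ M) :
    ∃ c > 0, ∃ C₂ > 0, ∃ C > 0, ∀ L ε W lam F F', IsFlow γ L M ε W F → IsFlow γ L M ε W F' →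
      Matched γ L lam F F' → ∀ x ∈ Rect L, ∃ H, c ≤ H ∧ H ≤ C₂ ∧
      |F.h x - F'.h x - H * (F.ρ x - F'.ρ x)| ≤ C * |F.s x - F'.s x| ∧
      lam ≤ H * ((F.ρ x + F'.ρ x) / 2) -
        (((F.u x + F'.u x) / 2) ^ 2 + ((F.v x + F'.v x) / 2) ^ 2) := by
  obtain ⟨c, hc, C₂, hC₂, hH⟩ := hrho_bounds hγ hM
  obtain ⟨C, hC, hE⟩ := enth_sub_enth (M := M) hγ
  refine ⟨c, hc, C₂, hC₂, C, hC, fun L ε W lam F F' hF hF' hm x hx => ?_⟩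
  have e := hF.h_enth x hx
  have e' := hF'.h_enth x hx
  obtain ⟨ξ, hξ, hb⟩ := hE (F.s x) (F'.s x) (F.ρ x) (F'.ρ x) (hF.s_le x hx) (hF'.s_le x hx)
    (pos_of_mem hM (hF.ρ_mem x hx)) (pos_of_mem hM (hF'.ρ_mem x hx))
    (by rw [← e']; exact (le_abs_self _).trans (hF'.h_le x hx))
  have hξ' := uIcc_subset_Icc' (hF.ρ_mem x hx) (hF'.ρ_mem x hx) hξ
  obtain ⟨h1, h2⟩ := hH _ _ (hF.s_le x hx) hξ'
  exact ⟨_, h1, h2, by rw [e, e']; exact hb, hm.subsonic x hx ξ hξ⟩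

theorem DiffFields.abs_w₁_le (S : DiffFields) (x : Pt) : |S.w₁ x| ≤ S.D x := by
  unfold D; linarith [abs_nonneg (S.w₂ x), abs_nonneg (S.Ψ x), abs_nonneg (S.k x),
    abs_nonneg (S.a x)]

namespace IsFlow

variable {γ L M ε : ℝ} {W : ℝ → ℝ} {F F' : Fields}

theorem delta_h (hF : IsFlow γ L M ε W F) (hF' : IsFlow γ L M ε W F') (x : Pt) :
    F.h x - F'.h x = (F.K x - F'.K x) + (F.Φ x - F'.Φ x) -
      (F.u x + F'.u x) / 2 * (F.u x - F'.u x) - (F.v x + F'.v x) / 2 * (F.v x - F'.v x) := by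
  rw [hF.h_eq, hF'.h_eq]; ring

theorem abs_um_le (hF : IsFlow γ L M ε W F) (hF' : IsFlow γ L M ε W F') (hM : 1 ≤ M) {x : Pt}
    (hx : x ∈ Rect L) : |(F.u x + F'.u x) / 2| ≤ M :=
  abs_le_of_mem hM (half_add_mem (hF.u_mem x hx) (hF'.u_mem x hx))

theorem abs_ρm_le (hF : IsFlow γ L M ε W F) (hF' : IsFlow γ L M ε W F') (hM : 1 ≤ M) {x : Pt}
    (hx : x ∈ Rect L) : |(F.ρ x + F'.ρ x) / 2| ≤ M :=
  abs_le_of_mem hM (half_add_mem (hF.ρ_mem x hx) (hF'.ρ_mem x hx))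

theorem abs_vm_le (hF : IsFlow γ L M ε W F) (hF' : IsFlow γ L M ε W F') (hM : 1 ≤ M) (hε : ε ≤ 1)
    {x : Pt} (hx : x ∈ Rect L) : |(F.v x + F'.v x) / 2| ≤ M :=
  abs_half_add_le (hF.v_le' hM hε hx) (hF'.v_le' hM hε hx)

theorem pair_v (hF : IsFlow γ L M ε W F) (hF' : IsFlow γ L M ε W F') (hM : 1 ≤ M) (hε : ε ≤ 1)
    {x : Pt} (hx : x ∈ Rect L) : PairBd M ((diffFields L F F').D x) (F.v x) (F'.v x) := by
  refine ⟨hF.v_le' hM hε hx, hF'.v_le' hM hε hx, ?_⟩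
  refine le_trans ?_ (le_mul_of_one_le_left ((diffFields L F F').D_nonneg x) hM)
  simp only [DiffFields.D, diffFields]
  linarith [abs_nonneg (F.u x - F'.u x), abs_nonneg (F.Φ x - F'.Φ x), abs_nonneg (F.K x - F'.K x),
    abs_nonneg (F.s x - F'.s x)]

theorem pair_h (hF : IsFlow γ L M ε W F) (hF' : IsFlow γ L M ε W F') (hM : 1 ≤ M) (hε : ε ≤ 1)
    {x : Pt} (hx : x ∈ Rect L) : PairBd M ((diffFields L F F').D x) (F.h x) (F'.h x) := by
  refine ⟨hF.h_le x hx, hF'.h_le x hx, ?_⟩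
  rw [hF.delta_h hF' x]
  have h1 := abs_mul_le_mul (hF.abs_um_le hF' hM hx) (le_refl |F.u x - F'.u x|)
  have h2 := abs_mul_le_mul (hF.abs_vm_le hF' hM hε hx) (le_refl |F.v x - F'.v x|)
  have h3 := abs_sub_le_add (abs_sub_le_add (abs_add_le (F.K x - F'.K x) (F.Φ x - F'.Φ x)) h1) h2
  refine h3.trans ?_
  simp only [DiffFields.D, diffFields]
  nlinarith [abs_nonneg (F.s x - F'.s x), abs_nonneg (F.Φ x - F'.Φ x), abs_nonneg (F.K x - F'.K x)]

theorem pd1_K_le (hF : IsFlow γ L M ε W F) (hM : 1 ≤ M) (hε : ε ≤ 1) {x : Pt} (hx : x ∈ Rect L) :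
    |pd1 F.K x| ≤ M ^ 3 * ε := by
  have hu := hF.u_ne hM hx
  have h : pd1 F.K x = -(F.v x * pd2 F.K x * (F.u x)⁻¹) := by
    have := hF.trK x hx
    field_simp; linarith
  rw [h]
  refine (abs_neg_le (abs_mul_le_mul (abs_mul_le_mul (hF.v_le' hM hε hx) (hF.K₂_le x hx))
    (abs_inv_le_of_mem hM (hF.u_mem x hx)))).trans (le_of_eq (by ring))

theorem pd1_s_le (hF : IsFlow γ L M ε W F) (hM : 1 ≤ M) (hε : ε ≤ 1) {x : Pt} (hx : x ∈ Rect L) :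
    |pd1 F.s x| ≤ M ^ 3 * ε := by
  have hu := hF.u_ne hM hx
  have h : pd1 F.s x = -(F.v x * pd2 F.s x * (F.u x)⁻¹) := by
    have := hF.trs x hx
    field_simp; linarith
  rw [h]
  refine (abs_neg_le (abs_mul_le_mul (abs_mul_le_mul (hF.v_le' hM hε hx) (hF.s₂_le x hx))
    (abs_inv_le_of_mem hM (hF.u_mem x hx)))).trans (le_of_eq (by ring))

theorem vorticity_le (hF : IsFlow γ L M ε W F) (hM : 1 ≤ M) (hε : ε ≤ 1) {x : Pt}
    (hx : x ∈ Rect L) : |pd1 F.v x - pd2 F.u x| ≤ (M * M + M) * M := by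
  have hu := hF.u_ne hM hx
  have hc' : pd1 F.v x - pd2 F.u x = (F.h x * pd2 F.s x - pd2 F.K x) * (F.u x)⁻¹ := by
    have hc := hF.crocco x hx
    field_simp; linarith
  have hMε : M * ε ≤ M := mul_le_of_le_one_right (by linarith) hε
  rw [hc']
  exact abs_mul_le_mul (abs_sub_le_add (abs_mul_le_mul (hF.h_le x hx)
    ((hF.s₂_le x hx).trans hMε)) ((hF.K₂_le x hx).trans hMε)) (abs_inv_le_of_mem hM (hF.u_mem x hx))

end IsFlow

theorem exists_curl_dual_le {M : ℝ} (hM : 1 ≤ M) : ∃ C > 0, ∀ γ L ε W F, ε ≤ 1 →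
    IsFlow γ L M ε W F → ∀ x ∈ Rect L,
    |pd1 F.U₂ x - pd2 F.U₁ x| ≤ C ∧ |pd1 F.V₂ x - pd2 F.V₁ x| ≤ C := by
  set A := M ^ 2 * ((M * M + M) * M) + 2 * (M ^ 3 * M) + 2 * (M ^ 3 * M) + 3 * (M ^ 4 * M * M)
  set B := M * A + M ^ 2 * (M * (M ^ 3 + M) + M * M + M * M) + (M + M) * (M + M ^ 2 * M ^ 3) +
    (M * M + M) * M + 2 * (M * M ^ 2 * M) + M * (M + M ^ 2 * M ^ 3) + 2 * (M * M)
  have hM0 : 0 < M := by linarith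
  refine ⟨max A B, lt_max_of_lt_left (by positivity), fun γ L ε W F hε hF x hx => ?_⟩
  have hg := abs_inv_le_of_mem hM (hF.u_mem x hx)
  have hω := hF.vorticity_le hM hε hx
  have hv := hF.v_le' hM hε hx
  have hu := abs_le_of_mem hM (hF.u_mem x hx)
  have hMε : M * ε ≤ M := mul_le_of_le_one_right hM0.le hε
  have hK₂ := (hF.K₂_le x hx).trans hMε
  have hK₁ : |pd1 F.K x| ≤ M ^ 3 :=
    (hF.pd1_K_le hM hε hx).trans (mul_le_of_le_one_right (by positivity) hε)
  have h2 : |(2:ℝ)| ≤ 2 := by norm_num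
  have h3 : |(3:ℝ)| ≤ 3 := by norm_num
  have hA : |pd1 F.U₂ x - pd2 F.U₁ x| ≤ A := by
    rw [hF.curl_U hM hx]
    exact abs_add_le_add (abs_sub_le_add (abs_add_le_add
      (abs_neg_le (abs_mul_le_mul (abs_pow_le_pow hg 2) hω))
      (abs_mul_le_mul h2 (abs_mul_le_mul (abs_pow_le_pow hg 3) (hF.vu₁_le x hx))))
      (abs_mul_le_mul h2 (abs_mul_le_mul (abs_pow_le_pow hg 3) (hF.vv₂_le x hx))))
      (abs_mul_le_mul h3 (abs_mul_le_mul (abs_mul_le_mul (abs_pow_le_pow hg 4) hv)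
        (hF.vu₂_le x hx)))
  have hU₁ : |F.U₁ x| ≤ M + M ^ 2 * M ^ 3 :=
    abs_add_le_add hg (abs_mul_le_mul (abs_pow_le_pow hv 2) (abs_pow_le_pow hg 3))
  refine ⟨hA.trans (le_max_left _ _), le_trans ?_ (le_max_right _ _)⟩
  rw [hF.curl_V hM hx]
  refine abs_sub_le_add (abs_add_le_add (abs_add_le_add (abs_sub_le_add (abs_sub_le_add
    (abs_sub_le_add (abs_mul_le_mul (hF.h_le x hx) hA) (abs_mul_le_mul (abs_pow_le_pow hg 2)
      (abs_sub_le_add (abs_sub_le_add (abs_mul_le_mul hv (abs_add_le_add hK₁ (hF.Φ₁_le x hx)))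
        (abs_mul_le_mul hu (hF.vu₁_le x hx))) (abs_mul_le_mul hv (hF.vv₁_le x hx)))))
    (abs_mul_le_mul (abs_add_le_add hK₂ (hF.Φ₂_le x hx)) hU₁)) hω)
    (abs_mul_le_mul h2 (abs_mul_le_mul (abs_mul_le_mul hv (abs_pow_le_pow hg 2)) (hF.vu₂_le x hx))))
    (abs_mul_le_mul (hF.vv₂_le x hx) hU₁))
    (abs_mul_le_mul h2 (abs_mul_le_mul hg (hF.vv₂_le x hx)))

namespace IsFlow

variable {γ L M ε lam : ℝ} {W : ℝ → ℝ} {F F' : Fields}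

theorem n₁_eq (x : Pt) : F.ρ x * F.u x - F'.ρ x * F'.u x =
    (F.ρ x + F'.ρ x) / 2 * (F.u x - F'.u x) + (F.u x + F'.u x) / 2 * (F.ρ x - F'.ρ x) := by ring

theorem n₂_eq (x : Pt) : F.ρ x * F.v x - F'.ρ x * F'.v x =
    (F.ρ x + F'.ρ x) / 2 * (F.v x - F'.v x) + (F.v x + F'.v x) / 2 * (F.ρ x - F'.ρ x) := by ring

theorem cQ (hF : IsFlow γ L M ε W F) (hF' : IsFlow γ L M ε W F') (hM : 1 ≤ M) :
    C1R L (fun x => (F.ρ x + F'.ρ x) / 2 * ((F.v x + F'.v x) / 2) *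
      ((F.u x + F'.u x) / 2)⁻¹) :=
  ((hF.cρ.half_add hF'.cρ).mul (hF.cv.half_add hF'.cv)).mul ((hF.cu.half_add hF'.cu).inv
    fun _ hx => (pos_of_mem hM (half_add_mem (hF.u_mem _ hx) (hF'.u_mem _ hx))).ne')

theorem q'_abs_le (hL : 0 < L) (hF : IsFlow γ L M ε W F) (hF' : IsFlow γ L M ε W F') (hM : 1 ≤ M)
    (hε0 : 0 < ε) (y : ℝ) (hy : y ∈ Ioo (0:ℝ) 1) :
    |(diffFields L F F').q' y| ≤ 3 * M ^ 5 * ε * W y := by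
  have hx : ((L, y) : Pt) ∈ Rect L := mem_Rect ⟨hL.le, le_rfl⟩ ⟨hy.1.le, hy.2.le⟩
  have hum := half_add_mem (hF.u_mem _ hx) (hF'.u_mem _ hx)
  have dρ := (hF.cρ.half_add hF'.cρ).differentiableAt hx
  have dv := (hF.cv.half_add hF'.cv).differentiableAt hx
  have du := (hF.cu.half_add hF'.cu).differentiableAt hx
  have dg := ((hF.cu.half_add hF'.cu).inv
    fun _ hx => (pos_of_mem hM (half_add_mem (hF.u_mem _ hx) (hF'.u_mem _ hx))).ne').differentiableAt
      hx
  have dρv := ((hF.cρ.half_add hF'.cρ).mul (hF.cv.half_add hF'.cv)).differentiableAt hx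
  have hg := abs_inv_le_of_mem hM hum
  have hρ := hF.abs_ρm_le hF' hM hx
  have hv := abs_half_add_le (hF.v_le _ hx) (hF'.v_le _ hx)
  have hM0 : 0 < M := by linarith
  have hW : 0 ≤ W y := by
    have := (abs_nonneg _).trans (hF.u₂_exit y hy)
    exact nonneg_of_mul_nonneg_right this hM0
  have hρ₂ := abs_half_add_le (hF.ρ₂_exit y hy) (hF'.ρ₂_exit y hy)
  have hu₂ := abs_half_add_le (hF.u₂_exit y hy) (hF'.u₂_exit y hy)
  have hv₂ := abs_half_add_le (hF.v₂_exit y hy) (hF'.v₂_exit y hy)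
  simp only [diffFields]
  rw [pd2_mul dρv dg, pd2_mul dρ dv, pd2_inv du (pos_of_mem hM hum).ne',
    pd2_half_add (hF.cρ.differentiableAt hx) (hF'.cρ.differentiableAt hx),
    pd2_half_add (hF.cu.differentiableAt hx) (hF'.cu.differentiableAt hx),
    pd2_half_add (hF.cv.differentiableAt hx) (hF'.cv.differentiableAt hx)]
  have h1 := abs_mul_le_mul (abs_mul_le_mul hρ hv)
    (abs_mul_le_mul (abs_neg_le (abs_pow_le_pow hg 2)) hu₂)
  have h2 := abs_mul_le_mul hg (abs_add_le_add (abs_mul_le_mul hρ hv₂) (abs_mul_le_mul hv hρ₂))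
  refine (abs_add_le_add h1 h2).trans ?_
  have hM3 : M ^ 3 ≤ M ^ 5 := pow_le_pow_right₀ hM (by norm_num)
  have hp : 0 ≤ ε * W y := mul_nonneg hε0.le hW
  nlinarith [mul_le_mul_of_nonneg_right hM3 hp]

theorem integral_q'_le (hL : 0 < L) (hF : IsFlow γ L M ε W F) (hF' : IsFlow γ L M ε W F')
    (hM : 1 ≤ M) (hε0 : 0 < ε) (hW : IntervalIntegrable (fun y => W y ^ 2) volume 0 1)
    (hWM : ∫ y in (0:ℝ)..1, W y ^ 2 ≤ M) (hq : ContinuousOn (diffFields L F F').q' (Icc 0 1)) :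
    ∫ y in (0:ℝ)..1, ((diffFields L F F').q' y / ε) ^ 2 ≤ (3 * M ^ 5) ^ 2 * M := by
  have hi : IntervalIntegrable (fun y => ((diffFields L F F').q' y / ε) ^ 2) volume 0 1 := by
    apply ContinuousOn.intervalIntegrable_of_Icc zero_le_one
    exact (hq.div_const _).pow 2
  calc ∫ y in (0:ℝ)..1, ((diffFields L F F').q' y / ε) ^ 2
      ≤ ∫ y in (0:ℝ)..1, (3 * M ^ 5) ^ 2 * W y ^ 2 := by
        refine intervalIntegral.integral_mono_on_of_le_Ioo zero_le_one hi (hW.const_mul _) ?_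
        intro y hy
        have h := q'_abs_le hL hF hF' hM hε0 y hy
        rw [← mul_pow, sq_le_sq, abs_div, abs_of_pos hε0, div_le_iff₀ hε0]
        refine h.trans (le_of_eq_of_le ?_ (mul_le_mul_of_nonneg_right (le_abs_self _) hε0.le))
        ring
    _ = (3 * M ^ 5) ^ 2 * ∫ y in (0:ℝ)..1, W y ^ 2 := intervalIntegral.integral_const_mul _ _
    _ ≤ (3 * M ^ 5) ^ 2 * M := by gcongr

theorem curl_z (hF : IsFlow γ L M ε W F) (hF' : IsFlow γ L M ε W F') (hM : 1 ≤ M) {x : Pt}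
    (hx : x ∈ Rect L) : pd1 (diffFields L F F').z₂ x - pd2 (diffFields L F F').z₁ x =
      (diffFields L F F').c x := by
  have dw₁ := (hF.cu.sub hF'.cu).differentiableAt hx
  have dw₂ := (hF.cv.sub hF'.cv).differentiableAt hx
  have dk := (hF.cK.sub hF'.cK).differentiableAt hx
  have da := (hF.cs.sub hF'.cs).differentiableAt hx
  have dU₁ := (hF'.cU₁ hM).differentiableAt hx
  have dU₂ := (hF'.cU₂ hM).differentiableAt hx
  have dV₁ := (hF'.cV₁ hM).differentiableAt hx
  have dV₂ := (hF'.cV₂ hM).differentiableAt hx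
  have dkU₁ := ((hF.cK.sub hF'.cK).mul (hF'.cU₁ hM)).differentiableAt hx
  have dkU₂ := ((hF.cK.sub hF'.cK).mul (hF'.cU₂ hM)).differentiableAt hx
  have daV₁ := ((hF.cs.sub hF'.cs).mul (hF'.cV₁ hM)).differentiableAt hx
  have daV₂ := ((hF.cs.sub hF'.cs).mul (hF'.cV₂ hM)).differentiableAt hx
  have d₁ := ((hF.cu.sub hF'.cu).sub ((hF.cK.sub hF'.cK).mul (hF'.cU₁ hM))).differentiableAt hx
  have d₂ := ((hF.cv.sub hF'.cv).sub ((hF.cK.sub hF'.cK).mul (hF'.cU₂ hM))).differentiableAt hx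
  have e₁ : (diffFields L F F').z₁ = fun x => F.u x - F'.u x - (F.K x - F'.K x) * F'.U₁ x +
    (F.s x - F'.s x) * F'.V₁ x := rfl
  have e₂ : (diffFields L F F').z₂ = fun x => F.v x - F'.v x - (F.K x - F'.K x) * F'.U₂ x +
    (F.s x - F'.s x) * F'.V₂ x := rfl
  have Fu := hF.cu.differentiableAt hx
  have Fv := hF.cv.differentiableAt hx
  have FK := hF.cK.differentiableAt hx
  have Fs := hF.cs.differentiableAt hx
  have Fu' := hF'.cu.differentiableAt hx
  have Fv' := hF'.cv.differentiableAt hx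
  have FK' := hF'.cK.differentiableAt hx
  have Fs' := hF'.cs.differentiableAt hx
  rw [e₁, e₂, pd1_add d₂ daV₂, pd2_add d₁ daV₁, pd1_sub dw₂ dkU₂, pd2_sub dw₁ dkU₁,
    pd1_sub Fv Fv', pd2_sub Fu Fu', pd1_mul dk dU₂, pd2_mul dk dU₁, pd1_mul da dV₂, pd2_mul da dV₁,
    pd1_sub FK FK', pd2_sub FK FK', pd1_sub Fs Fs', pd2_sub Fs Fs']
  have h := hF.vorticity_eq hM hx
  have h' := hF'.vorticity_eq hM hx
  simp only [diffFields]
  linear_combination h - h'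

theorem transport_K (hF : IsFlow γ L M ε W F) (hF' : IsFlow γ L M ε W F') {x : Pt}
    (hx : x ∈ Rect L) : F.ρ x * F.u x * pd1 (fun y => F.K y - F'.K y) x +
      F.ρ x * F.v x * pd2 (fun y => F.K y - F'.K y) x = (diffFields L F F').Gk x := by
  have FK := hF.cK.differentiableAt hx
  have FK' := hF'.cK.differentiableAt hx
  rw [pd1_sub FK FK', pd2_sub FK FK']
  simp only [diffFields]
  linear_combination F.ρ x * hF.trK x hx - F'.ρ x * hF'.trK x hx

theorem transport_s (hF : IsFlow γ L M ε W F) (hF' : IsFlow γ L M ε W F') {x : Pt}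
    (hx : x ∈ Rect L) : F.ρ x * F.u x * pd1 (fun y => F.s y - F'.s y) x +
      F.ρ x * F.v x * pd2 (fun y => F.s y - F'.s y) x = (diffFields L F F').Ga x := by
  have FK := hF.cs.differentiableAt hx
  have FK' := hF'.cs.differentiableAt hx
  rw [pd1_sub FK FK', pd2_sub FK FK']
  simp only [diffFields]
  linear_combination F.ρ x * hF.trs x hx - F'.ρ x * hF'.trs x hx

end IsFlow

theorem lap_sub {f g : Pt → ℝ} {x : Pt} (hf : ContDiffAt ℝ 2 f x) (hg : ContDiffAt ℝ 2 g x) :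
    lap (fun y => f y - g y) x = lap f x - lap g x := by
  have e : ∀ {h : Pt → ℝ}, ContDiffAt ℝ 2 h x → ∀ᶠ y in nhds x, DifferentiableAt ℝ h y := by
    intro h hh
    filter_upwards [hh.eventually (by simp)] with y hy
    exact hy.differentiableAt (by norm_num)
  have d : ∀ {h : Pt → ℝ} (v : Pt), ContDiffAt ℝ 2 h x →
      DifferentiableAt ℝ (fun y => fderiv ℝ h y v) x := by
    intro h v hh
    exact ((hh.fderiv_right (m := 1) (by norm_num)).clm_apply contDiffAt_const).differentiableAt
      (by norm_num)
  have e1 : pd1 (fun y => f y - g y) =ᶠ[nhds x] fun y => pd1 f y - pd1 g y := by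
    filter_upwards [e hf, e hg] with y h1 h2 using pd1_sub h1 h2
  have e2 : pd2 (fun y => f y - g y) =ᶠ[nhds x] fun y => pd2 f y - pd2 g y := by
    filter_upwards [e hf, e hg] with y h1 h2 using pd2_sub h1 h2
  have f1 : pd1 (pd1 (fun y => f y - g y)) x = pd1 (fun y => pd1 f y - pd1 g y) x := by
    rw [pd1, e1.fderiv_eq]; rfl
  have f2 : pd2 (pd2 (fun y => f y - g y)) x = pd2 (fun y => pd2 f y - pd2 g y) x := by
    rw [pd2, e2.fderiv_eq]; rfl
  rw [lap, f1, f2, pd1_sub (f := pd1 f) (g := pd1 g) (d _ hf) (d _ hg),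
    pd2_sub (f := pd2 f) (g := pd2 g) (d _ hf) (d _ hg)]
  simp only [lap, pd1, pd2]
  ring

theorem exists_diffSystem {γ M lam : ℝ} (hγ : 1 < γ) (hM : 1 ≤ M) (hlam : 0 < lam)
    (hlam1 : lam ≤ 1) : ∃ C ≥ 1, ∃ l > 0, l ≤ 1 ∧ ∀ L ε W F F', 0 < L → 0 < ε → ε ≤ 1 →
      IsFlow γ L M ε W F → IsFlow γ L M ε W F' → Matched γ L lam F F' →
      IntervalIntegrable (fun y => W y ^ 2) volume 0 1 → ∫ y in (0:ℝ)..1, W y ^ 2 ≤ M →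
      DiffSystem L C l ε (diffFields L F F') ∧
        ∀ x ∈ Rect L, |F.ρ x - F'.ρ x| ≤ C * (diffFields L F F').D x := by
  obtain ⟨c, hc, C₂, hC₂, C₃, hC₃, hslope⟩ := exists_slope hγ hM
  obtain ⟨Cc, hCc, hcurl⟩ := exists_curl_dual_le hM
  obtain ⟨B, hB, hdual⟩ := exists_pairBd_dual (M ^ 2)
  have hM0 : 0 < M := by linarith
  have hB0 : 0 < B := by linarith
  have hMM : M ≤ M ^ 2 := by nlinarith
  have hM13 : M ≤ M ^ 3 := le_self_pow₀ hM (by norm_num)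
  set Cr := (M + C₃) / c with hCr
  have hCr0 : 0 ≤ Cr := by positivity
  set Cn := 2 * ((M + Cr) * M) with hCn
  have hCn0 : 0 ≤ Cn := by positivity
  set R := M * exp (2 * M) with hR
  have hR0 : 0 ≤ R := by positivity
  set Cx := M * M + (M * M * (C₂ * R + C₃) + M * R) with hCx
  have hCx0 : 0 ≤ Cx := by positivity
  set Cq := (3 * M ^ 5) ^ 2 * M with hCq
  have hCq0 : 0 ≤ Cq := by positivity
  set Cg := 2 * (Cn * M ^ 3) with hCg
  have hCg0 : 0 ≤ Cg := by positivity
  set Cv := 4 * (M ^ 3 * B) + Cc with hCv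
  have hCv0 : 0 ≤ Cv := by positivity
  set Co := (1 + C₃) * M / c with hCo
  have hCo0 : 0 ≤ Co := by positivity
  set C := 1 + M * M + M * M * M + Cq + Cg + Cv + B + Cn + Cr + Co + Cx with hC
  have hMM0 : 0 ≤ M * M := by positivity
  have hMM3 : 0 ≤ M * M * M := by positivity
  refine ⟨C, by linarith, min 1 (lam / C₂), lt_min one_pos (by positivity), min_le_left _ _,
    fun L ε W F F' hL hε0 hε hF hF' hm hW hWM => ?_⟩
  set S := diffFields L F F' with hS
  have hD := S.D_nonneg
  have hDdef : ∀ x, S.D x = |F.u x - F'.u x| + |F.v x - F'.v x| + |F.Φ x - F'.Φ x| +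
    |F.K x - F'.K x| + |F.s x - F'.s x| := fun _ => rfl
  have hr : ∀ x ∈ Rect L, |F.ρ x - F'.ρ x| ≤ Cr * S.D x := by
    intro x hx
    obtain ⟨H, h1, -, h3, -⟩ := hslope L ε W lam F F' hF hF' hm x hx
    exact density_bound hc hC₃.le hM h1 h3 (hF.delta_h hF' x) (hF.abs_um_le hF' hM hx)
      (hF.abs_vm_le hF' hM hε hx)
  have pρ : ∀ x ∈ Rect L, PairBd (M + Cr) (S.D x) (F.ρ x) (F'.ρ x) := fun x hx =>
    ⟨(abs_le_of_mem hM (hF.ρ_mem x hx)).trans (by linarith),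
      (abs_le_of_mem hM (hF'.ρ_mem x hx)).trans (by linarith),
      (hr x hx).trans (mul_le_mul_of_nonneg_right (by linarith) (hD x))⟩
  have pu : ∀ x ∈ Rect L, PairBd M (S.D x) (F.u x) (F'.u x) := fun x hx =>
    ⟨abs_le_of_mem hM (hF.u_mem x hx), abs_le_of_mem hM (hF'.u_mem x hx),
      (S.abs_w₁_le x).trans (le_mul_of_one_le_left (hD x) hM)⟩
  have pv : ∀ x ∈ Rect L, PairBd M (S.D x) (F.v x) (F'.v x) := fun x hx => hF.pair_v hF' hM hε hx
  have ph : ∀ x ∈ Rect L, PairBd M (S.D x) (F.h x) (F'.h x) := fun x hx => hF.pair_h hF' hM hε hx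
  have hn₁ : ∀ x ∈ Rect L, |S.n₁ x| ≤ Cn * S.D x := fun x hx => ((pρ x hx).mul (pu x hx)).2.2
  have hn₂ : ∀ x ∈ Rect L, |S.n₂ x| ≤ Cn * S.D x := fun x hx => ((pρ x hx).mul (pv x hx)).2.2
  have pd : ∀ x ∈ Rect L, PairBd B (S.D x) (F.U₁ x) (F'.U₁ x) ∧
      PairBd B (S.D x) (F.U₂ x) (F'.U₂ x) ∧ PairBd B (S.D x) (F.V₁ x) (F'.V₁ x) ∧
      PairBd B (S.D x) (F.V₂ x) (F'.V₂ x) := fun x hx =>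
    hdual (S.D x) _ _ _ _ _ _ (hD x) (PairBd.inv hM (hF.u_mem x hx) (hF'.u_mem x hx)
      (S.abs_w₁_le x)) ((pv x hx).mono hMM (hD x)) ((ph x hx).mono hMM (hD x))
  have hG : ∀ x ∈ Rect L, ∀ X Y : ℝ, |X| ≤ M ^ 3 * ε → |Y| ≤ M * ε →
      |-(S.n₁ x * X + S.n₂ x * Y)| ≤ C * ε * S.D x := by
    intro x hx X Y hX hY
    have hY' : |Y| ≤ M ^ 3 * ε := hY.trans (mul_le_mul_of_nonneg_right hM13 hε0.le)
    refine (abs_neg_le (abs_add_le_add (abs_mul_le_mul (hn₁ x hx) hX)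
      (abs_mul_le_mul (hn₂ x hx) hY'))).trans ?_
    calc Cn * S.D x * (M ^ 3 * ε) + Cn * S.D x * (M ^ 3 * ε) = Cg * (ε * S.D x) := by
          rw [hCg]; ring
      _ ≤ C * (ε * S.D x) :=
          mul_le_mul_of_nonneg_right (by linarith) (mul_nonneg hε0.le (hD x))
      _ = C * ε * S.D x := by ring
  have hexit : ∀ y ∈ Icc (0:ℝ) 1, ((L, y) : Pt) ∈ Rect L := fun y hy =>
    mem_Rect ⟨hL.le, le_rfl⟩ hy
  have cQ := hF.cQ hF' hM
  have hq' : ContinuousOn S.q' (Icc 0 1) := cQ.continuousOn_pd2.slice_fst ⟨hL.le, le_rfl⟩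
  have hin : ∀ y ∈ Icc (0:ℝ) 1, ((0, y) : Pt) ∈ Rect L := fun y hy =>
    mem_Rect ⟨le_rfl, hL.le⟩ hy
  refine ⟨?_, fun x hx => (hr x hx).trans (mul_le_mul_of_nonneg_right (by linarith) (hD x))⟩
  exact
  { hw₁ := hF.cu.sub hF'.cu
    hw₂ := hF.cv.sub hF'.cv
    hk := hF.cK.sub hF'.cK
    ha := hF.cs.sub hF'.cs
    hΨ := fun x hx => (hF.cΦ x hx).sub (hF'.cΦ x hx)
    hr := (hF.cρ.sub hF'.cρ).continuousOn
    hm₁ := hF.cρ.mul hF.cu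
    hm₂ := hF.cρ.mul hF.cv
    hn₁ := (hF.cρ.mul hF.cu).sub (hF'.cρ.mul hF'.cu)
    hn₂ := (hF.cρ.mul hF.cv).sub (hF'.cρ.mul hF'.cv)
    hU₁ := hF'.cU₁ hM
    hU₂ := hF'.cU₂ hM
    hV₁ := hF'.cV₁ hM
    hV₂ := hF'.cV₂ hM
    hc := ((((hF.cK.continuousOn_pd1.mul ((hF.cU₂ hM).sub (hF'.cU₂ hM)).continuousOn).sub
      (hF.cK.continuousOn_pd2.mul ((hF.cU₁ hM).sub (hF'.cU₁ hM)).continuousOn)).sub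
      ((hF.cs.continuousOn_pd1.mul ((hF.cV₂ hM).sub (hF'.cV₂ hM)).continuousOn).sub
      (hF.cs.continuousOn_pd2.mul ((hF.cV₁ hM).sub (hF'.cV₁ hM)).continuousOn))).sub
      ((hF.cK.sub hF'.cK).continuousOn.mul ((hF'.cU₂ hM).continuousOn_pd1.sub
        (hF'.cU₁ hM).continuousOn_pd2))).add
      ((hF.cs.sub hF'.cs).continuousOn.mul ((hF'.cV₂ hM).continuousOn_pd1.sub
        (hF'.cV₁ hM).continuousOn_pd2))
    hGk := ((((hF.cρ.mul hF.cu).sub (hF'.cρ.mul hF'.cu)).continuousOn.mul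
      hF'.cK.continuousOn_pd1).add (((hF.cρ.mul hF.cv).sub (hF'.cρ.mul hF'.cv)).continuousOn.mul
      hF'.cK.continuousOn_pd2)).neg
    hGa := ((((hF.cρ.mul hF.cu).sub (hF'.cρ.mul hF'.cu)).continuousOn.mul
      hF'.cs.continuousOn_pd1).add (((hF.cρ.mul hF.cv).sub (hF'.cρ.mul hF'.cv)).continuousOn.mul
      hF'.cs.continuousOn_pd2)).neg
    hq := cQ.continuousOn.slice_fst ⟨hL.le, le_rfl⟩
    hq' := hq'
    dq := fun y hy => hasDerivAt_snd (x := (L, y))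
      (cQ.differentiableAt (hexit y (Ioo_subset_Icc_self hy)))
    q0 := by
      simp [hS, diffFields, hF.v_w0 L ⟨hL.le, le_rfl⟩, hF'.v_w0 L ⟨hL.le, le_rfl⟩]
    q1 := by
      simp [hS, diffFields, hF.v_w1 L ⟨hL.le, le_rfl⟩, hF'.v_w1 L ⟨hL.le, le_rfl⟩]
    q_le := fun y hy => by
      have hx := hexit y hy
      exact (abs_mul_le_mul (abs_mul_le_mul (hF.abs_ρm_le hF' hM hx) (hF.abs_vm_le hF' hM hε hx))
        (abs_inv_le_of_mem hM (half_add_mem (hF.u_mem _ hx) (hF'.u_mem _ hx)))).trans (by linarith)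
    q'_le := (IsFlow.integral_q'_le hL hF hF' hM hε0 hW hWM hq').trans (by linarith)
    divm := hF.mass
    divn := fun x hx => by
      have hx' := Noz_subset_Rect L hx
      have h := hF.mass x hx
      have h' := hF'.mass x hx
      change pd1 (fun x => F.ρ x * F.u x - F'.ρ x * F'.u x) x +
        pd2 (fun x => F.ρ x * F.v x - F'.ρ x * F'.v x) x = 0
      rw [pd1_sub ((hF.cρ.mul hF.cu).differentiableAt hx') ((hF'.cρ.mul hF'.cu).differentiableAt hx'),
        pd2_sub ((hF.cρ.mul hF.cv).differentiableAt hx') ((hF'.cρ.mul hF'.cv).differentiableAt hx')]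
      linarith
    m_w0 := fun s hs => by simp [hS, diffFields, hF.v_w0 s hs]
    m_w1 := fun s hs => by simp [hS, diffFields, hF.v_w1 s hs]
    n_w0 := fun s hs => by simp [hS, diffFields, hF.v_w0 s hs, hF'.v_w0 s hs]
    n_w1 := fun s hs => by simp [hS, diffFields, hF.v_w1 s hs, hF'.v_w1 s hs]
    m_lo := fun x hx => by
      have h1 : M⁻¹ * M⁻¹ ≤ F.ρ x * F.u x :=
        mul_le_mul (hF.ρ_mem x hx).1 (hF.u_mem x hx).1 (by positivity)
          (pos_of_mem hM (hF.ρ_mem x hx)).le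
      refine le_trans ?_ h1
      rw [← mul_inv]
      exact inv_anti₀ (by positivity) (by linarith)
    tr_k := fun x hx => hF.transport_K hF' (Noz_subset_Rect L hx)
    tr_a := fun x hx => hF.transport_s hF' (Noz_subset_Rect L hx)
    Gk_le := fun x hx => hG x hx _ _ (hF'.pd1_K_le hM hε hx) (hF'.K₂_le x hx)
    Ga_le := fun x hx => hG x hx _ _ (hF'.pd1_s_le hM hε hx) (hF'.s₂_le x hx)
    k_in := fun y hy => sub_eq_zero.2 (hm.K_in y hy)
    a_in := fun y hy => sub_eq_zero.2 (hm.s_in y hy)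
    w₂_in := fun y hy => by simp [hS, diffFields, hF.v_in y hy, hF'.v_in y hy]
    lapΨ := fun x hx => by
      have hx' := Noz_subset_Rect L hx
      exact (lap_sub (hF.cΦ x hx') (hF'.cΦ x hx')).trans (hm.poisson x hx)
    Ψ_in := fun y hy => sub_eq_zero.2 (hm.Φ_in y hy)
    Ψ_ex := fun y hy => sub_eq_zero.2 (hm.Φ_ex y hy)
    Ψ_w0 := fun s hs => by
      have hx : ((s, 0) : Pt) ∈ Rect L := mem_Rect (Ioo_subset_Icc_self hs) ⟨le_rfl, zero_le_one⟩
      refine (pd2_sub ((hF.cΦ _ hx).differentiableAt (by norm_num))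
        ((hF'.cΦ _ hx).differentiableAt (by norm_num))).trans (sub_eq_zero.2 (hm.Φ_w0 s hs))
    Ψ_w1 := fun s hs => by
      have hx : ((s, 1) : Pt) ∈ Rect L := mem_Rect (Ioo_subset_Icc_self hs) ⟨zero_le_one, le_rfl⟩
      refine (pd2_sub ((hF.cΦ _ hx).differentiableAt (by norm_num))
        ((hF'.cΦ _ hx).differentiableAt (by norm_num))).trans (sub_eq_zero.2 (hm.Φ_w1 s hs))
    curl := fun x hx => hF.curl_z hF' hM hx
    c_le := fun x hx => by
      obtain ⟨d1, d2, d3, d4⟩ := pd x hx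
      obtain ⟨c1, c2⟩ := hcurl γ L ε W F' hε hF' x hx
      have hup : ∀ {Y : ℝ}, |Y| ≤ M * ε → |Y| ≤ M ^ 3 * ε := fun hY =>
        hY.trans (mul_le_mul_of_nonneg_right hM13 hε0.le)
      have key := abs_add_le_add (abs_sub_le_add (abs_sub_le_add (abs_sub_le_add
        (abs_mul_le_mul (hF.pd1_K_le hM hε hx) d2.2.2) (abs_mul_le_mul (hup (hF.K₂_le x hx)) d1.2.2))
        (abs_sub_le_add (abs_mul_le_mul (hF.pd1_s_le hM hε hx) d4.2.2)
          (abs_mul_le_mul (hup (hF.s₂_le x hx)) d3.2.2)))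
        (abs_mul_le_mul (le_refl |F.K x - F'.K x|) c1))
        (abs_mul_le_mul (le_refl |F.s x - F'.s x|) c2)
      refine (show |S.c x| ≤ _ from key).trans ?_
      have e1 : 0 ≤ ε * S.D x := mul_nonneg hε0.le (hD x)
      have e2 := abs_nonneg (F.K x - F'.K x)
      have e3 := abs_nonneg (F.s x - F'.s x)
      have hcc : 4 * (M ^ 3 * B) ≤ C := by linarith
      have hcc' : Cc ≤ C := by
        have : 0 ≤ 4 * (M ^ 3 * B) := by positivity
        linarith
      change _ ≤ C * (ε * S.D x + |F.K x - F'.K x| + |F.s x - F'.s x|)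
      linarith [mul_le_mul_of_nonneg_right hcc e1, mul_le_mul_of_nonneg_right hcc' e2,
        mul_le_mul_of_nonneg_right hcc' e3]
    U₁_le := fun x hx => (pd x hx).1.2.1.trans (by linarith)
    U₂_le := fun x hx => (pd x hx).2.1.2.1.trans (by linarith)
    V₁_le := fun x hx => (pd x hx).2.2.1.2.1.trans (by linarith)
    V₂_le := fun x hx => (pd x hx).2.2.2.2.1.trans (by linarith)
    n₁_le := fun x hx => (hn₁ x hx).trans (mul_le_mul_of_nonneg_right (by linarith) (hD x))
    n₂_le := fun x hx => (hn₂ x hx).trans (mul_le_mul_of_nonneg_right (by linarith) (hD x))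
    coercive := fun x hx => by
      obtain ⟨H, h1, h2, h3, h4⟩ := hslope L ε W lam F F' hF hF' hm x hx
      have key := coercive_bound hc hC₃.le hM hlam hlam1 h1 h2 h3 (hF.delta_h hF' x)
        (hF.abs_um_le hF' hM hx) (hF.abs_vm_le hF' hM hε hx) h4
      have e1 : S.n₁ x = _ := IsFlow.n₁_eq (F := F) (F' := F') x
      have e2 : S.n₂ x = _ := IsFlow.n₂_eq (F := F) (F' := F') x
      rw [e1, e2]
      change min 1 (lam / C₂) * ((F.u x - F'.u x) ^ 2 + (F.v x - F'.v x) ^ 2 +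
        (F.Φ x - F'.Φ x) ^ 2) ≤ (_ * (F.u x - F'.u x) + _ * (F.v x - F'.v x) +
        (F.ρ x - F'.ρ x) * (F.Φ x - F'.Φ x)) +
        C * ((|F.K x - F'.K x| + |F.s x - F'.s x|) * S.D x)
      have e3 : 0 ≤ (F.u x - F'.u x) ^ 2 + (F.v x - F'.v x) ^ 2 + (F.Φ x - F'.Φ x) ^ 2 := by
        positivity
      have e4 : 0 ≤ (|F.K x - F'.K x| + |F.s x - F'.s x|) * S.D x :=
        mul_nonneg (by positivity) (hD x)
      have e5 := mul_le_mul_of_nonneg_right (min_le_right 1 (lam / C₂)) e3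
      have e6 := mul_le_mul_of_nonneg_right (show Co ≤ C by linarith) e4
      rw [← hDdef x] at key
      linarith
    exit := fun y hy => by
      have hx := hexit y hy
      obtain ⟨H, h1, h2, h3, -⟩ := hslope L ε W lam F F' hF hF' hm _ hx
      have hδ := hF.delta_h hF' (L, y)
      have hρ : |F.ρ (L, y) - F'.ρ (L, y)| ≤ R * |F.s (L, y) - F'.s (L, y)| :=
        abs_sub_le_of_pressure_eq hγ hM (hF.s_le _ hx) (hF'.s_le _ hx) (hF.ρ_mem _ hx)
          (hF'.ρ_mem _ hx) (hm.p_ex y hy)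
      have hum := half_add_mem (hF.u_mem _ hx) (hF'.u_mem _ hx)
      have hne := (pos_of_mem hM hum).ne'
      have hH : |F.h (L, y) - F'.h (L, y)| ≤ (C₂ * R + C₃) * |F.s (L, y) - F'.s (L, y)| := by
        have e : F.h (L, y) - F'.h (L, y) = H * (F.ρ (L, y) - F'.ρ (L, y)) +
          (F.h (L, y) - F'.h (L, y) - H * (F.ρ (L, y) - F'.ρ (L, y))) := by ring
        rw [e]
        refine (abs_add_le_add (abs_mul_le_mul (A := C₂) ?_ hρ) h3).trans (le_of_eq (by ring))
        rw [abs_of_pos (hc.trans_le h1)]; exact h2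
      have e : S.n₁ (L, y) + S.q y * S.w₂ (L, y) =
          (F.ρ (L, y) + F'.ρ (L, y)) / 2 * ((F.u (L, y) + F'.u (L, y)) / 2)⁻¹ *
            ((F.K (L, y) - F'.K (L, y)) - (F.h (L, y) - F'.h (L, y))) +
          (F.u (L, y) + F'.u (L, y)) / 2 * (F.ρ (L, y) - F'.ρ (L, y)) := by
        have e1 : S.n₁ (L, y) = _ := IsFlow.n₁_eq (F := F) (F' := F') (L, y)
        have e2 : S.q y * S.w₂ (L, y) = (F.ρ (L, y) + F'.ρ (L, y)) / 2 *
          ((F.v (L, y) + F'.v (L, y)) / 2) * ((F.u (L, y) + F'.u (L, y)) / 2)⁻¹ *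
          (F.v (L, y) - F'.v (L, y)) := rfl
        rw [e1, e2, hδ, hm.Φ_ex y hy]
        linear_combination -((F.ρ (L, y) + F'.ρ (L, y)) / 2 * (F.u (L, y) - F'.u (L, y))) *
          (inv_mul_cancel₀ hne)
      rw [e]
      refine (abs_add_le_add (abs_mul_le_mul (abs_mul_le_mul (hF.abs_ρm_le hF' hM hx)
        (abs_inv_le_of_mem hM hum)) (abs_sub_le_add (le_refl _) hH))
        (abs_mul_le_mul (hF.abs_um_le hF' hM hx) hρ)).trans ?_
      change _ ≤ C * (|F.K (L, y) - F'.K (L, y)| + |F.s (L, y) - F'.s (L, y)|)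
      have e2 := abs_nonneg (F.K (L, y) - F'.K (L, y))
      have e3 := abs_nonneg (F.s (L, y) - F'.s (L, y))
      have g1 : M * M ≤ C := by linarith
      have g2 : M * M * (C₂ * R + C₃) + M * R ≤ C := by linarith
      linarith [mul_le_mul_of_nonneg_right g1 e2, mul_le_mul_of_nonneg_right g2 e3] }

theorem exists_flow_unique {γ L M lam : ℝ} (hγ : 1 < γ) (hL : 0 < L) (hM : 1 ≤ M) (hlam : 0 < lam)
    (hlam1 : lam ≤ 1) : ∃ ε₀ > 0, ε₀ ≤ 1 ∧ ∀ ε W F F', 0 < ε → ε ≤ ε₀ →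
      IsFlow γ L M ε W F → IsFlow γ L M ε W F' → Matched γ L lam F F' →
      IntervalIntegrable (fun y => W y ^ 2) volume 0 1 → ∫ y in (0:ℝ)..1, W y ^ 2 ≤ M →
      ∀ x ∈ Rect L, F.ρ x = F'.ρ x ∧ F.u x = F'.u x ∧ F.v x = F'.v x ∧ F.s x = F'.s x ∧
        F.Φ x = F'.Φ x := by
  obtain ⟨C, hC, l, hl, hl1, h⟩ := exists_diffSystem hγ hM hlam hlam1
  obtain ⟨η₀, hη₀, hsmall⟩ := DiffSystem.exists_small L C l hL hC hl hl1
  refine ⟨min 1 (η₀ ^ 2), by positivity, min_le_left _ _,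
    fun ε W F F' hε0 hε hF hF' hm hW hWM x hx => ?_⟩
  obtain ⟨hS, hr⟩ := h L ε W F F' hL hε0 (hε.trans (min_le_left _ _)) hF hF' hm hW hWM
  have he : (diffFields L F F').e x = 0 := by
    refine hsmall (√ε) (sqrt_pos.2 hε0) ?_ _ (by rwa [sq_sqrt hε0.le]) x hx
    exact sqrt_le_iff.2 ⟨hη₀.le, hε.trans (min_le_right _ _)⟩
  have hD : (diffFields L F F').D x = 0 := by
    have := (diffFields L F F').sq_D_le x
    rw [he, mul_zero] at this
    exact pow_eq_zero_iff two_ne_zero |>.1 (le_antisymm this (sq_nonneg _))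
  have hr' := hr x hx
  rw [hD, mul_zero] at hr'
  simp only [DiffFields.D, diffFields] at hD
  have p1 := abs_nonneg (F.u x - F'.u x)
  have p2 := abs_nonneg (F.v x - F'.v x)
  have p3 := abs_nonneg (F.Φ x - F'.Φ x)
  have p4 := abs_nonneg (F.K x - F'.K x)
  have p5 := abs_nonneg (F.s x - F'.s x)
  have key : ∀ {a b : ℝ}, |a - b| ≤ 0 → a = b := fun h =>
    sub_eq_zero.1 (abs_nonpos_iff.1 h)
  exact ⟨key hr', key (by linarith), key (by linarith), key (by linarith), key (by linarith)⟩

/-! ### bounds contained in the Hölder norms -/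

theorem le_of_ofReal_le_sup {ι : Type*} {Ω : Set ι} {g : ι → ℝ} {δ : ℝ} (hδ : 0 ≤ δ)
    (h : ⨆ x ∈ Ω, ENNReal.ofReal (g x) ≤ ENNReal.ofReal δ) : ∀ x ∈ Ω, g x ≤ δ := fun x hx =>
  (ENNReal.ofReal_le_ofReal_iff hδ).1
    ((le_iSup₂ (f := fun x (_ : x ∈ Ω) => ENNReal.ofReal (g x)) x hx).trans h)

theorem wSup_le_of_whNorm_le {m : ℕ} {α k δ : ℝ} {Γ Ω : Set Pt} {f : Pt → ℝ}
    (hδ : 0 ≤ δ) (h : whNorm m α k Γ Ω f ≤ ENNReal.ofReal δ) {i j : ℕ} (hij : i + j ≤ m) :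
    ∀ x ∈ Ω, infDist x Γ ^ (max (((i + j : ℕ) : ℝ) + k) 0) * |Dmix i j f x| ≤ δ := by
  rw [whNorm] at h
  refine le_of_ofReal_le_sup hδ (le_trans ?_ (le_self_add.trans h))
  have hmem : (i, j) ∈ idxLe m := by
    simp only [idxLe, Finset.mem_filter, Finset.mem_product, Finset.mem_range]; omega
  have hle := Finset.single_le_sum
    (f := fun p : ℕ × ℕ => wSup k Γ Ω (p.1 + p.2) (Dmix p.1 p.2 f)) (fun _ _ => bot_le) hmem
  exact hle

theorem bounds_of_whNorm_one {α δ : ℝ} {Γ Ω : Set Pt} {f : Pt → ℝ} (hα : α ∈ Ioo (0:ℝ) 1)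
    (hδ : 0 ≤ δ) (h : whNorm 1 α (-α) Γ Ω f ≤ ENNReal.ofReal δ) : ∀ x ∈ Ω, |f x| ≤ δ ∧
      infDist x Γ ^ (1 - α) * |pd1 f x| ≤ δ ∧ infDist x Γ ^ (1 - α) * |pd2 f x| ≤ δ := by
  intro x hx
  have e0 := wSup_le_of_whNorm_le hδ h (i := 0) (j := 0) (by norm_num) x hx
  have e1 := wSup_le_of_whNorm_le hδ h (i := 1) (j := 0) (by norm_num) x hx
  have e2 := wSup_le_of_whNorm_le hδ h (i := 0) (j := 1) (by norm_num) x hx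
  have m0 : max (((0 + 0 : ℕ) : ℝ) + -α) 0 = 0 := max_eq_right (by simpa using hα.1.le)
  have m1 : max (((1 + 0 : ℕ) : ℝ) + -α) 0 = 1 - α := by
    rw [max_eq_left (by push_cast; linarith [hα.2])]; push_cast; ring
  have m2 : max (((0 + 1 : ℕ) : ℝ) + -α) 0 = 1 - α := by
    rw [max_eq_left (by push_cast; linarith [hα.2])]; push_cast; ring
  rw [m0, rpow_zero, one_mul] at e0
  rw [m1] at e1
  rw [m2] at e2
  exact ⟨e0, e1, e2⟩

theorem bounds_of_whNorm_two {α δ : ℝ} {Γ Ω : Set Pt} {f : Pt → ℝ} (hα : α ∈ Ioo (0:ℝ) 1)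
    (hδ : 0 ≤ δ) (h : whNorm 2 α (-1 - α) Γ Ω f ≤ ENNReal.ofReal δ) : ∀ x ∈ Ω,
      |pd1 f x| ≤ δ ∧ |pd2 f x| ≤ δ := by
  intro x hx
  have e1 := wSup_le_of_whNorm_le hδ h (i := 1) (j := 0) (by norm_num) x hx
  have e2 := wSup_le_of_whNorm_le hδ h (i := 0) (j := 1) (by norm_num) x hx
  have m1 : max (((1 + 0 : ℕ) : ℝ) + (-1 - α)) 0 = 0 :=
    max_eq_right (by push_cast; linarith [hα.1])
  have m2 : max (((0 + 1 : ℕ) : ℝ) + (-1 - α)) 0 = 0 :=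
    max_eq_right (by push_cast; linarith [hα.1])
  rw [m1, rpow_zero, one_mul] at e1
  rw [m2, rpow_zero, one_mul] at e2
  exact ⟨e1, e2⟩

theorem abs_deriv_le_of_h1Norm {α δ : ℝ} {Ω : Set ℝ} {f : ℝ → ℝ} (hδ : 0 ≤ δ)
    (h : h1Norm 1 α Ω f ≤ ENNReal.ofReal δ) : ∀ x ∈ Ω, |deriv f x| ≤ δ := by
  rw [h1Norm] at h
  refine le_of_ofReal_le_sup hδ (le_trans ?_ (le_self_add.trans h))
  have hle := Finset.single_le_sum (f := fun i => supAbs1 Ω (deriv^[i] f))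
    (fun _ _ => bot_le) (show 1 ∈ Finset.range (1 + 1) by simp)
  exact hle

theorem abs_deriv_le_of_wh1Norm {α δ : ℝ} {Γ Ω : Set ℝ} {f : ℝ → ℝ} (hα : 0 < α) (hδ : 0 ≤ δ)
    (h : wh1Norm 2 α (-1 - α) Γ Ω f ≤ ENNReal.ofReal δ) : ∀ x ∈ Ω, |deriv f x| ≤ δ := by
  have key : ∀ x ∈ Ω, infDist x Γ ^ (max (((1 : ℕ) : ℝ) + (-1 - α)) 0) * |deriv f x| ≤ δ := by
    rw [wh1Norm] at h
    refine le_of_ofReal_le_sup hδ (le_trans ?_ (le_self_add.trans h))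
    have hle := Finset.single_le_sum (f := fun i => wSup1 (-1 - α) Γ Ω i (deriv^[i] f))
      (fun _ _ => bot_le) (show 1 ∈ Finset.range (2 + 1) by simp)
    exact hle
  intro x hx
  have e := key x hx
  rwa [max_eq_right (by push_cast; linarith), rpow_zero, one_mul] at e

theorem min_le_infDist_GamWbar {L : ℝ} (hL : 0 < L) (x : Pt) :
    min x.2 (1 - x.2) ≤ infDist x (GamWbar L) := by
  have hne : (GamWbar L).Nonempty := ⟨(0, 0), ⟨⟨le_rfl, hL.le⟩, by simp⟩⟩
  refine (le_infDist hne).2 ?_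
  rintro ⟨t, y⟩ ⟨-, hy⟩
  refine le_trans ?_ (le_max_right _ _)
  rcases hy with hy | hy
  · have hy : y = 0 := hy
    simp only [hy, Real.dist_eq, sub_zero]
    exact (min_le_left _ _).trans (le_abs_self _)
  · have hy : y = 1 := hy
    simp only [hy, Real.dist_eq]
    rw [abs_sub_comm]
    exact (min_le_right _ _).trans (le_abs_self _)

theorem le_rpow_of_weighted {D d α δ X : ℝ} (hα : α < 1) (hd : 0 < d) (hD : d ≤ D) (hX : 0 ≤ X)
    (h : D ^ (1 - α) * X ≤ δ) : X ≤ δ * d ^ (α - 1) := by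
  have h1 : d ^ (1 - α) * X ≤ δ :=
    (mul_le_mul_of_nonneg_right (rpow_le_rpow hd.le hD (by linarith)) hX).trans h
  have e : d ^ (α - 1) = (d ^ (1 - α))⁻¹ := by rw [← rpow_neg hd.le]; congr 1; ring
  rw [e, ← div_eq_mul_inv, le_div_iff₀ (rpow_pos_of_pos hd _), mul_comm]
  exact h1

theorem abs_le_rpow_of_deriv {f f' : ℝ → ℝ} {α A b : ℝ} (hα : 0 < α) (hf : ContinuousOn f (Icc 0 b))
    (hd : ∀ t ∈ Ioo 0 b, HasDerivAt f (f' t) t) (hb : ∀ t ∈ Ioo 0 b, |f' t| ≤ A * t ^ (α - 1))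
    (h0 : f 0 = 0) : ∀ t ∈ Icc 0 b, |f t| ≤ A / α * t ^ α := by
  intro t ht
  have hB : ∀ t : ℝ, 0 < t → HasDerivAt (fun t => A / α * t ^ α) (A * t ^ (α - 1)) t := by
    intro t ht
    have := ((hasDerivAt_rpow_const (x := t) (p := α) (Or.inl ht.ne')).const_mul (A / α))
    refine this.congr_deriv ?_
    rw [← mul_assoc, div_mul_cancel₀ _ hα.ne']
  have hcB : ContinuousOn (fun t : ℝ => A / α * t ^ α) (Icc 0 b) :=
    (continuous_const.mul (continuous_id.rpow_const fun _ => Or.inr hα.le)).continuousOn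
  have m1 : MonotoneOn (fun t => A / α * t ^ α - f t) (Icc 0 b) := by
    refine monotoneOn_of_hasDerivWithinAt_nonneg (f' := fun t => A * t ^ (α - 1) - f' t)
      (convex_Icc _ _) (hcB.sub hf) ?_ ?_
    · intro x hx
      rw [interior_Icc] at hx
      exact ((hB x hx.1).sub (hd x hx)).hasDerivWithinAt
    · intro x hx
      rw [interior_Icc] at hx
      linarith [(abs_le.1 (hb x hx)).2]
  have m2 : MonotoneOn (fun t => A / α * t ^ α + f t) (Icc 0 b) := by
    refine monotoneOn_of_hasDerivWithinAt_nonneg (f' := fun t => A * t ^ (α - 1) + f' t)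
      (convex_Icc _ _) (hcB.add hf) ?_ ?_
    · intro x hx
      rw [interior_Icc] at hx
      exact ((hB x hx.1).add (hd x hx)).hasDerivWithinAt
    · intro x hx
      rw [interior_Icc] at hx
      linarith [(abs_le.1 (hb x hx)).1]
  have l0 : (0:ℝ) ∈ Icc 0 b := ⟨le_rfl, ht.1.trans ht.2⟩
  have g1 := m1 l0 ht ht.1
  have g2 := m2 l0 ht ht.1
  simp only [h0, zero_rpow hα.ne', mul_zero] at g1 g2
  exact abs_le.2 ⟨by linarith, by linarith⟩

theorem intervalIntegrable_wall_weight {α : ℝ} (hα : 1 / 2 < α) :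
    IntervalIntegrable (fun y : ℝ => (min y (1 - y) ^ (α - 1)) ^ 2) volume 0 1 := by
  have h1 : IntervalIntegrable (fun y : ℝ => y ^ (2 * α - 2)) volume 0 1 :=
    intervalIntegral.intervalIntegrable_rpow' (by linarith)
  have h2 : IntervalIntegrable (fun y : ℝ => (1 - y) ^ (2 * α - 2)) volume 0 1 := by
    have := (h1.comp_sub_left 1).symm
    simpa using this
  refine (h1.add h2).mono_fun ?_ ?_
  · refine Measurable.aestronglyMeasurable ?_
    fun_prop
  · refine (ae_restrict_iff' measurableSet_uIoc).2 (Filter.Eventually.of_forall fun y hy => ?_)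
    rw [uIoc_of_le zero_le_one] at hy
    have n1 : 0 ≤ y ^ (2 * α - 2) := rpow_nonneg hy.1.le _
    have n2 : 0 ≤ (1 - y) ^ (2 * α - 2) := rpow_nonneg (by linarith [hy.2]) _
    have e : ∀ z : ℝ, 0 ≤ z → (z ^ (α - 1)) ^ 2 = z ^ (2 * α - 2) := by
      intro z hz
      rw [← rpow_natCast, ← rpow_mul hz]
      congr 1; push_cast; ring
    have hmin : 0 ≤ min y (1 - y) := le_min hy.1.le (by linarith [hy.2])
    change ‖(min y (1 - y) ^ (α - 1)) ^ 2‖ ≤ ‖y ^ (2 * α - 2) + (1 - y) ^ (2 * α - 2)‖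
    rw [e _ hmin, Real.norm_eq_abs, Real.norm_eq_abs, abs_of_nonneg (rpow_nonneg hmin _),
      abs_of_nonneg (add_nonneg n1 n2)]
    rcases min_choice y (1 - y) with h | h <;> rw [h] <;> linarith

/-! ### states close to the background -/

theorem IsCompact.exists_bound_near {X : Type*} [PseudoMetricSpace X] {K : Set X} (hK : IsCompact K)
    {f : X → ℝ} (hf : ∀ k ∈ K, ContinuousAt f k) :
    ∃ A : ℝ, ∃ δ > 0, ∀ k ∈ K, ∀ y, dist y k < δ → |f y| ≤ A := by
  obtain ⟨A, hA⟩ := hK.exists_bound_of_continuousOn fun k hk => (hf k hk).continuousWithinAt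
  have hsub : K ⊆ interior {y | |f y| ≤ A + 1} := fun k hk => by
    rw [mem_interior_iff_mem_nhds]
    filter_upwards [(hf k hk).abs.eventually (gt_mem_nhds (lt_of_le_of_lt (hA k hk)
      (lt_add_one A)))] with y hy using le_of_lt hy
  obtain ⟨δ, hδ, h⟩ := hK.exists_thickening_subset_open isOpen_interior hsub
  exact ⟨A + 1, δ, hδ, fun k hk y hy =>
    interior_subset (s := {y | |f y| ≤ A + 1}) (h (mem_thickening_iff.2 ⟨k, hk, hy⟩))⟩

theorem IsCompact.exists_lower_bound_near {X : Type*} [PseudoMetricSpace X] {K : Set X}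
    (hK : IsCompact K) {f : X → ℝ} {ν : ℝ} (hf : ∀ k ∈ K, ContinuousAt f k) (hν : 0 < ν)
    (h : ∀ k ∈ K, ν ≤ f k) : ∃ δ > 0, ∀ k ∈ K, ∀ y, dist y k < δ → ν / 2 ≤ f y := by
  have hsub : K ⊆ interior {y | ν / 2 ≤ f y} := fun k hk => by
    rw [mem_interior_iff_mem_nhds]
    filter_upwards [(hf k hk).eventually (lt_mem_nhds ((half_lt_self hν).trans_le (h k hk)))]
      with y hy using le_of_lt hy
  obtain ⟨δ, hδ, h⟩ := hK.exists_thickening_subset_open isOpen_interior hsub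
  exact ⟨δ, hδ, fun k hk y hy =>
    interior_subset (s := {y | ν / 2 ≤ f y}) (h (mem_thickening_iff.2 ⟨k, hk, hy⟩))⟩

theorem exists_bounds_near_background {R : Set ℝ} {γ κ J ν r₀ : ℝ} (hR : IsCompact R) (hγ : 1 < γ)
    (hκ : 0 < κ) (hJ : 0 < J) (hν : 0 < ν) (hr₀ : 0 < r₀) (hlo : ∀ r ∈ R, r₀ ≤ r)
    (hsub : ∀ r ∈ R, ν ≤ γ * κ * r ^ (γ - 1) - J ^ 2 / r ^ 2) :
    ∃ M lam δ : ℝ, 1 ≤ M ∧ 0 < lam ∧ lam ≤ 1 ∧ 0 < δ ∧ ∀ r ∈ R, ∀ p ρ ξ ρm u v : ℝ,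
      |p - κ * r ^ γ| < δ → |ρ - r| < δ → |ξ - r| < δ → |ρm - r| < δ → |u - J / r| < δ → |v| < δ →
      0 < p ∧ ρ ∈ Icc M⁻¹ M ∧ u ∈ Icc M⁻¹ M ∧ |log p / γ - log ρ| ≤ M ∧
      |γ * p / ((γ - 1) * ρ)| ≤ M ∧
      lam ≤ γ * (p / ρ ^ γ) * ξ ^ (γ - 2) * ρm - (u ^ 2 + v ^ 2) := by
  have hpos : ∀ r ∈ R, 0 < r := fun r hr => hr₀.trans_le (hlo r hr)
  have hγ0 : 0 < γ := one_pos.trans hγ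
  obtain ⟨R₁, hR₁⟩ := hR.isBounded.subset_closedBall 0
  set c : ℝ → ℝ × ℝ × ℝ × ℝ × ℝ × ℝ := fun r => (κ * r ^ γ, r, r, r, J / r, 0) with hc
  have hcc : ContinuousOn c R := by
    intro r hr
    have := (hpos r hr).ne'
    have h1 : ContinuousAt (fun r : ℝ => κ * r ^ γ) r :=
      continuousAt_const.mul (continuousAt_rpow_const _ _ (Or.inl this))
    have h2 : ContinuousAt (fun r : ℝ => J / r) r := continuousAt_const.div continuousAt_id this
    exact (h1.prodMk (continuousAt_id.prodMk (continuousAt_id.prodMk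
      (continuousAt_id.prodMk (h2.prodMk continuousAt_const))))).continuousWithinAt
  have hK : IsCompact (c '' R) := hR.image_of_continuousOn hcc
  have hp0 : ∀ r ∈ R, κ * r₀ ^ γ ≤ κ * r ^ γ := fun r hr =>
    mul_le_mul_of_nonneg_left (rpow_le_rpow hr₀.le (hlo r hr) hγ0.le) hκ.le
  have hκr : 0 < κ * r₀ ^ γ := mul_pos hκ (rpow_pos_of_pos hr₀ _)
  obtain ⟨A₁, d₁, hd₁, H₁⟩ := hK.exists_bound_near (f := fun y => y.2.1) (by fun_prop)
  obtain ⟨A₂, d₂, hd₂, H₂⟩ := hK.exists_bound_near (f := fun y => (y.2.1)⁻¹) (by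
    rintro _ ⟨r, hr, rfl⟩
    exact ContinuousAt.inv₀ (by fun_prop) (hpos r hr).ne')
  obtain ⟨A₃, d₃, hd₃, H₃⟩ := hK.exists_bound_near (f := fun y => y.2.2.2.2.1) (by fun_prop)
  obtain ⟨A₄, d₄, hd₄, H₄⟩ := hK.exists_bound_near (f := fun y => (y.2.2.2.2.1)⁻¹) (by
    rintro _ ⟨r, hr, rfl⟩
    exact ContinuousAt.inv₀ (by fun_prop) (div_pos hJ (hpos r hr)).ne')
  obtain ⟨A₅, d₅, hd₅, H₅⟩ := hK.exists_bound_near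
    (f := fun y => log y.1 / γ - log y.2.1) (by
    rintro _ ⟨r, hr, rfl⟩
    have h1 : ContinuousAt (fun y : ℝ × ℝ × ℝ × ℝ × ℝ × ℝ => log y.1) (c r) :=
      ContinuousAt.log (by fun_prop) (hκr.trans_le (hp0 r hr)).ne'
    have h2 : ContinuousAt (fun y : ℝ × ℝ × ℝ × ℝ × ℝ × ℝ => log y.2.1) (c r) :=
      ContinuousAt.log (by fun_prop) (hpos r hr).ne'
    exact (h1.div_const _).sub h2)
  obtain ⟨A₆, d₆, hd₆, H₆⟩ := hK.exists_bound_near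
    (f := fun y => γ * y.1 / ((γ - 1) * y.2.1)) (by
    rintro _ ⟨r, hr, rfl⟩
    exact ContinuousAt.div (by fun_prop) (by fun_prop)
      (mul_pos (sub_pos.2 hγ) (hpos r hr)).ne')
  obtain ⟨d₇, hd₇, H₇⟩ := hK.exists_lower_bound_near (f := fun y => y.1) (by fun_prop) hκr (by
    rintro _ ⟨r, hr, rfl⟩
    exact hp0 r hr)
  obtain ⟨d₈, hd₈, H₈⟩ := hK.exists_lower_bound_near (f := fun y => y.2.1) (by fun_prop) hr₀ (by
    rintro _ ⟨r, hr, rfl⟩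
    exact hlo r hr)
  have hJR : ∀ r ∈ R, J / (|R₁| + 1) ≤ J / r := fun r hr => by
    have := hR₁ hr
    rw [mem_closedBall, dist_zero_right, Real.norm_eq_abs] at this
    refine div_le_div_of_nonneg_left hJ.le (hpos r hr) ?_
    linarith [le_abs_self r, le_abs_self R₁]
  obtain ⟨d₉, hd₉, H₉⟩ := hK.exists_lower_bound_near (f := fun y => y.2.2.2.2.1) (by fun_prop)
    (show 0 < J / (|R₁| + 1) by positivity) (by
    rintro _ ⟨r, hr, rfl⟩
    exact hJR r hr)
  obtain ⟨d₀, hd₀, H₀⟩ := hK.exists_lower_bound_near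
    (f := fun y => γ * (y.1 / y.2.1 ^ γ) * y.2.2.1 ^ (γ - 2) * y.2.2.2.1 -
      (y.2.2.2.2.1 ^ 2 + y.2.2.2.2.2 ^ 2)) (by
    rintro _ ⟨r, hr, rfl⟩
    have h0 := (hpos r hr).ne'
    have h1 : ContinuousAt (fun y : ℝ × ℝ × ℝ × ℝ × ℝ × ℝ => y.2.1 ^ γ) (c r) :=
      ContinuousAt.rpow_const (by fun_prop) (Or.inl h0)
    have h2 : ContinuousAt (fun y : ℝ × ℝ × ℝ × ℝ × ℝ × ℝ => y.2.2.1 ^ (γ - 2)) (c r) :=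
      ContinuousAt.rpow_const (by fun_prop) (Or.inl h0)
    have h3 : ContinuousAt (fun y : ℝ × ℝ × ℝ × ℝ × ℝ × ℝ => y.1 / y.2.1 ^ γ) (c r) :=
      ContinuousAt.div (by fun_prop) h1 (rpow_pos_of_pos (hpos r hr) _).ne'
    have h4 : ContinuousAt (fun y : ℝ × ℝ × ℝ × ℝ × ℝ × ℝ => y.2.2.2.1) (c r) := by fun_prop
    have h5 : ContinuousAt (fun y : ℝ × ℝ × ℝ × ℝ × ℝ × ℝ =>
      y.2.2.2.2.1 ^ 2 + y.2.2.2.2.2 ^ 2) (c r) := by fun_prop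
    exact (((continuousAt_const.mul h3).mul h2).mul h4).sub h5) hν (by
    rintro _ ⟨r, hr, rfl⟩
    refine (hsub r hr).trans_eq ?_
    have h0 := hpos r hr
    have e : r ^ (γ - 1) = r ^ (γ - 2) * r := by
      rw [← rpow_add_one h0.ne']; congr 1; ring
    simp only [hc]
    rw [mul_div_assoc, div_self (rpow_pos_of_pos h0 _).ne', e, div_pow]
    ring)
  have hM : ∃ M : ℝ, 1 ≤ M ∧ A₁ ≤ M ∧ A₂ ≤ M ∧ A₃ ≤ M ∧ A₄ ≤ M ∧ A₅ ≤ M ∧ A₆ ≤ M := by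
    refine ⟨1 + |A₁| + |A₂| + |A₃| + |A₄| + |A₅| + |A₆|, ?_⟩
    have := abs_nonneg A₁; have := abs_nonneg A₂; have := abs_nonneg A₃
    have := abs_nonneg A₄; have := abs_nonneg A₅; have := abs_nonneg A₆
    have := le_abs_self A₁; have := le_abs_self A₂; have := le_abs_self A₃
    have := le_abs_self A₄; have := le_abs_self A₅; have := le_abs_self A₆
    refine ⟨?_, ?_, ?_, ?_, ?_, ?_, ?_⟩ <;> linarith
  obtain ⟨M, hM1, m₁, m₂, m₃, m₄, m₅, m₆⟩ := hM
  have hδ : ∃ δ : ℝ, 0 < δ ∧ δ ≤ d₁ ∧ δ ≤ d₂ ∧ δ ≤ d₃ ∧ δ ≤ d₄ ∧ δ ≤ d₅ ∧ δ ≤ d₆ ∧ δ ≤ d₇ ∧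
      δ ≤ d₈ ∧ δ ≤ d₉ ∧ δ ≤ d₀ :=
    ⟨min d₁ (min d₂ (min d₃ (min d₄ (min d₅ (min d₆ (min d₇ (min d₈ (min d₉ d₀)))))))),
      by positivity, by simp⟩
  obtain ⟨δ, hδ0, l₁, l₂, l₃, l₄, l₅, l₆, l₇, l₈, l₉, l₀⟩ := hδ
  refine ⟨M, min 1 (ν / 2), δ, hM1, by positivity, min_le_left _ _, hδ0, ?_⟩
  intro r hr p ρ ξ ρm u v hp hρ hξ hρm hu hv
  have hd : dist (p, ρ, ξ, ρm, u, v) (c r) < δ := by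
    simp only [hc, Prod.dist_eq, Real.dist_eq, sub_zero, max_lt_iff]
    exact ⟨hp, hρ, hξ, hρm, hu, hv⟩
  have hcr : c r ∈ c '' R := mem_image_of_mem _ hr
  have q₁ := H₁ _ hcr _ (hd.trans_le l₁)
  have q₂ := H₂ _ hcr _ (hd.trans_le l₂)
  have q₃ := H₃ _ hcr _ (hd.trans_le l₃)
  have q₄ := H₄ _ hcr _ (hd.trans_le l₄)
  have q₅ := H₅ _ hcr _ (hd.trans_le l₅)
  have q₆ := H₆ _ hcr _ (hd.trans_le l₆)
  have q₇ := H₇ _ hcr _ (hd.trans_le l₇)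
  have q₈ := H₈ _ hcr _ (hd.trans_le l₈)
  have q₉ := H₉ _ hcr _ (hd.trans_le l₉)
  have q₀ := H₀ _ hcr _ (hd.trans_le l₀)
  simp only at q₁ q₂ q₃ q₄ q₅ q₆ q₇ q₈ q₉ q₀
  have hρ0 : 0 < ρ := (half_pos hr₀).trans_le q₈
  have hu0 : 0 < u := (by positivity : 0 < J / (|R₁| + 1) / 2).trans_le q₉
  have hM0 : 0 < M := one_pos.trans_le hM1
  have inv_le : ∀ {a A : ℝ}, 0 < a → |a⁻¹| ≤ A → A ≤ M → M⁻¹ ≤ a := fun ha h hA =>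
    inv_le_of_inv_le₀ ha ((le_abs_self _).trans (h.trans hA))
  exact ⟨(half_pos hκr).trans_le q₇, ⟨inv_le hρ0 q₂ m₂, (le_abs_self _).trans (q₁.trans m₁)⟩,
    ⟨inv_le hu0 q₄ m₄, (le_abs_self _).trans (q₃.trans m₃)⟩, q₅.trans m₅, q₆.trans m₆,
    (min_le_right _ _).trans q₀⟩

/-! ### Euler–Poisson solutions as flows -/

theorem UpTo.contDiffAt {m : ℕ} {f : Pt → ℝ} {K : Set Pt} (h : UpTo m f K) {x : Pt} (hx : x ∈ K) :
    ContDiffAt ℝ m f x := by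
  obtain ⟨U, hU, hKU, hf⟩ := h
  exact hf.contDiffAt (hU.mem_nhds (hKU hx))

theorem UpTo.C1R {L : ℝ} (hL : 0 < L) {f : Pt → ℝ} (h : UpTo 1 f (closure (Noz L))) : C1R L f := by
  intro x hx
  rw [← closure_Noz hL] at hx
  exact h.contDiffAt hx

theorem C1R.log {L : ℝ} {f : Pt → ℝ} (hf : C1R L f) (h0 : ∀ x ∈ Rect L, f x ≠ 0) :
    C1R L (fun x => Real.log (f x)) := fun x hx => (hf x hx).log (h0 x hx)

theorem fderiv_log_apply {f : Pt → ℝ} {x : Pt} (hf : DifferentiableAt ℝ f x) (h0 : f x ≠ 0)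
    (e : Pt) : fderiv ℝ (fun y => Real.log (f y)) x e = (f x)⁻¹ * fderiv ℝ f x e := by
  rw [fderiv.log hf h0]; simp

/-- the thermodynamic fields of a flow -/
def flowFields (γ : ℝ) (ρ u v p Φ : Pt → ℝ) : Fields where
  ρ := ρ
  u := u
  v := v
  h x := γ * p x / ((γ - 1) * ρ x)
  s x := Real.log (p x) / γ - Real.log (ρ x)
  K x := BernFn γ ρ u v p x - Φ x
  Φ := Φ

theorem gibbs_algebra {γ p ρ dp dρ : ℝ} (hγ : γ ≠ 0) (hγ1 : γ - 1 ≠ 0) (hp : p ≠ 0) (hρ : ρ ≠ 0) :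
    γ / (γ - 1) * (p * (-(ρ⁻¹) ^ 2 * dρ) + ρ⁻¹ * dp) -
      γ * p / ((γ - 1) * ρ) * (γ⁻¹ * (p⁻¹ * dp) - ρ⁻¹ * dρ) = ρ⁻¹ * dp := by
  field_simp
  ring

section gibbs

variable {γ : ℝ} {ρ u v p Φ : Pt → ℝ} {x : Pt}

theorem gibbs (hγ : 1 < γ) (hρ : DifferentiableAt ℝ ρ x) (hp : DifferentiableAt ℝ p x)
    (hρ0 : 0 < ρ x) (hp0 : 0 < p x) (e : Pt) :
    fderiv ℝ (flowFields γ ρ u v p Φ).h x e -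
      (flowFields γ ρ u v p Φ).h x * fderiv ℝ (flowFields γ ρ u v p Φ).s x e =
      (ρ x)⁻¹ * fderiv ℝ p x e := by
  have hi : DifferentiableAt ℝ (fun y => (ρ y)⁻¹) x := hρ.inv hρ0.ne'
  have hei : fderiv ℝ (fun y => (ρ y)⁻¹) x e = -((ρ x)⁻¹) ^ 2 * fderiv ℝ ρ x e := by
    have h := ((hasDerivAt_inv hρ0.ne').comp_hasFDerivAt x hρ.hasFDerivAt).fderiv
    simp only [Function.comp_def] at h
    rw [h]; simp
  have hpi : DifferentiableAt ℝ (fun y => p y * (ρ y)⁻¹) x := hp.mul hi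
  have e1 : (flowFields γ ρ u v p Φ).h = fun y => γ / (γ - 1) * (p y * (ρ y)⁻¹) := by
    funext y
    simp only [flowFields, div_eq_mul_inv, mul_inv]
    ring
  have e2 : (flowFields γ ρ u v p Φ).s =
      fun y => γ⁻¹ * Real.log (p y) - Real.log (ρ y) := by
    funext y
    simp only [flowFields, div_eq_mul_inv]
    ring
  have d1 : fderiv ℝ (flowFields γ ρ u v p Φ).h x e = γ / (γ - 1) *
      (p x * (-((ρ x)⁻¹) ^ 2 * fderiv ℝ ρ x e) + (ρ x)⁻¹ * fderiv ℝ p x e) := by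
    rw [e1, fderiv_const_mul hpi, ← hei, ← fderiv_mul_apply' hp hi]
    rfl
  have hlp : DifferentiableAt ℝ (fun y => Real.log (p y)) x := hp.log hp0.ne'
  have hlρ : DifferentiableAt ℝ (fun y => Real.log (ρ y)) x := hρ.log hρ0.ne'
  have d2 : fderiv ℝ (flowFields γ ρ u v p Φ).s x e =
      γ⁻¹ * ((p x)⁻¹ * fderiv ℝ p x e) - (ρ x)⁻¹ * fderiv ℝ ρ x e := by
    rw [e2, fderiv_fun_sub (hlp.const_mul _) hlρ, fderiv_const_mul hlp,
      ← fderiv_log_apply hp hp0.ne', ← fderiv_log_apply hρ hρ0.ne']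
    rfl
  rw [d1, d2]
  exact gibbs_algebra (by linarith) (by linarith) hp0.ne' hρ0.ne'

theorem flowFields_p (hγ : 1 < γ) (hρ0 : 0 < ρ x) (hp0 : 0 < p x) :
    exp (γ * (flowFields γ ρ u v p Φ).s x) * ρ x ^ γ = p x := by
  have hγ0 : γ ≠ 0 := by linarith
  have : γ * (flowFields γ ρ u v p Φ).s x = Real.log (p x) - Real.log (ρ x) * γ := by
    simp only [flowFields]; field_simp
  rw [this, exp_sub, exp_log hp0, ← rpow_def_of_pos hρ0]
  exact div_mul_cancel₀ _ (rpow_pos_of_pos hρ0 _).ne'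

theorem flowFields_h (hγ : 1 < γ) (hρ0 : 0 < ρ x) (hp0 : 0 < p x) :
    (flowFields γ ρ u v p Φ).h x = enth γ ((flowFields γ ρ u v p Φ).s x) (ρ x) := by
  have h := flowFields_p (u := u) (v := v) (Φ := Φ) hγ hρ0 hp0
  have e : ρ x ^ γ = ρ x ^ (γ - 1) * ρ x := by
    rw [← rpow_add_one hρ0.ne']; congr 1; ring
  rw [e] at h
  have hγ1 : γ - 1 ≠ 0 := by linarith
  change γ * p x / ((γ - 1) * ρ x) = _
  rw [enth, ← h]
  field_simp

end gibbs

theorem euler_algebra {r r1 r2 u u1 u2 v v1 v2 p1 p2 h h1 h2 s1 s2 F1 F2 K1 K2 : ℝ} (hr : r ≠ 0)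
    (hh : h ≠ 0) (mass : r * u1 + u * r1 + (r * v2 + v * r2) = 0)
    (mom1 : u * (r * u1 + u * r1 + (r * v2 + v * r2)) + r * (u * u1 + v * u2) + p1 = r * F1)
    (mom2 : v * (r * u1 + u * r1 + (r * v2 + v * r2)) + r * (u * v1 + v * v2) + p2 = r * F2)
    (g1 : h1 - h * s1 = r⁻¹ * p1) (g2 : h2 - h * s2 = r⁻¹ * p2)
    (k1 : K1 = u * u1 + v * v1 + h1 - F1) (k2 : K2 = u * u2 + v * v2 + h2 - F2)
    (energy : r * (u * (K1 + F1) + v * (K2 + F2)) = r * (u * F1 + v * F2)) :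
    u * K1 + v * K2 = 0 ∧ u * s1 + v * s2 = 0 ∧ u * (v1 - u2) = h * s2 - K2 := by
  have hK : u * K1 + v * K2 = 0 := by
    have := mul_left_cancel₀ hr energy
    linarith
  have q1 : u * u1 + v * u2 + r⁻¹ * p1 = F1 := by
    rw [mass] at mom1
    field_simp
    linarith
  have q2 : u * v1 + v * v2 + r⁻¹ * p2 = F2 := by
    rw [mass] at mom2
    field_simp
    linarith
  refine ⟨hK, ?_, by rw [k2]; linear_combination g2 + q2⟩
  refine mul_left_cancel₀ hh ?_
  rw [k1, k2] at hK
  linear_combination hK - u * g1 - v * g2 - u * q1 - v * q2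

section

variable {γ 𝔭 cv L : ℝ} {b : Pt → ℝ} {Sen Ben Φbd0 ΦbdL pex : ℝ → ℝ} {ρ u v p Φ : Pt → ℝ}

theorem EPSol.euler (hγ : 1 < γ) (hL : 0 < L)
    (h : EPSol γ 𝔭 cv L b Sen Ben Φbd0 ΦbdL pex ρ u v p Φ) (hp : ∀ x ∈ Rect L, 0 < p x) :
    (C1R L (flowFields γ ρ u v p Φ).h ∧ C1R L (flowFields γ ρ u v p Φ).s ∧
      C1R L (flowFields γ ρ u v p Φ).K) ∧ ∀ x ∈ Rect L,
      u x * pd1 (flowFields γ ρ u v p Φ).K x + v x * pd2 (flowFields γ ρ u v p Φ).K x = 0 ∧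
      u x * pd1 (flowFields γ ρ u v p Φ).s x + v x * pd2 (flowFields γ ρ u v p Φ).s x = 0 ∧
      u x * (pd1 v x - pd2 u x) = (flowFields γ ρ u v p Φ).h x *
        pd2 (flowFields γ ρ u v p Φ).s x - pd2 (flowFields γ ρ u v p Φ).K x := by
  obtain ⟨hρ, hu, hv, hpc, hΦ, hpos, heq, -, -, -⟩ := h
  rw [closure_Noz hL] at hpos
  replace hρ := hρ.C1R hL
  replace hu := hu.C1R hL
  replace hv := hv.C1R hL
  replace hpc := hpc.C1R hL
  have hΦ1 : C1R L Φ := fun x hx =>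
    (hΦ.contDiffAt (by rwa [closure_Noz hL])).of_le (by norm_num)
  have hρ0 : ∀ x ∈ Rect L, ρ x ≠ 0 := fun x hx => (hpos x hx).1.ne'
  have hp0 : ∀ x ∈ Rect L, p x ≠ 0 := fun x hx => (hp x hx).ne'
  have ch : C1R L (flowFields γ ρ u v p Φ).h := by
    have := (C1R.const (γ / (γ - 1))).mul (hpc.mul (hρ.inv hρ0))
    refine fun x hx => (this x hx).congr_of_eventuallyEq (Filter.Eventually.of_forall fun y => ?_)
    simp only [flowFields, div_eq_mul_inv, mul_inv]
    ring
  have cs : C1R L (flowFields γ ρ u v p Φ).s := by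
    have := ((C1R.const γ⁻¹).mul (hpc.log hp0)).sub (hρ.log hρ0)
    refine fun x hx => (this x hx).congr_of_eventuallyEq (Filter.Eventually.of_forall fun y => ?_)
    simp only [flowFields, div_eq_mul_inv]
    ring
  have cK' := (((C1R.const (2⁻¹)).mul ((hu.pow 2).add (hv.pow 2))).add ch).sub hΦ1
  have eK : (flowFields γ ρ u v p Φ).K = fun x => 2⁻¹ * (u x ^ 2 + v x ^ 2) +
      (flowFields γ ρ u v p Φ).h x - Φ x := by
    funext y
    simp only [flowFields, BernFn]
    ring
  have cK : C1R L (flowFields γ ρ u v p Φ).K := by rw [eK]; exact cK'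
  refine ⟨⟨ch, cs, cK⟩, ?_⟩
  have key : ∀ x ∈ Noz L,
      u x * pd1 (flowFields γ ρ u v p Φ).K x + v x * pd2 (flowFields γ ρ u v p Φ).K x = 0 ∧
      u x * pd1 (flowFields γ ρ u v p Φ).s x + v x * pd2 (flowFields γ ρ u v p Φ).s x = 0 ∧
      u x * (pd1 v x - pd2 u x) = (flowFields γ ρ u v p Φ).h x *
        pd2 (flowFields γ ρ u v p Φ).s x - pd2 (flowFields γ ρ u v p Φ).K x := by
    intro x hx
    have hxR := Noz_subset_Rect L hx
    obtain ⟨mass, mom1, mom2, energy, -⟩ := heq x hx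
    have dρ := hρ.differentiableAt hxR
    have du := hu.differentiableAt hxR
    have dv := hv.differentiableAt hxR
    have dp := hpc.differentiableAt hxR
    have dΦ := hΦ1.differentiableAt hxR
    have dh := ch.differentiableAt hxR
    have dK := cK.differentiableAt hxR
    have dρu := (hρ.mul hu).differentiableAt hxR
    have dρv := (hρ.mul hv).differentiableAt hxR
    have du2 := (hu.pow 2).differentiableAt hxR
    have dv2 := (hv.pow 2).differentiableAt hxR
    have dB : DifferentiableAt ℝ (fun y => (flowFields γ ρ u v p Φ).K y + Φ y) x :=
      (cK.add hΦ1).differentiableAt hxR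
    have eB : BernFn γ ρ u v p = fun y => (flowFields γ ρ u v p Φ).K y + Φ y := by
      funext y; simp [flowFields]
    have duv := ((hu.pow 2).add (hv.pow 2)).differentiableAt hxR
    have dq := ((C1R.const (L := L) (2⁻¹)).mul ((hu.pow 2).add (hv.pow 2))).differentiableAt hxR
    have dqh := (((C1R.const (2⁻¹)).mul ((hu.pow 2).add (hv.pow 2))).add ch).differentiableAt hxR
    have dc : DifferentiableAt ℝ (fun _ : Pt => (2⁻¹ : ℝ)) x := differentiableAt_const _
    have zc1 : pd1 (fun _ : Pt => (2⁻¹ : ℝ)) x = 0 := by simp [pd1]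
    have zc2 : pd2 (fun _ : Pt => (2⁻¹ : ℝ)) x = 0 := by simp [pd2]
    have k1 : pd1 (flowFields γ ρ u v p Φ).K x = u x * pd1 u x + v x * pd1 v x +
        pd1 (flowFields γ ρ u v p Φ).h x - pd1 Φ x := by
      rw [eK, pd1_sub dqh dΦ, pd1_add dq dh, pd1_mul dc duv, pd1_add du2 dv2,
        pd1_pow du, pd1_pow dv, zc1]
      push_cast; ring
    have k2 : pd2 (flowFields γ ρ u v p Φ).K x = u x * pd2 u x + v x * pd2 v x +
        pd2 (flowFields γ ρ u v p Φ).h x - pd2 Φ x := by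
      rw [eK, pd2_sub dqh dΦ, pd2_add dq dh, pd2_mul dc duv, pd2_add du2 dv2,
        pd2_pow du, pd2_pow dv, zc2]
      push_cast; ring
    rw [pd1_mul dρ du, pd2_mul dρ dv] at mass
    rw [eB, pd1_mul dρu dB, pd2_mul dρv dB, pd1_add dK dΦ, pd2_add dK dΦ, pd1_mul dρ du,
      pd2_mul dρ dv] at energy
    have dρu2 := (hρ.mul (hu.pow 2)).differentiableAt hxR
    have dρv2 := (hρ.mul (hv.pow 2)).differentiableAt hxR
    rw [pd1_add dρu2 dp, pd1_mul dρ du2, pd1_pow du, pd2_mul dρu dv, pd2_mul dρ du] at mom1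
    rw [pd2_add dρv2 dp, pd2_mul dρ dv2, pd2_pow dv, pd1_mul dρu dv, pd1_mul dρ du] at mom2
    have hh : (flowFields γ ρ u v p Φ).h x ≠ 0 := by
      have h1 := hp x hxR
      have h2 := (hpos x hxR).1
      have h3 : 0 < γ - 1 := sub_pos.2 hγ
      simp only [flowFields]
      positivity
    refine euler_algebra (p1 := pd1 p x) (p2 := pd2 p x) (hρ0 x hxR) hh mass ?_ ?_
      (gibbs hγ dρ dp (hpos x hxR).1 (hp x hxR) (1, 0))
      (gibbs hγ dρ dp (hpos x hxR).1 (hp x hxR) (0, 1)) k1 k2 ?_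
    · push_cast at mom1; linear_combination mom1
    · push_cast at mom2; linear_combination mom2
    · linear_combination energy - ((flowFields γ ρ u v p Φ).K x + Φ x) * mass
  have cu := hu.continuousOn
  have cv' := hv.continuousOn
  have z : ContinuousOn (fun _ : Pt => (0:ℝ)) (Rect L) := continuousOn_const
  intro x hx
  refine ⟨eq_on_Rect hL ((cu.mul cK.continuousOn_pd1).add (cv'.mul cK.continuousOn_pd2)) z
    (fun y hy => (key y hy).1) x hx,
    eq_on_Rect hL ((cu.mul cs.continuousOn_pd1).add (cv'.mul cs.continuousOn_pd2)) z
    (fun y hy => (key y hy).2.1) x hx,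
    eq_on_Rect hL (cu.mul (hv.continuousOn_pd1.sub hu.continuousOn_pd2))
    ((ch.continuousOn.mul cs.continuousOn_pd2).sub cK.continuousOn_pd2)
    (fun y hy => (key y hy).2.2) x hx⟩

theorem EPSol.v_wall (hL : 0 < L)
    (h : EPSol γ 𝔭 cv L b Sen Ben Φbd0 ΦbdL pex ρ u v p Φ) {c : ℝ} (hc : c = 0 ∨ c = 1) :
    ∀ t ∈ Icc 0 L, v (t, c) = 0 := by
  obtain ⟨-, -, hv, -, -, -, -, -, -, hw⟩ := h
  replace hv := hv.C1R hL
  have hcI : c ∈ Icc (0:ℝ) 1 := by rcases hc with rfl | rfl <;> simp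
  have cont := hv.continuousOn.slice_snd hcI
  intro t ht
  rw [← closure_Ioo hL.ne] at ht cont
  have hz : EqOn (fun t => v (t, c)) (fun _ => 0) (Ioo 0 L) := fun s hs => (hw (s, c) ⟨hs, hc⟩).1
  exact hz.of_subset_closure cont continuousOn_const subset_closure le_rfl ht

end

/-! ### pointwise bounds from the weighted Hölder estimate -/

theorem exists_abs_deriv_le_of_contDiffOn {L : ℝ} (hL : 0 < L) {g : ℝ → ℝ}
    (hg : ContDiffOn ℝ 1 g (Icc 0 L)) :
    ∃ A, ∀ t ∈ Ioo 0 L, HasDerivAt g (deriv g t) t ∧ |deriv g t| ≤ A := by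
  obtain ⟨A, hA⟩ := isCompact_Icc.exists_bound_of_continuousOn
    (hg.continuousOn_derivWithin (uniqueDiffOn_Icc hL) le_rfl)
  refine ⟨A, fun t ht => ?_⟩
  have hn : Icc 0 L ∈ nhds t := Icc_mem_nhds ht.1 ht.2
  refine ⟨((hg.differentiableOn one_ne_zero).differentiableAt hn).hasDerivAt, ?_⟩
  rw [← derivWithin_of_mem_nhds hn]
  exact hA t (Ioo_subset_Icc_self ht)

theorem hasDerivAt_integral_of_continuousOn {L : ℝ} {E : ℝ → ℝ} (hE : ContinuousOn E (Icc 0 L))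
    {t : ℝ} (ht : t ∈ Ioo 0 L) : HasDerivAt (fun y => ∫ s in (0:ℝ)..y, E s) (E t) t := by
  have hn : Icc 0 L ∈ nhds t := Icc_mem_nhds ht.1 ht.2
  refine intervalIntegral.integral_hasDerivAt_right ?_ ?_ (hE.continuousAt hn)
  · refine (hE.mono ?_).intervalIntegrable
    rw [uIcc_of_le ht.1.le]
    exact Icc_subset_Icc_right ht.2.le
  · exact (hE.mono Ioo_subset_Icc_self).stronglyMeasurableAtFilter isOpen_Ioo t ht

theorem hasFDerivAt_comp_fst {g : ℝ → ℝ} {g' : ℝ} {x : Pt} (hg : HasDerivAt g g' x.1) :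
    HasFDerivAt (fun y : Pt => g y.1) (g' • ContinuousLinearMap.fst ℝ ℝ ℝ) x :=
  hg.comp_hasFDerivAt x hasFDerivAt_fst

theorem pd1_sub_comp_fst {f : Pt → ℝ} {g : ℝ → ℝ} {g' : ℝ} {x : Pt} (hf : DifferentiableAt ℝ f x)
    (hg : HasDerivAt g g' x.1) : pd1 (fun y => f y - g y.1) x = pd1 f x - g' := by
  have h := hasFDerivAt_comp_fst hg
  rw [pd1_sub hf h.differentiableAt]
  simp only [pd1, h.fderiv]
  simp

theorem pd2_sub_comp_fst {f : Pt → ℝ} {g : ℝ → ℝ} {g' : ℝ} {x : Pt} (hf : DifferentiableAt ℝ f x)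
    (hg : HasDerivAt g g' x.1) : pd2 (fun y => f y - g y.1) x = pd2 f x := by
  have h := hasFDerivAt_comp_fst hg
  rw [pd2_sub hf h.differentiableAt]
  simp only [pd2, h.fderiv]
  simp

/-- distance to the walls at height `y` -/
def wallDist (y : ℝ) : ℝ := min y (1 - y)

theorem wallDist_pos {y : ℝ} (hy : y ∈ Ioo (0:ℝ) 1) : 0 < wallDist y :=
  lt_min hy.1 (by linarith [hy.2])

theorem wallDist_le_one {y : ℝ} (hy : y ∈ Ioo (0:ℝ) 1) : wallDist y ≤ 1 :=
  (min_le_left _ _).trans hy.2.le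

theorem one_le_wallDist_rpow {y α : ℝ} (hy : y ∈ Ioo (0:ℝ) 1) (hα : α < 1) :
    1 ≤ wallDist y ^ (α - 1) :=
  one_le_rpow_of_pos_of_le_one_of_nonpos (wallDist_pos hy) (wallDist_le_one hy) (by linarith)

theorem bounds_of_whNorm_sub {L α δ A : ℝ} {f : Pt → ℝ} {g : ℝ → ℝ} (hL : 0 < L)
    (hα : α ∈ Ioo (0:ℝ) 1) (hδ : 0 ≤ δ) (hA : 0 ≤ A) (hf : C1R L f)
    (hg : ∀ t ∈ Ioo 0 L, HasDerivAt g (deriv g t) t ∧ |deriv g t| ≤ A)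
    (h : whNorm 1 α (-α) (GamWbar L) (Noz L) (fun x => f x - g x.1) ≤ ENNReal.ofReal δ) :
    ∀ x ∈ Noz L, |f x - g x.1| ≤ δ ∧ |pd1 f x| ≤ (δ + A) * wallDist x.2 ^ (α - 1) ∧
      |pd2 f x| ≤ δ * wallDist x.2 ^ (α - 1) := by
  intro x hx
  obtain ⟨b0, b1, b2⟩ := bounds_of_whNorm_one hα hδ h x hx
  have df := hf.differentiableAt (Noz_subset_Rect L hx)
  obtain ⟨hg1, hg2⟩ := hg x.1 hx.1
  rw [pd1_sub_comp_fst df hg1] at b1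
  rw [pd2_sub_comp_fst df hg1] at b2
  have c1 := le_rpow_of_weighted hα.2 (wallDist_pos hx.2) (min_le_infDist_GamWbar hL x)
    (abs_nonneg _) b1
  have c2 := le_rpow_of_weighted hα.2 (wallDist_pos hx.2) (min_le_infDist_GamWbar hL x)
    (abs_nonneg _) b2
  refine ⟨b0, ?_, c2⟩
  have := one_le_wallDist_rpow hx.2 hα.2
  have e := abs_sub_abs_le_abs_sub (pd1 f x) (deriv g x.1)
  nlinarith

theorem abs_le_wallDist_rpow {L α A : ℝ} {v : Pt → ℝ} (hα : 0 < α) (hv : C1R L v)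
    (hw0 : ∀ t ∈ Icc 0 L, v (t, 0) = 0) (hw1 : ∀ t ∈ Icc 0 L, v (t, 1) = 0)
    (hb : ∀ x ∈ Noz L, |pd2 v x| ≤ A * wallDist x.2 ^ (α - 1)) :
    ∀ x ∈ Noz L, |v x| ≤ A / α * wallDist x.2 ^ α := by
  rintro ⟨a, y⟩ ⟨ha, hy⟩
  have ha' : a ∈ Icc 0 L := Ioo_subset_Icc_self ha
  have cont := hv.continuousOn.slice_fst ha'
  have lo : ∀ t ∈ Icc (0:ℝ) (1 / 2), |v (a, t)| ≤ A / α * t ^ α := by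
    refine abs_le_rpow_of_deriv (f' := fun t => pd2 v (a, t)) hα
      (cont.mono (Icc_subset_Icc_right (by norm_num))) (fun t ht => ?_) (fun t ht => ?_) (hw0 a ha')
    · exact hasDerivAt_snd (x := (a, t))
        (hv.differentiableAt (mem_Rect ha' ⟨ht.1.le, by linarith [ht.2]⟩))
    · have := hb (a, t) ⟨ha, ht.1, by linarith [ht.2]⟩
      rwa [wallDist, min_eq_left (by linarith [ht.2])] at this
  have hi : ∀ t ∈ Icc (0:ℝ) (1 / 2), |v (a, 1 - t)| ≤ A / α * t ^ α := by
    refine abs_le_rpow_of_deriv (f := fun t => v (a, 1 - t)) (f' := fun t => -pd2 v (a, 1 - t)) hα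
      ?_ (fun t ht => ?_) (fun t ht => ?_) (by simpa using hw1 a ha')
    · refine cont.comp (by fun_prop) fun t ht => ⟨by linarith [ht.2], by linarith [ht.1]⟩
    · have h1 : HasDerivAt (fun s => v (a, s)) (pd2 v (a, 1 - t)) (1 - t) :=
        hasDerivAt_snd (x := (a, 1 - t))
          (hv.differentiableAt (mem_Rect ha' ⟨by linarith [ht.2], by linarith [ht.1]⟩))
      have h2 : HasDerivAt (fun s : ℝ => 1 - s) (-1) t := by
        simpa using (hasDerivAt_id t).const_sub 1
      exact (h1.comp t h2).congr_deriv (by ring)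
    · have := hb (a, 1 - t) ⟨ha, by linarith [ht.2], by linarith [ht.1]⟩
      rw [wallDist, min_eq_right (by simp only; linarith [ht.2])] at this
      simpa using this
  rcases le_total y (1 / 2) with h | h
  · have := lo y ⟨hy.1.le, h⟩
    rwa [wallDist, min_eq_left (by simp only; linarith)]
  · have := hi (1 - y) ⟨by linarith [hy.2], by linarith⟩
    rw [wallDist, min_eq_right (by simp only; linarith)]
    simpa using this

theorem abs_mul_le_of_wallDist {y α a b A B : ℝ} (hα : 1 / 2 < α) (hy : y ∈ Ioo (0:ℝ) 1)
    (hA : 0 ≤ A) (hB : 0 ≤ B) (ha : |a| ≤ A * wallDist y ^ α)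
    (hb : |b| ≤ B * wallDist y ^ (α - 1)) : |a * b| ≤ A * B := by
  have hd := wallDist_pos hy
  rw [abs_mul]
  refine (mul_le_mul ha hb (abs_nonneg _) (by positivity)).trans ?_
  have e : wallDist y ^ α * wallDist y ^ (α - 1) ≤ 1 := by
    rw [← rpow_add hd]
    exact rpow_le_one hd.le (wallDist_le_one hy) (by linarith)
  calc A * wallDist y ^ α * (B * wallDist y ^ (α - 1))
      = A * B * (wallDist y ^ α * wallDist y ^ (α - 1)) := by ring
    _ ≤ A * B * 1 := mul_le_mul_of_nonneg_left e (by positivity)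
    _ = A * B := mul_one _

/-- pointwise closeness of a flow to the background flow -/
structure CloseTo (L α κ γ J δ A : ℝ) (ρb : ℝ → ℝ) (ρ u v p Φ : Pt → ℝ) : Prop where
  ρ_c : ∀ x ∈ Rect L, |ρ x - ρb x.1| ≤ δ
  u_c : ∀ x ∈ Rect L, |u x - J / ρb x.1| ≤ δ
  v_c : ∀ x ∈ Rect L, |v x| ≤ δ
  p_c : ∀ x ∈ Rect L, |p x - κ * ρb x.1 ^ γ| ≤ δ
  ρ₂ : ∀ x ∈ Noz L, |pd2 ρ x| ≤ δ * wallDist x.2 ^ (α - 1)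
  u₁ : ∀ x ∈ Noz L, |pd1 u x| ≤ (δ + A) * wallDist x.2 ^ (α - 1)
  u₂ : ∀ x ∈ Noz L, |pd2 u x| ≤ δ * wallDist x.2 ^ (α - 1)
  v₁ : ∀ x ∈ Noz L, |pd1 v x| ≤ δ * wallDist x.2 ^ (α - 1)
  v₂ : ∀ x ∈ Noz L, |pd2 v x| ≤ δ * wallDist x.2 ^ (α - 1)
  Φ₁ : ∀ x ∈ Rect L, |pd1 Φ x| ≤ δ + A
  Φ₂ : ∀ x ∈ Rect L, |pd2 Φ x| ≤ δ

theorem exists_background_deriv_bound {γ 𝔭 cv b₀ J₀ S₀ E₀ ρ₀ L ν₀ ρlow ρhigh : ℝ} {ρb Eb : ℝ → ℝ}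
    (hbg : Background γ 𝔭 cv b₀ J₀ S₀ E₀ ρ₀ L ν₀ ρlow ρhigh ρb Eb) :
    ∃ A : ℝ, 0 ≤ A ∧ (∀ t ∈ Ioo 0 L, HasDerivAt ρb (deriv ρb t) t ∧ |deriv ρb t| ≤ A) ∧
      (∀ t ∈ Ioo 0 L, HasDerivAt (fun t => J₀ / ρb t) (deriv (fun t => J₀ / ρb t) t) t ∧
        |deriv (fun t => J₀ / ρb t) t| ≤ A) ∧ ∀ t ∈ Ioo 0 L, |Eb t| ≤ A := by
  have hρ0 : ∀ t ∈ Icc 0 L, ρb t ≠ 0 := fun t ht => (hbg.hρlow.trans_le (hbg.bound_lo t ht)).ne'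
  have c1 : ContDiffOn ℝ 1 ρb (Icc 0 L) := hbg.smooth_rho.of_le (by exact_mod_cast le_top)
  have c2 : ContDiffOn ℝ 1 (fun t => J₀ / ρb t) (Icc 0 L) := contDiffOn_const.div c1 hρ0
  obtain ⟨A₁, h₁⟩ := exists_abs_deriv_le_of_contDiffOn hbg.hL c1
  obtain ⟨A₂, h₂⟩ := exists_abs_deriv_le_of_contDiffOn hbg.hL c2
  obtain ⟨A₃, h₃⟩ := isCompact_Icc.exists_bound_of_continuousOn hbg.smooth_E.continuousOn
  refine ⟨|A₁| + |A₂| + |A₃|, by positivity, fun t ht => ⟨(h₁ t ht).1, ?_⟩,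
    fun t ht => ⟨(h₂ t ht).1, ?_⟩, fun t ht => ?_⟩
  · have := (h₁ t ht).2
    linarith [le_abs_self A₁, abs_nonneg A₂, abs_nonneg A₃]
  · have := (h₂ t ht).2
    linarith [le_abs_self A₂, abs_nonneg A₁, abs_nonneg A₃]
  · have := h₃ t (Ioo_subset_Icc_self ht)
    rw [Real.norm_eq_abs] at this
    linarith [le_abs_self A₃, abs_nonneg A₁, abs_nonneg A₂]

theorem EPEst.closeTo {γ 𝔭 cv b₀ J₀ S₀ E₀ ρ₀ L ν₀ ρlow ρhigh α C σ A : ℝ} {ρb Eb : ℝ → ℝ}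
    {b : Pt → ℝ} {Sen Ben Φbd0 ΦbdL pex : ℝ → ℝ} {ρ u v p Φ : Pt → ℝ} {ω : ℝ≥0∞}
    (hbg : Background γ 𝔭 cv b₀ J₀ S₀ E₀ ρ₀ L ν₀ ρlow ρhigh ρb Eb) (hα : α ∈ Ioo (0:ℝ) 1)
    (hC : 0 < C) (hσ : 0 < σ) (hA : 0 ≤ A)
    (hd₁ : ∀ t ∈ Ioo 0 L, HasDerivAt ρb (deriv ρb t) t ∧ |deriv ρb t| ≤ A)
    (hd₂ : ∀ t ∈ Ioo 0 L, HasDerivAt (fun t => J₀ / ρb t) (deriv (fun t => J₀ / ρb t) t) t ∧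
        |deriv (fun t => J₀ / ρb t) t| ≤ A)
    (hd₃ : ∀ t ∈ Ioo 0 L, |Eb t| ≤ A)
    (h : EPSol γ 𝔭 cv L b Sen Ben Φbd0 ΦbdL pex ρ u v p Φ)
    (hest : EPEst γ 𝔭 cv J₀ S₀ L α C ρb Eb ρ u v p Φ ω) (hω : ω ≤ ENNReal.ofReal σ) :
    CloseTo L α (𝔭 * exp (S₀ / cv)) γ J₀ (C * σ) A ρb ρ u v p Φ := by
  have hL := hbg.hL
  have hδ : 0 ≤ C * σ := by positivity
  have hω' : ENNReal.ofReal C * ω ≤ ENNReal.ofReal (C * σ) := by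
    rw [ENNReal.ofReal_mul hC.le]
    exact mul_le_mul_right hω _
  obtain ⟨hρ, hu, hv, hp, hΦ, -, -, -, -, -⟩ := h
  replace hρ := hρ.C1R hL
  replace hu := hu.C1R hL
  replace hv := hv.C1R hL
  replace hp := hp.C1R hL
  have hΦ1 : C1R L Φ := fun x hx =>
    (hΦ.contDiffAt (by rwa [closure_Noz hL])).of_le (by norm_num)
  have hest' := hest.trans hω'
  have n5 := le_add_self.trans hest'
  have hest4 := le_self_add.trans hest'
  have n4 := le_add_self.trans hest4
  have hest3 := le_self_add.trans hest4
  have n3 := le_add_self.trans hest3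
  have hest2 := le_self_add.trans hest3
  have n2 := le_add_self.trans hest2
  have n1 := le_self_add.trans hest2
  have b1 := bounds_of_whNorm_sub hL hα hδ hA hρ hd₁ n1
  have b2 := bounds_of_whNorm_sub hL hα hδ hA hu (g := fun t => J₀ / ρb t) hd₂ n2
  have b3 := bounds_of_whNorm_sub (f := v) (g := fun _ => 0) hL hα hδ le_rfl hv
    (fun t _ => by simpa using hasDerivAt_const t (0:ℝ)) (by simpa using n3)
  have b4 := bounds_of_whNorm_one hα hδ n4
  have b5 := bounds_of_whNorm_two hα hδ n5
  have cρb : ContinuousOn (fun x : Pt => ρb x.1) (Rect L) :=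
    hbg.smooth_rho.continuousOn.comp continuousOn_fst fun x hx => hx.1
  have hρb : ∀ x ∈ Rect L, 0 < ρb x.1 := fun x hx =>
    hbg.hρlow.trans_le (hbg.bound_lo _ hx.1)
  have hPhi : ∀ x ∈ Noz L, |pd1 Φ x| ≤ C * σ + A ∧ |pd2 Φ x| ≤ C * σ := by
    intro x hx
    have hd := hasDerivAt_integral_of_continuousOn hbg.smooth_E.continuousOn hx.1
    have dΦ := hΦ1.differentiableAt (Noz_subset_Rect L hx)
    have h1 := b5 x hx
    have e1 : pd1 (fun y => Φ y - Phi0 Eb y) x = pd1 Φ x - Eb x.1 := pd1_sub_comp_fst dΦ hd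
    have e2 : pd2 (fun y => Φ y - Phi0 Eb y) x = pd2 Φ x := pd2_sub_comp_fst dΦ hd
    rw [e1, e2] at h1
    refine ⟨?_, h1.2⟩
    have := abs_sub_abs_le_abs_sub (pd1 Φ x) (Eb x.1)
    linarith [hd₃ x.1 hx.1]
  constructor
  · exact le_on_Rect hL (hρ.continuousOn.sub cρb).abs continuousOn_const fun x hx => (b1 x hx).1
  · exact le_on_Rect hL (hu.continuousOn.sub
      (continuousOn_const.div cρb fun x hx => (hρb x hx).ne')).abs continuousOn_const
      fun x hx => (b2 x hx).1
  · exact le_on_Rect hL hv.continuousOn.abs continuousOn_const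
      fun x hx => by simpa using (b3 x hx).1
  · exact le_on_Rect hL (hp.continuousOn.sub (continuousOn_const.mul
      (cρb.rpow_const fun x hx => Or.inl (hρb x hx).ne'))).abs continuousOn_const
      fun x hx => (b4 x hx).1
  · exact fun x hx => (b1 x hx).2.2
  · exact fun x hx => (b2 x hx).2.1
  · exact fun x hx => (b2 x hx).2.2
  · exact fun x hx => by simpa using (b3 x hx).2.1
  · exact fun x hx => (b3 x hx).2.2
  · exact le_on_Rect hL hΦ1.continuousOn_pd1.abs continuousOn_const fun x hx => (hPhi x hx).1
  · exact le_on_Rect hL hΦ1.continuousOn_pd2.abs continuousOn_const fun x hx => (hPhi x hx).2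

/-! ### Solutions near the background are flows -/

theorem pd2_eq_deriv_of_slice {a t : ℝ} {f : Pt → ℝ} {g : ℝ → ℝ} (hf : DifferentiableAt ℝ f (a, t))
    (ht : t ∈ Ioo (0:ℝ) 1) (h : ∀ y ∈ Icc (0:ℝ) 1, f (a, y) = g y) : pd2 f (a, t) = deriv g t := by
  have hd : HasDerivAt (fun y => f (a, y)) (pd2 f (a, t)) t := hasDerivAt_snd (x := (a, t)) hf
  rw [← hd.deriv]
  refine Filter.EventuallyEq.deriv_eq ?_
  filter_upwards [Icc_mem_nhds ht.1 ht.2] with y hy using h y hy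

theorem abs_exit_le {L B : ℝ} (hL : 0 < L) {g : Pt → ℝ} (hg : ContinuousOn g (Rect L)) {y : ℝ}
    (hy : y ∈ Ioo (0:ℝ) 1) (h : ∀ x ∈ Noz L, x.2 = y → |g x| ≤ B) : |g (L, y)| ≤ B := by
  have hc : ContinuousOn (fun t => |g (t, y)|) (closure (Ioo 0 L)) := by
    rw [closure_Ioo hL.ne]
    exact (hg.slice_snd (Ioo_subset_Icc_self hy)).abs
  have hmem : L ∈ closure (Ioo 0 L) := by
    rw [closure_Ioo hL.ne]
    exact right_mem_Icc.2 hL.le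
  exact le_on_closure (fun t ht => h (t, y) ⟨ht, hy⟩ rfl) hc continuousOn_const hmem

theorem abs_mul_le_on_Rect {L α A B : ℝ} (hL : 0 < L) (hα : 1 / 2 < α) (hA : 0 ≤ A) (hB : 0 ≤ B)
    {v g : Pt → ℝ} (hv : ContinuousOn v (Rect L)) (hg : ContinuousOn g (Rect L))
    (hvb : ∀ x ∈ Noz L, |v x| ≤ A * wallDist x.2 ^ α)
    (hgb : ∀ x ∈ Noz L, |g x| ≤ B * wallDist x.2 ^ (α - 1)) : ∀ x ∈ Rect L, |v x * g x| ≤ A * B :=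
  le_on_Rect hL (hv.mul hg).abs continuousOn_const fun x hx =>
    abs_mul_le_of_wallDist hα hx.2 hA hB (hvb x hx) (hgb x hx)

section flow

variable {γ 𝔭 cv L : ℝ} {b : Pt → ℝ} {Sen Ben Φbd0 ΦbdL pex : ℝ → ℝ} {ρ u v p Φ : Pt → ℝ}

theorem EPSol.entropy_entrance (hγ : 1 < γ) (h𝔭 : 0 < 𝔭) (hcv : 0 < cv) (hL : 0 < L)
    (h : EPSol γ 𝔭 cv L b Sen Ben Φbd0 ΦbdL pex ρ u v p Φ) (hp : ∀ x ∈ Rect L, 0 < p x) :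
    ∀ y ∈ Icc (0:ℝ) 1,
      (flowFields γ ρ u v p Φ).s (0, y) = (Sen y / cv + Real.log 𝔭) / γ := by
  intro y hy
  obtain ⟨-, -, -, -, -, hpos, -, -, hbd, -⟩ := h
  have hmem : ((0:ℝ), y) ∈ Rect L := mem_Rect (left_mem_Icc.2 hL.le) hy
  have hρ := (hpos (0, y) (by rwa [closure_Noz hL])).1
  have hp0 := hp _ hmem
  have hS := (hbd y hy).1
  rw [Real.log_div hp0.ne' (by positivity), Real.log_mul h𝔭.ne' (by positivity),
    Real.log_rpow hρ] at hS
  have hγ0 : γ ≠ 0 := by linarith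
  rw [← hS]
  simp only [flowFields]
  field_simp
  ring

theorem EPSol.bernoulli_entrance (h : EPSol γ 𝔭 cv L b Sen Ben Φbd0 ΦbdL pex ρ u v p Φ) :
    ∀ y ∈ Icc (0:ℝ) 1, Φ (0, y) = Φbd0 y ∧ Φ (L, y) = ΦbdL y ∧
      (flowFields γ ρ u v p Φ).K (0, y) = Ben y - Φbd0 y := by
  intro y hy
  obtain ⟨-, -, -, -, -, -, -, h0, hbd, -⟩ := h
  obtain ⟨-, hB, -, h1, h2, -⟩ := hbd y hy
  rw [h0, sub_zero] at h1 h2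
  refine ⟨h1, h2, ?_⟩
  rw [← hB, ← h1]
  rfl

theorem EPSol.isFlow {α C σ A M₀ M κ J : ℝ} {ρb : ℝ → ℝ} (hγ : 1 < γ) (h𝔭 : 0 < 𝔭) (hcv : 0 < cv)
    (hL : 0 < L) (hα : 1 / 2 < α) (hC : 0 ≤ C) (hσ : 0 ≤ σ) (hσ1 : σ ≤ 1) (hA : 0 ≤ A)
    (hM₀ : 1 ≤ M₀) (hM1 : M₀ ≤ M) (hM2 : C + A ≤ M) (hM3 : 2 * M₀ ^ 4 ≤ M)
    (hM4 : M₀ ^ 4 / (cv * γ) ≤ M) (hM5 : C / α * (C + A) ≤ M)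
    (h : EPSol γ 𝔭 cv L b Sen Ben Φbd0 ΦbdL pex ρ u v p Φ)
    (hcl : CloseTo L α κ γ J (C * σ) A ρb ρ u v p Φ)
    (hnear : ∀ x ∈ Rect L, 0 < p x ∧ ρ x ∈ Icc M₀⁻¹ M₀ ∧ u x ∈ Icc M₀⁻¹ M₀ ∧
      |Real.log (p x) / γ - Real.log (ρ x)| ≤ M₀ ∧ |γ * p x / ((γ - 1) * ρ x)| ≤ M₀)
    (hS : ∀ t ∈ Icc (0:ℝ) 1, |deriv Sen t| ≤ σ) (hB : ∀ t ∈ Icc (0:ℝ) 1, |deriv Ben t| ≤ σ)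
    (hΦ : ∀ t ∈ Icc (0:ℝ) 1, |deriv Φbd0 t| ≤ σ) :
    IsFlow γ L M σ (fun y => wallDist y ^ (α - 1)) (flowFields γ ρ u v p Φ) := by
  have hp : ∀ x ∈ Rect L, 0 < p x := fun x hx => (hnear x hx).1
  have hM₀p : 0 < M₀ := by linarith
  have hMp : 0 < M := by linarith
  have hCσ : C * σ ≤ C := mul_le_of_le_one_right hC hσ1
  have hCσ0 : 0 ≤ C * σ := by positivity
  have hα0 : 0 < α := by linarith
  obtain ⟨⟨ch, cs, cK⟩, heul⟩ := EPSol.euler hγ hL h hp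
  have hw0 := EPSol.v_wall hL h (Or.inl rfl)
  have hw1 := EPSol.v_wall hL h (Or.inr rfl)
  have hent := EPSol.entropy_entrance hγ h𝔭 hcv hL h hp
  have hber := EPSol.bernoulli_entrance h
  obtain ⟨rρ, ru, rv, rp, rΦ, hpos, hsys, h00, hbd, -⟩ := h
  have cρ := rρ.C1R hL
  have cu := ru.C1R hL
  have cv' := rv.C1R hL
  have cΦ : ∀ x ∈ Rect L, ContDiffAt ℝ 2 Φ x := fun x hx => by
    rw [← closure_Noz hL] at hx
    exact rΦ.contDiffAt hx
  have mono : Icc M₀⁻¹ M₀ ⊆ Icc M⁻¹ M := Icc_subset_Icc (inv_anti₀ hM₀p hM1) hM1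
  have hm : ∀ x ∈ Rect L, (M₀ ^ 2)⁻¹ ≤ ρ x * u x ∧ ρ x * u x ≤ M₀ ^ 2 := fun x hx => by
    obtain ⟨-, hr, hu, -⟩ := hnear x hx
    have hi : 0 < M₀⁻¹ := by positivity
    constructor
    · rw [← inv_pow, pow_two]
      exact mul_le_mul hr.1 hu.1 hi.le (hi.le.trans hr.1)
    · rw [pow_two]
      exact mul_le_mul hr.2 hu.2 (hi.le.trans hu.1) hM₀p.le
  have hratio : M₀ ^ 2 / (M₀ ^ 2)⁻¹ = M₀ ^ 4 := by
    field_simp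
  have transport : ∀ {K : Pt → ℝ} {A₀ : ℝ}, C1R L K →
      (∀ x ∈ Rect L, u x * pd1 K x + v x * pd2 K x = 0) →
      (∀ t ∈ Ioo (0:ℝ) 1, |pd2 K (0, t)| ≤ A₀) → ∀ x ∈ Rect L, |pd2 K x| ≤ A₀ * M₀ ^ 4 := by
    intro K A₀ hK htr h0
    rw [← hratio]
    refine abs_pd2_le_of_transport hL (by positivity) (cρ.mul cu) (cρ.mul cv') hK
      (fun x hx => (hsys x hx).1) (fun s hs => ?_) (fun s hs => ?_) (fun x hx => ?_)
      (fun x hx => (hm x hx).1) (fun x hx => (hm x hx).2) h0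
    · show ρ (s, 0) * v (s, 0) = 0
      rw [hw0 s hs, mul_zero]
    · show ρ (s, 1) * v (s, 1) = 0
      rw [hw1 s hs, mul_zero]
    · linear_combination ρ x * htr x (Noz_subset_Rect L hx)
  have z0 : (0:ℝ) ∈ Icc 0 L := left_mem_Icc.2 hL.le
  have hK₂ : ∀ x ∈ Rect L, |pd2 (flowFields γ ρ u v p Φ).K x| ≤ M * σ := by
    have h0 : ∀ t ∈ Ioo (0:ℝ) 1, |pd2 (flowFields γ ρ u v p Φ).K (0, t)| ≤ 2 * σ := by
      intro t ht
      have ht' := Ioo_subset_Icc_self ht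
      have hmem : ((0:ℝ), t) ∈ Rect L := mem_Rect z0 ht'
      have dK := cK.differentiableAt hmem
      have dΦ : DifferentiableAt ℝ Φ (0, t) := (cΦ _ hmem).differentiableAt two_ne_zero
      have e1 : pd2 Φ (0, t) = deriv Φbd0 t := pd2_eq_deriv_of_slice dΦ ht fun y hy => (hber y hy).1
      have e2 : pd2 (fun x => (flowFields γ ρ u v p Φ).K x + Φ x) (0, t) = deriv Ben t :=
        pd2_eq_deriv_of_slice (dK.add dΦ) ht fun y hy => by
          rw [(hber y hy).2.2, (hber y hy).1]; ring
      rw [pd2_add dK dΦ, e1] at e2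
      rw [eq_sub_of_add_eq e2]
      calc |deriv Ben t - deriv Φbd0 t| ≤ |deriv Ben t| + |deriv Φbd0 t| := abs_sub _ _
        _ ≤ 2 * σ := by linarith [hB t ht', hΦ t ht']
    intro x hx
    refine (transport cK (fun x hx => (heul x hx).1) h0 x hx).trans ?_
    calc 2 * σ * M₀ ^ 4 = 2 * M₀ ^ 4 * σ := by ring
      _ ≤ M * σ := by gcongr
  have hs₂ : ∀ x ∈ Rect L, |pd2 (flowFields γ ρ u v p Φ).s x| ≤ M * σ := by
    have h0 : ∀ t ∈ Ioo (0:ℝ) 1, |pd2 (flowFields γ ρ u v p Φ).s (0, t)| ≤ σ / (cv * γ) := by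
      intro t ht
      have ht' := Ioo_subset_Icc_self ht
      have hmem : ((0:ℝ), t) ∈ Rect L := mem_Rect z0 ht'
      rw [pd2_eq_deriv_of_slice (cs.differentiableAt hmem) ht hent]
      have hγ0 : 0 < γ := by linarith
      rw [deriv_div_const, deriv_add_const, deriv_div_const, div_div, abs_div,
        abs_of_pos (mul_pos hcv hγ0)]
      gcongr
      exact hS t ht'
    intro x hx
    refine (transport cs (fun x hx => (heul x hx).2.1) h0 x hx).trans ?_
    calc σ / (cv * γ) * M₀ ^ 4 = M₀ ^ 4 / (cv * γ) * σ := by ring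
      _ ≤ M * σ := by gcongr
  have hv₀ : ∀ x ∈ Noz L, |v x| ≤ C / α * wallDist x.2 ^ α := fun x hx => by
    refine (abs_le_wallDist_rpow hα0 cv' hw0 hw1 hcl.v₂ x hx).trans ?_
    have := wallDist_pos hx.2
    gcongr
  have vprod : ∀ {g : Pt → ℝ} {B : ℝ}, ContinuousOn g (Rect L) →
      (∀ x ∈ Noz L, |g x| ≤ B * wallDist x.2 ^ (α - 1)) → B ≤ C + A →
      ∀ x ∈ Rect L, |v x * g x| ≤ M := by
    intro g B hg hgb hBA x hx
    refine (abs_mul_le_on_Rect hL hα (by positivity) (by positivity) cv'.continuousOn hg hv₀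
      (fun x hx => (hgb x hx).trans ?_) x hx).trans hM5
    have := wallDist_pos hx.2
    gcongr
  have exit : ∀ {g : Pt → ℝ}, ContinuousOn g (Rect L) →
      (∀ x ∈ Noz L, |g x| ≤ C * σ * wallDist x.2 ^ (α - 1)) →
      ∀ y ∈ Ioo (0:ℝ) 1, |g (L, y)| ≤ M * σ * wallDist y ^ (α - 1) := by
    intro g hg hgb y hy
    refine (abs_exit_le hL hg hy fun x hx hxy => hxy ▸ hgb x hx).trans ?_
    have := wallDist_pos hy
    gcongr
    linarith
  have exit' : ∀ {g : Pt → ℝ}, ContinuousOn g (Rect L) →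
      (∀ x ∈ Noz L, |g x| ≤ C * σ * wallDist x.2 ^ (α - 1)) →
      ∀ y ∈ Ioo (0:ℝ) 1, |g (L, y)| ≤ M * wallDist y ^ (α - 1) := by
    intro g hg hgb y hy
    refine (exit hg hgb y hy).trans ?_
    have := wallDist_pos hy
    gcongr
    exact mul_le_of_le_one_right hMp.le hσ1
  exact
    { cρ := cρ
      cu := cu
      cv := cv'
      ch := ch
      cs := cs
      cK := cK
      cΦ := cΦ
      h_eq := fun x => by simp only [flowFields, BernFn]; ring
      h_enth := fun x hx => flowFields_h hγ (hpos x (by rwa [closure_Noz hL])).1 (hp x hx)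
      mass := fun x hx => (hsys x hx).1
      trK := fun x hx => (heul x hx).1
      trs := fun x hx => (heul x hx).2.1
      crocco := fun x hx => (heul x hx).2.2
      v_w0 := hw0
      v_w1 := hw1
      v_in := fun y hy => (hbd y hy).2.2.1
      ρ_mem := fun x hx => mono (hnear x hx).2.1
      u_mem := fun x hx => mono (hnear x hx).2.2.1
      h_le := fun x hx => (hnear x hx).2.2.2.2.trans hM1
      s_le := fun x hx => (hnear x hx).2.2.2.1.trans hM1
      v_le := fun x hx => (hcl.v_c x hx).trans (by gcongr; linarith)
      K₂_le := hK₂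
      s₂_le := hs₂
      Φ₁_le := fun x hx => (hcl.Φ₁ x hx).trans (by linarith)
      Φ₂_le := fun x hx => (hcl.Φ₂ x hx).trans (by linarith)
      vu₁_le := vprod cu.continuousOn_pd1 hcl.u₁ (by linarith)
      vu₂_le := vprod cu.continuousOn_pd2 hcl.u₂ (by linarith)
      vv₁_le := vprod cv'.continuousOn_pd1 hcl.v₁ (by linarith)
      vv₂_le := vprod cv'.continuousOn_pd2 hcl.v₂ (by linarith)
      ρ₂_exit := exit' cρ.continuousOn_pd2 hcl.ρ₂
      u₂_exit := exit' cu.continuousOn_pd2 hcl.u₂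
      v₂_exit := exit cv'.continuousOn_pd2 hcl.v₂ }

end flow

theorem EPSol.matched {γ 𝔭 cv L lam : ℝ} {b : Pt → ℝ} {Sen Ben Φbd0 ΦbdL pex : ℝ → ℝ}
    {ρ u v p Φ ρ' u' v' p' Φ' : Pt → ℝ} (hγ : 1 < γ) (h𝔭 : 0 < 𝔭) (hcv : 0 < cv) (hL : 0 < L)
    (h : EPSol γ 𝔭 cv L b Sen Ben Φbd0 ΦbdL pex ρ u v p Φ)
    (h' : EPSol γ 𝔭 cv L b Sen Ben Φbd0 ΦbdL pex ρ' u' v' p' Φ')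
    (hp : ∀ x ∈ Rect L, 0 < p x) (hp' : ∀ x ∈ Rect L, 0 < p' x)
    (hsub : ∀ x ∈ Rect L, ∀ ξ ∈ uIcc (ρ x) (ρ' x),
      lam ≤ γ * (p x / ρ x ^ γ) * ξ ^ (γ - 2) * ((ρ x + ρ' x) / 2) -
        (((u x + u' x) / 2) ^ 2 + ((v x + v' x) / 2) ^ 2)) :
    Matched γ L lam (flowFields γ ρ u v p Φ) (flowFields γ ρ' u' v' p' Φ') := by
  have hent := EPSol.entropy_entrance hγ h𝔭 hcv hL h hp
  have hent' := EPSol.entropy_entrance hγ h𝔭 hcv hL h' hp'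
  have hber := EPSol.bernoulli_entrance h
  have hber' := EPSol.bernoulli_entrance h'
  obtain ⟨-, -, -, -, -, hpos, hsys, -, hbd, hw⟩ := h
  obtain ⟨-, -, -, -, -, hpos', hsys', -, hbd', hw'⟩ := h'
  rw [closure_Noz hL] at hpos hpos'
  exact
    { K_in := fun y hy => by rw [(hber y hy).2.2, (hber' y hy).2.2]
      s_in := fun y hy => by rw [hent y hy, hent' y hy]
      Φ_in := fun y hy => (hber y hy).1.trans (hber' y hy).1.symm
      Φ_ex := fun y hy => (hber y hy).2.1.trans (hber' y hy).2.1.symm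
      p_ex := fun y hy => by
        have hm : (L, y) ∈ Rect L := mem_Rect (right_mem_Icc.2 hL.le) hy
        have e := flowFields_p (u := u) (v := v) (Φ := Φ) hγ (hpos _ hm).1 (hp _ hm)
        have e' := flowFields_p (u := u') (v := v') (Φ := Φ') hγ (hpos' _ hm).1 (hp' _ hm)
        exact e.trans (((hbd y hy).2.2.2.2.2.trans (hbd' y hy).2.2.2.2.2.symm).trans e'.symm)
      poisson := fun x hx => by
        have e := (hsys x hx).2.2.2.2
        have e' := (hsys' x hx).2.2.2.2
        simp only [flowFields]
        rw [e, e']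
        ring
      Φ_w0 := fun t ht =>
        (hw (t, 0) ⟨ht, Or.inl rfl⟩).2.trans (hw' (t, 0) ⟨ht, Or.inl rfl⟩).2.symm
      Φ_w1 := fun t ht =>
        (hw (t, 1) ⟨ht, Or.inr rfl⟩).2.trans (hw' (t, 1) ⟨ht, Or.inr rfl⟩).2.symm
      subsonic := fun x hx ξ hξ => by
        have hρ0 := (hpos x hx).1
        have e := flowFields_p (u := u) (v := v) (Φ := Φ) hγ hρ0 (hp x hx)
        rw [hrho, eq_div_of_mul_eq (rpow_pos_of_pos hρ0 γ).ne' e]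
        exact hsub x hx ξ hξ }

theorem abs_avg_sub_lt {a b c δ : ℝ} (ha : |a - c| < δ) (hb : |b - c| < δ) :
    |(a + b) / 2 - c| < δ := by
  rw [abs_lt] at *
  constructor <;> linarith [ha.1, ha.2, hb.1, hb.2]

theorem abs_sub_lt_of_mem_uIcc {a b c ξ δ : ℝ} (ha : |a - c| < δ) (hb : |b - c| < δ)
    (hξ : ξ ∈ uIcc a b) : |ξ - c| < δ := by
  rw [abs_lt] at *
  rcases mem_uIcc.1 hξ with h | h <;> constructor <;> linarith [ha.1, ha.2, hb.1, hb.2, h.1, h.2]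

/-- Theorem 1, uniqueness. Let `(ρ̄,(ū,0),p̄,Φ₀)` be the subsonic
background solution on `N`, fix `α ∈ (1/2,1)`, `μ ∈ (2,∞)`, and suppose `Φ_bd` satisfies
the compatibility condition at the corner points. Then for the constant `C > 0` of the
existence theorem there exists `σ₂ > 0`, depending only on the data, `α` and `μ`, such
that if `ω₁ + ω₂ + ω₃ + ω₄ ≤ σ₂`, where `ω₄ = ‖(S_en, B_en − Φ_bd) − (S₀,B₀)‖_{W^{2,μ}(Γ₀)}`,
then the solution `(ρ,(u,v),p,Φ)` of the boundary value problem satisfying the stated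
weighted Hölder estimate is unique. -/
theorem stmt2 (γ 𝔭 cv b₀ J₀ S₀ E₀ ρ₀ L ν₀ ρlow ρhigh α μ C : ℝ) (ρb Eb : ℝ → ℝ)
    (hbg : Background γ 𝔭 cv b₀ J₀ S₀ E₀ ρ₀ L ν₀ ρlow ρhigh ρb Eb)
    (hα : α ∈ Ioo (1/2 : ℝ) 1) (hμ : 2 < μ) (hC : 0 < C) :
    ∃ σ₂ > (0:ℝ), ∀ b : Pt → ℝ, ∀ Sen Ben Φbd0 ΦbdL pex : ℝ → ℝ,
      -- compatibility condition `∂_{x₂}Φ_bd = 0` on `Γ̄_w ∩ (Γ̄₀ ∪ Γ̄_L)`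
      deriv Φbd0 0 = 0 → deriv Φbd0 1 = 0 → deriv ΦbdL 0 = 0 → deriv ΦbdL 1 = 0 →
      om1 α b₀ L b + om2 α S₀ (Bern0 γ 𝔭 cv S₀ J₀ ρ₀) Sen Ben
        + om3 γ 𝔭 cv S₀ α L ρb Eb Φbd0 ΦbdL pex
        + ENNReal.ofReal (om4 μ S₀ (Bern0 γ 𝔭 cv S₀ J₀ ρ₀) Sen Ben Φbd0)
        ≤ ENNReal.ofReal σ₂ →
      ∀ ρ u v p Φ ρ' u' v' p' Φ' : Pt → ℝ,
        EPSol γ 𝔭 cv L b Sen Ben Φbd0 ΦbdL pex ρ u v p Φ →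
        EPEst γ 𝔭 cv J₀ S₀ L α C ρb Eb ρ u v p Φ
          (om1 α b₀ L b + om2 α S₀ (Bern0 γ 𝔭 cv S₀ J₀ ρ₀) Sen Ben
            + om3 γ 𝔭 cv S₀ α L ρb Eb Φbd0 ΦbdL pex) →
        EPSol γ 𝔭 cv L b Sen Ben Φbd0 ΦbdL pex ρ' u' v' p' Φ' →
        EPEst γ 𝔭 cv J₀ S₀ L α C ρb Eb ρ' u' v' p' Φ'
          (om1 α b₀ L b + om2 α S₀ (Bern0 γ 𝔭 cv S₀ J₀ ρ₀) Sen Ben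
            + om3 γ 𝔭 cv S₀ α L ρb Eb Φbd0 ΦbdL pex) →
        EqOn ρ ρ' (closure (Noz L)) ∧ EqOn u u' (closure (Noz L)) ∧
        EqOn v v' (closure (Noz L)) ∧ EqOn p p' (closure (Noz L)) ∧
        EqOn Φ Φ' (closure (Noz L)) := by
  have hγ := hbg.hγ
  have hL := hbg.hL
  have hα0 : 0 < α := by linarith [hα.1]
  obtain ⟨A, hA, hd₁, hd₂, hd₃⟩ := exists_background_deriv_bound hbg
  obtain ⟨M₀, lam, δ₀, hM₀, hlam, hlam1, hδ₀, hnear⟩ :=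
    exists_bounds_near_background (R := ρb '' Icc 0 L) (κ := 𝔭 * exp (S₀ / cv))
      (isCompact_Icc.image_of_continuousOn hbg.smooth_rho.continuousOn) hγ
      (mul_pos hbg.h𝔭 (exp_pos _)) hbg.hJ₀ hbg.hν₀ hbg.hρlow
      (by rintro _ ⟨t, ht, rfl⟩; exact hbg.bound_lo t ht)
      (by rintro _ ⟨t, ht, rfl⟩; rw [← mul_assoc γ]; exact hbg.subsonic t ht)
  obtain ⟨M, hM⟩ : ∃ M : ℝ, M = M₀ + (C + A) + 2 * M₀ ^ 4 + M₀ ^ 4 / (cv * γ) + C / α * (C + A) +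
      ∫ y in (0:ℝ)..1, (wallDist y ^ (α - 1)) ^ 2 := ⟨_, rfl⟩
  have n1 : 0 ≤ C + A := by positivity
  have n2 : 0 ≤ 2 * M₀ ^ 4 := by positivity
  have n3 : 0 ≤ M₀ ^ 4 / (cv * γ) := by
    have := hbg.hcv
    have : 0 < γ := by linarith
    positivity
  have n4 : 0 ≤ C / α * (C + A) := by positivity
  have n5 : 0 ≤ ∫ y in (0:ℝ)..1, (wallDist y ^ (α - 1)) ^ 2 :=
    intervalIntegral.integral_nonneg zero_le_one fun y _ => sq_nonneg _
  obtain ⟨ε₀, hε₀, hε₁, huniq⟩ :=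
    exists_flow_unique (L := L) (M := M) hγ hL (by linarith) hlam hlam1
  obtain ⟨σ, hσ, hσε, hσδ⟩ : ∃ σ : ℝ, 0 < σ ∧ σ ≤ ε₀ ∧ C * σ < δ₀ := by
    refine ⟨min ε₀ (δ₀ / (2 * C)), by positivity, min_le_left _ _, ?_⟩
    calc C * min ε₀ (δ₀ / (2 * C)) ≤ C * (δ₀ / (2 * C)) := by gcongr; exact min_le_right _ _
      _ = δ₀ / 2 := by field_simp
      _ < δ₀ := by linarith
  refine ⟨σ, hσ, ?_⟩
  intro b Sen Ben Φbd0 ΦbdL pex _ _ _ _ hω ρ u v p Φ ρ' u' v' p' Φ' h hest h' hest'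
  have hω₃ := le_self_add.trans hω
  have h₃ := le_add_self.trans hω₃
  have h₂ := (le_add_self.trans le_self_add).trans hω₃
  have hS : ∀ t ∈ Icc (0:ℝ) 1, |deriv Sen t| ≤ σ := fun t ht => by
    simpa using abs_deriv_le_of_h1Norm hσ.le (le_self_add.trans h₂) t ht
  have hB : ∀ t ∈ Icc (0:ℝ) 1, |deriv Ben t| ≤ σ := fun t ht => by
    simpa using abs_deriv_le_of_h1Norm hσ.le (le_add_self.trans h₂) t ht
  have hΦ : ∀ t ∈ Icc (0:ℝ) 1, |deriv Φbd0 t| ≤ σ :=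
    abs_deriv_le_of_wh1Norm hα0 hσ.le ((le_self_add.trans le_self_add).trans h₃)
  have c := EPEst.closeTo hbg ⟨hα0, hα.2⟩ hC hσ hA hd₁ hd₂ hd₃ h hest hω₃
  have c' := EPEst.closeTo hbg ⟨hα0, hα.2⟩ hC hσ hA hd₁ hd₂ hd₃ h' hest' hω₃
  have near : ∀ {ρ u v p Φ : Pt → ℝ},
      CloseTo L α (𝔭 * exp (S₀ / cv)) γ J₀ (C * σ) A ρb ρ u v p Φ →
      ∀ x ∈ Rect L, 0 < p x ∧ ρ x ∈ Icc M₀⁻¹ M₀ ∧ u x ∈ Icc M₀⁻¹ M₀ ∧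
        |Real.log (p x) / γ - Real.log (ρ x)| ≤ M₀ ∧ |γ * p x / ((γ - 1) * ρ x)| ≤ M₀ := by
    intro ρ u v p Φ c x hx
    have hρ := (c.ρ_c x hx).trans_lt hσδ
    obtain ⟨h1, h2, h3, h4, h5, -⟩ := hnear _ (mem_image_of_mem ρb hx.1) _ _ _ _ _ _
      ((c.p_c x hx).trans_lt hσδ) hρ hρ hρ ((c.u_c x hx).trans_lt hσδ) ((c.v_c x hx).trans_lt hσδ)
    exact ⟨h1, h2, h3, h4, h5⟩
  have flow : ∀ {ρ u v p Φ : Pt → ℝ}, EPSol γ 𝔭 cv L b Sen Ben Φbd0 ΦbdL pex ρ u v p Φ →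
      CloseTo L α (𝔭 * exp (S₀ / cv)) γ J₀ (C * σ) A ρb ρ u v p Φ →
      IsFlow γ L M σ (fun y => wallDist y ^ (α - 1)) (flowFields γ ρ u v p Φ) :=
    fun h c => h.isFlow hγ hbg.h𝔭 hbg.hcv hL hα.1 hC.le hσ.le (hσε.trans hε₁) hA hM₀ (by linarith)
      (by linarith) (by linarith) (by linarith) (by linarith) c (near c) hS hB hΦ
  have hp : ∀ x ∈ Rect L, 0 < p x := fun x hx => (near c x hx).1
  have hp' : ∀ x ∈ Rect L, 0 < p' x := fun x hx => (near c' x hx).1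
  have matched := h.matched (lam := lam) hγ hbg.h𝔭 hbg.hcv hL h' hp hp' fun x hx ξ hξ => by
    have hρ := (c.ρ_c x hx).trans_lt hσδ
    have hρ' := (c'.ρ_c x hx).trans_lt hσδ
    have hv : |(v x + v' x) / 2| < δ₀ := by
      simpa using abs_avg_sub_lt (c := 0) (by simpa using (c.v_c x hx).trans_lt hσδ)
        (by simpa using (c'.v_c x hx).trans_lt hσδ)
    exact (hnear _ (mem_image_of_mem ρb hx.1) _ _ _ _ _ _ ((c.p_c x hx).trans_lt hσδ) hρ
      (abs_sub_lt_of_mem_uIcc hρ hρ' hξ) (abs_avg_sub_lt hρ hρ')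
      (abs_avg_sub_lt ((c.u_c x hx).trans_lt hσδ) ((c'.u_c x hx).trans_lt hσδ)) hv).2.2.2.2.2
  have key := huniq σ _ _ _ hσ hσε (flow h c) (flow h' c') matched
    (intervalIntegrable_wall_weight hα.1) (by linarith)
  have hpos := h.2.2.2.2.2.1
  have hpos' := h'.2.2.2.2.2.1
  rw [closure_Noz hL] at hpos hpos' ⊢
  refine ⟨fun x hx => (key x hx).1, fun x hx => (key x hx).2.1, fun x hx => (key x hx).2.2.1,
    fun x hx => ?_, fun x hx => (key x hx).2.2.2.2⟩
  have eρ : ρ x = ρ' x := (key x hx).1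
  rw [← flowFields_p (u := u) (v := v) (Φ := Φ) hγ (hpos x hx).1 (hp x hx),
    ← flowFields_p (u := u') (v := v') (Φ := Φ') hγ (hpos' x hx).1 (hp' x hx),
    (key x hx).2.2.2.1, eρ]
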